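/- Let f and g be polynomial functions on ℝⁿ vanishing at 0, and let h be a semialgebraic homeomorphism between semialgebraic neighbourhoods of 0 in ℝⁿ with h(0) = 0. If h̃(𝒻_f) = 𝒻_g, then F_f(r,a) and F_g(r,a) are semialgebraically homeomorphic for 0 < a ≪ r ≪ 1. -/

import Mathlib

noncomputable section
open Classical Filter Topology

namespace RealMilnor

/-- Semialgebraic subsets of `ℝ^ι`: the Boolean algebra generated by the sets
`{x | P(x) > 0}` for real polynomials `P`. -/
inductive IsRSA (ι : Type) : Set (ι → ℝ) → Prop
  | basic (P : MvPolynomial ι ℝ) : IsRSA ι {x | 0 < MvPolynomial.eval x P}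
  | compl {s : Set (ι → ℝ)} : IsRSA ι s → IsRSA ι sᶜ
  | union {s t : Set (ι → ℝ)} : IsRSA ι s → IsRSA ι t → IsRSA ι (s ∪ t)

/-- The Euclidean norm on `ℝⁿ`. -/
def enorm {n : ℕ} (x : Fin n → ℝ) : ℝ := Real.sqrt (∑ i, x i ^ 2)

/-- An arc in `ℝⁿ`: (a representative of) the germ at `0⁺` of a continuous
semialgebraic map `(0,ε) → ℝⁿ`. -/
def IsArc {n : ℕ} (γ : ℝ → (Fin n → ℝ)) : Prop :=
  ∃ ε : ℝ, 0 < ε ∧ ContinuousOn γ (Set.Ioo 0 ε) ∧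
    IsRSA (Option (Fin n))
      {z | z none ∈ Set.Ioo 0 ε ∧ (fun i => z (some i)) = γ (z none)}

/-- The set `𝒻_f` of arcs `γ` with `lim_{t→0⁺} γ(t) = 0` and `f(γ(t)) = t` for all
sufficiently small `t > 0`. -/
def ArcFib {n : ℕ} (f : (Fin n → ℝ) → ℝ) : Set (ℝ → (Fin n → ℝ)) :=
  {γ | IsArc γ ∧ Filter.Tendsto γ (nhdsWithin 0 (Set.Ioi 0)) (nhds 0) ∧
       ∀ᶠ t in nhdsWithin (0 : ℝ) (Set.Ioi 0), f (γ t) = t}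

/-- The positive Milnor fibre `F_f(r,a) = {x ∈ ℝⁿ : |x| ≤ r, f(x) = a}`. -/
def Fib {n : ℕ} (f : (Fin n → ℝ) → ℝ) (r a : ℝ) : Set (Fin n → ℝ) :=
  {x | enorm x ≤ r ∧ f x = a}

/-- The graph of the restriction of `f : ℝⁿ → ℝ` to `A`. -/
def graphFunOn {n : ℕ} (f : (Fin n → ℝ) → ℝ) (A : Set (Fin n → ℝ)) :
    Set (Option (Fin n) → ℝ) :=
  {z | (fun i => z (some i)) ∈ A ∧ z none = f (fun i => z (some i))}

/-- The graph of the restriction of `φ : ℝⁿ → ℝᵐ` to `A`. -/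
def graphMapOn {n m : ℕ} (φ : (Fin n → ℝ) → (Fin m → ℝ)) (A : Set (Fin n → ℝ)) :
    Set (Fin n ⊕ Fin m → ℝ) :=
  {z | (fun i => z (Sum.inl i)) ∈ A ∧
       (fun j => z (Sum.inr j)) = φ (fun i => z (Sum.inl i))}

/-- `A` and `B` are semialgebraically homeomorphic: there is a semialgebraic
bijection between them, continuous with continuous inverse. -/
def IsSemialgHomeo {n : ℕ} (A B : Set (Fin n → ℝ)) : Prop :=
  ∃ φ ψ : (Fin n → ℝ) → (Fin n → ℝ),
    Set.MapsTo φ A B ∧ Set.MapsTo ψ B A ∧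
    (∀ x ∈ A, ψ (φ x) = x) ∧ (∀ y ∈ B, φ (ψ y) = y) ∧
    ContinuousOn φ A ∧ ContinuousOn ψ B ∧
    IsRSA (Fin n ⊕ Fin n) (graphMapOn φ A) ∧ IsRSA (Fin n ⊕ Fin n) (graphMapOn ψ B)



local notation "sg" => SignType.sign

section

theorem rsa_univ {ι : Type} : IsRSA ι Set.univ := by
  have := (IsRSA.basic (0 : MvPolynomial ι ℝ)).union (IsRSA.basic (0 : MvPolynomial ι ℝ)).compl
  simpa using this

theorem rsa_inter {ι : Type} {s t : Set (ι → ℝ)} (hs : IsRSA ι s) (ht : IsRSA ι t) :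
    IsRSA ι (s ∩ t) := by
  simpa [Set.compl_union] using (hs.compl.union ht.compl).compl

theorem rsa_iUnion {ι : Type} {α : Type*} [Finite α] (s : α → Set (ι → ℝ))
    (h : ∀ i, IsRSA ι (s i)) : IsRSA ι (⋃ i, s i) := by
  have : ∀ t : Set α, t.Finite → IsRSA ι (⋃ i ∈ t, s i) := by
    intro t ht
    induction t, ht using Set.Finite.induction_on with
    | empty => simpa using (rsa_univ (ι := ι)).compl
    | insert _ _ ih => rw [Set.biUnion_insert]; exact (h _).union ih
  simpa using this Set.univ Set.finite_univ

theorem rsa_iInter {ι : Type} {α : Type*} [Finite α] (s : α → Set (ι → ℝ))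
    (h : ∀ i, IsRSA ι (s i)) : IsRSA ι (⋂ i, s i) := by
  have := (rsa_iUnion (fun i => (s i)ᶜ) fun i => (h i).compl).compl
  simpa [Set.compl_iUnion] using this

theorem rsa_sign {ι : Type} (P : MvPolynomial ι ℝ) (σ : SignType) :
    IsRSA ι {x | sg (MvPolynomial.eval x P) = σ} := by
  have h1 := IsRSA.basic P
  have h2 := IsRSA.basic (-P)
  cases σ
  · convert (h1.union h2).compl using 1
    ext x; simp [le_antisymm_iff]
  · convert h2 using 1
    ext x; simp [sign_eq_neg_one_iff]
  · convert h1 using 1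
    ext x; simp [sign_eq_one_iff]

/-- Sign equality on a finite family. -/
theorem rsa_iff {ι : Type} {S : Set (ι → ℝ)} : IsRSA ι S ↔ ∃ A : Finset (MvPolynomial ι ℝ),
    ∀ x y, (∀ P ∈ A, sg (MvPolynomial.eval x P) = sg (MvPolynomial.eval y P)) → x ∈ S → y ∈ S := by
  constructor
  · intro h
    induction h with
    | basic P =>
      refine ⟨{P}, fun x y h hx => ?_⟩
      have := h P (by simp)
      rw [Set.mem_ofPred_eq, ← sign_eq_one_iff] at *
      rw [← this, hx]
    | compl _ ih =>
      obtain ⟨A, hA⟩ := ih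
      exact ⟨A, fun x y h hx hy => hx (hA y x (fun P hP => (h P hP).symm) hy)⟩
    | union _ _ ih1 ih2 =>
      obtain ⟨A, hA⟩ := ih1
      obtain ⟨B, hB⟩ := ih2
      refine ⟨A ∪ B, fun x y h hx => ?_⟩
      rcases hx with hx | hx
      · exact Or.inl (hA x y (fun P hP => h P (by simp [hP])) hx)
      · exact Or.inr (hB x y (fun P hP => h P (by simp [hP])) hx)
  · rintro ⟨A, hA⟩
    have : S = ⋃ σ : {σ : A → SignType // ∃ x ∈ S, ∀ P, σ P = sg (MvPolynomial.eval x P.1)},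
        ⋂ P : A, {y | sg (MvPolynomial.eval y P.1) = σ.1 P} := by
      ext y
      simp only [Set.mem_iUnion, Set.mem_iInter, Set.mem_ofPred_eq, Subtype.exists]
      constructor
      · intro hy
        exact ⟨fun P => sg (MvPolynomial.eval y P.1), ⟨y, hy, fun _ => rfl⟩, fun _ => rfl⟩
      · rintro ⟨σ, ⟨x, hx, hσ⟩, h⟩
        refine hA x y (fun P hP => ?_) hx
        rw [h ⟨P, hP⟩, hσ]
    rw [this]
    exact rsa_iUnion _ fun σ => rsa_iInter _ fun P => rsa_sign _ _

/-- extension of strictly monotone maps on finite sets -/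
theorem oi_ext (A : Finset ℝ) : ∀ k : ℝ → ℝ, StrictMonoOn k A → ∃ e : ℝ ≃o ℝ, ∀ x ∈ A, e x = k x := by
  induction A using Finset.induction_on_max with
  | empty => exact fun k _ => ⟨OrderIso.refl ℝ, by simp⟩
  | insert m A hm ih =>
    intro k hk
    obtain ⟨e, he⟩ := ih k (hk.mono (by simp))
    rcases A.eq_empty_or_nonempty with rfl | hne
    · refine ⟨OrderIso.addRight (k m - m), by simp⟩
    set c := A.max' hne
    have hcA : c ∈ A := A.max'_mem hne
    have hcm : c < m := hm c hcA
    have h1 : e c < e m := e.strictMono hcm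
    have h2 : e c < k m := by rw [he c hcA]; exact hk (by simp [hcA]) (by simp) hcm
    set l := (k m - e c) / (e m - e c)
    have hl : 0 < l := div_pos (by linarith) (by linarith)
    have hl1 : l * (e m - e c) = k m - e c := div_mul_cancel₀ _ (by linarith)
    let G : ℝ → ℝ → ℝ := fun l y => if y ≤ e c then y else e c + l * (y - e c)
    have hG : ∀ l l', 0 < l → 0 < l' → l * l' = 1 → ∀ y, G l (G l' y) = y := by
      intro l l' h h' hh y
      simp only [G]
      split_ifs with h3 h4 h4
      · rfl
      · nlinarith [mul_pos h' (sub_pos.2 (not_le.1 h3))]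
      · linear_combination (y - e c) * hh
    have hmono : ∀ l, 0 < l → StrictMono (G l) := by
      intro l h x y hxy
      simp only [G]
      split_ifs with h3 h4 h4
      · exact hxy
      · nlinarith [mul_pos h (sub_pos.2 (not_le.1 h4))]
      · linarith
      · nlinarith
    let g : ℝ ≃o ℝ := (hmono l hl).orderIsoOfRightInverse (G l) (G l⁻¹)
      (hG _ _ hl (inv_pos.2 hl) (mul_inv_cancel₀ hl.ne'))
    refine ⟨e.trans g, fun x hx => ?_⟩
    have hgx : (e.trans g) x = G l (e x) := rfl
    rw [hgx]
    rcases Finset.mem_insert.1 hx with rfl | hx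
    · simp only [G]
      rw [if_neg (by linarith)]; linarith
    · simp only [G]
      rw [if_pos (e.monotone (A.le_max' x hx)), he x hx]

end


section

open Polynomial in
theorem sg_same {f : ℝ → ℝ} {a b : ℝ} (hf : ContinuousOn f (Set.uIcc a b))
    (h : ∀ x ∈ Set.uIcc a b, f x ≠ 0) : sg (f a) = sg (f b) := by
  have hiv := intermediate_value_uIcc hf
  have h0 : (0 : ℝ) ∉ Set.uIcc (f a) (f b) := fun h' => by
    obtain ⟨x, hx, hx'⟩ := hiv h'; exact h x hx hx'
  have ha := h a Set.left_mem_uIcc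
  have hb := h b Set.right_mem_uIcc
  rw [Set.mem_uIcc] at h0
  push Not at h0
  rcases lt_or_gt_of_ne ha with ha | ha
  · rw [sign_neg ha, sign_neg (h0.1 ha.le)]
  · rw [sign_pos ha]
    rcases lt_or_gt_of_ne hb with hb | hb
    · exact absurd (h0.2 hb.le) (by linarith)
    · rw [sign_pos hb]

open Polynomial in
theorem poly_rolle {p : ℝ[X]} {a b : ℝ} (hab : a < b) (ha : p.eval a = 0) (hb : p.eval b = 0) :
    ∃ c, a < c ∧ c < b ∧ p.derivative.eval c = 0 := by
  obtain ⟨c, hc, h⟩ := exists_hasDerivAt_eq_zero hab (f := fun x => p.eval x)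
    (f' := fun x => p.derivative.eval x) p.continuous.continuousOn (by simp [ha, hb])
    (fun x _ => p.hasDerivAt x)
  exact ⟨c, hc.1, hc.2, h⟩

open Polynomial in
theorem core_cut {p q : ℝ[X]} (e : ℝ ≃o ℝ) (Z : Finset ℝ)
    (hZ : ∀ x, p.derivative.eval x = 0 → x ∈ Z)
    (hs : ∀ z ∈ Z, sg (p.eval z) = sg (q.eval (e z))) (t : ℝ) (ht : p.eval t = 0)
    (hlo : ∃ z ∈ Z, z < t) (hhi : ∃ z ∈ Z, t < z) :
    ∃ y, q.eval y = 0 ∧ ∀ z ∈ Z, (t < z ↔ y < e z) ∧ (z < t ↔ e z < y) := by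
  by_cases htZ : t ∈ Z
  · refine ⟨e t, ?_, fun z _ => by simp⟩
    have := hs t htZ
    rw [ht, sign_zero, eq_comm, sign_eq_zero_iff] at this
    exact this
  have n1 : (Z.filter (· < t)).Nonempty := by
    obtain ⟨z, h1, h2⟩ := hlo; exact ⟨z, by simp [h1, h2]⟩
  have n2 : (Z.filter (t < ·)).Nonempty := by
    obtain ⟨z, h1, h2⟩ := hhi; exact ⟨z, by simp [h1, h2]⟩
  obtain ⟨a, ha, haM⟩ := Finset.exists_max_image _ id n1
  obtain ⟨b, hb, hbM⟩ := Finset.exists_min_image _ id n2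
  simp only [Finset.mem_filter, id] at ha hb haM hbM
  have key : ∀ z ∈ Z, z ≤ a ∨ b ≤ z := by
    intro z hz
    rcases lt_trichotomy z t with h | h | h
    · exact Or.inl (haM z ⟨hz, h⟩)
    · exact absurd (h ▸ hz) htZ
    · exact Or.inr (hbM z ⟨hz, h⟩)
  have hd : ∀ x, a < x → x < b → p.derivative.eval x ≠ 0 := by
    intro x h1 h2 h3
    rcases key x (hZ x h3) with h | h <;> linarith
  obtain ⟨c1, hc1, h1⟩ := exists_hasDerivAt_eq_slope (fun x => p.eval x)
    (fun x => p.derivative.eval x) ha.2 p.continuous.continuousOn (fun x _ => p.hasDerivAt x)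
  obtain ⟨c2, hc2, h2⟩ := exists_hasDerivAt_eq_slope (fun x => p.eval x)
    (fun x => p.derivative.eval x) hb.2 p.continuous.continuousOn (fun x _ => p.hasDerivAt x)
  have hsd := sg_same (f := fun x => p.derivative.eval x) (a := c1) (b := c2)
    p.derivative.continuous.continuousOn (by
      intro x hx
      rw [Set.uIcc_of_le (hc1.2.trans hc2.1).le] at hx
      exact hd x (hc1.1.trans_le hx.1) (hx.2.trans_lt hc2.2))
  simp only [ht] at h1 h2
  have ha' : p.eval a = -(p.derivative.eval c1 * (t - a)) := by
    rw [h1, div_mul_cancel₀ _ (by linarith [ha.2])]; ring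
  have hb' : p.eval b = p.derivative.eval c2 * (b - t) := by
    rw [h2, div_mul_cancel₀ _ (by linarith [hb.2])]; ring
  have s1 := hs a ha.1
  have s2 := hs b hb.1
  have t1 : 0 < t - a := by linarith [ha.2]
  have t2 : 0 < b - t := by linarith [hb.2]
  have hopp : sg (q.eval (e a)) = - sg (q.eval (e b)) ∧ sg (q.eval (e b)) ≠ 0 := by
    rw [← s1, ← s2, ha', hb', Left.sign_neg, sign_mul, sign_mul, sign_pos t1, sign_pos t2, hsd]
    simp [hd c2 (by linarith [hc2.1]) hc2.2]
  have hab : e a < e b := e.strictMono (by linarith)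
  have : ∃ y ∈ Set.uIcc (e a) (e b), q.eval y = 0 := by
    by_contra hcon
    push Not at hcon
    have := sg_same (f := fun x => q.eval x) q.continuous.continuousOn hcon
    simp only [this] at hopp
    rcases hopp with ⟨h3, h4⟩
    revert h3 h4
    generalize sg (q.eval (e b)) = σ
    cases σ <;> decide
  obtain ⟨y, hy, hy0⟩ := this
  rw [Set.uIcc_of_le hab.le] at hy
  have hya : y ≠ e a := by
    rintro rfl
    rw [hy0, sign_zero] at hopp
    revert hopp
    generalize sg (q.eval (e b)) = σ
    cases σ <;> decide
  have hyb : y ≠ e b := by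
    rintro rfl
    rw [hy0] at hopp
    simp at hopp
  have hy1 := lt_of_le_of_ne hy.1 hya.symm
  have hy2 := lt_of_le_of_ne hy.2 hyb
  refine ⟨y, hy0, fun z hz => ?_⟩
  rcases key z hz with h | h
  · have := e.monotone h
    constructor
    · constructor <;> intro <;> linarith
    · constructor <;> intro <;> linarith
  · have := e.monotone h
    constructor
    · constructor <;> intro <;> linarith
    · constructor <;> intro <;> linarith

open Polynomial in
theorem core_gap {p : ℝ[X]} (hp : p ≠ 0) (Z : Finset ℝ)
    (hZ : ∀ x, p.derivative.eval x = 0 → x ∈ Z)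
    (hlo : ∃ z ∈ Z, ∀ t ≤ z, p.eval t ≠ 0) (hhi : ∃ z ∈ Z, ∀ t ≥ z, p.eval t ≠ 0)
    (t : ℝ) (ht : p.eval t ≠ 0) : ∃ z ∈ Z, ∀ x ∈ Set.uIcc t z, p.eval x ≠ 0 := by
  by_contra hcon
  push Not at hcon
  obtain ⟨z1, hz1, hl⟩ := hlo
  obtain ⟨z2, hz2, hr⟩ := hhi
  have n1 : (p.roots.toFinset.filter (· < t)).Nonempty := by
    obtain ⟨x, hx, hx0⟩ := hcon z1 hz1
    refine ⟨x, ?_⟩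
    have h1 : x ≠ t := fun h => ht (h ▸ hx0)
    have h2 : ¬ x ≤ z1 := fun h => hl x h hx0
    rw [Set.mem_uIcc] at hx
    simp only [Finset.mem_filter, Multiset.mem_toFinset, mem_roots hp, IsRoot, hx0, true_and]
    rcases hx with hx | hx
    · exact absurd hx.2 h2
    · exact lt_of_le_of_ne hx.2 h1
  have n2 : (p.roots.toFinset.filter (t < ·)).Nonempty := by
    obtain ⟨x, hx, hx0⟩ := hcon z2 hz2
    refine ⟨x, ?_⟩
    have h1 : x ≠ t := fun h => ht (h ▸ hx0)
    have h2 : ¬ z2 ≤ x := fun h => hr x h hx0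
    rw [Set.mem_uIcc] at hx
    simp only [Finset.mem_filter, Multiset.mem_toFinset, mem_roots hp, IsRoot, hx0, true_and]
    rcases hx with hx | hx
    · exact lt_of_le_of_ne hx.1 h1.symm
    · exact absurd hx.1 h2
  obtain ⟨a, ha, haM⟩ := Finset.exists_max_image _ id n1
  obtain ⟨b, hb, hbM⟩ := Finset.exists_min_image _ id n2
  simp only [Finset.mem_filter, Multiset.mem_toFinset, mem_roots hp, IsRoot, id] at ha hb haM hbM
  obtain ⟨c, h1, h2, h3⟩ := poly_rolle (ha.2.trans hb.2) ha.1 hb.1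
  obtain ⟨x, hx, hx0⟩ := hcon c (hZ c h3)
  rw [Set.mem_uIcc] at hx
  rcases lt_trichotomy x t with h | h | h
  · have := haM x ⟨hx0, h⟩
    rcases hx with hx | hx <;> linarith [hx.1, hx.2]
  · exact ht (h ▸ hx0)
  · have := hbM x ⟨hx0, h⟩
    rcases hx with hx | hx <;> linarith [hx.1, hx.2]

open Polynomial in
theorem core_iso {p q : ℝ[X]} (hp : p ≠ 0) (e : ℝ ≃o ℝ) (Z : Finset ℝ)
    (hZ : ∀ x, p.derivative.eval x = 0 → x ∈ Z)
    (hZ' : ∀ x, q.derivative.eval (e x) = 0 → x ∈ Z)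
    (hs : ∀ z ∈ Z, sg (p.eval z) = sg (q.eval (e z)))
    (hlo : ∃ z ∈ Z, ∀ t ≤ z, p.eval t ≠ 0 ∧ q.eval (e t) ≠ 0)
    (hhi : ∃ z ∈ Z, ∀ t ≥ z, p.eval t ≠ 0 ∧ q.eval (e t) ≠ 0) :
    ∃ e' : ℝ ≃o ℝ, (∀ z ∈ Z, e' z = e z) ∧ ∀ t, sg (p.eval t) = sg (q.eval (e' t)) := by
  obtain ⟨z1, hz1, hl⟩ := hlo
  obtain ⟨z2, hz2, hr⟩ := hhi
  have hcut : ∀ t, p.eval t = 0 →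
      ∃ y, q.eval y = 0 ∧ ∀ z ∈ Z, (t < z ↔ y < e z) ∧ (z < t ↔ e z < y) := fun t ht =>
    core_cut e Z hZ hs t ht ⟨z1, hz1, not_le.1 fun h => (hl t h).1 ht⟩
      ⟨z2, hz2, not_le.1 fun h => (hr t h).1 ht⟩
  have hcut' : ∀ t, q.eval t = 0 →
      ∃ y, p.eval y = 0 ∧ ∀ z ∈ Z, (t < e z ↔ y < z) ∧ (e z < t ↔ z < y) := by
    intro t ht
    have := core_cut (p := q) (q := p) e.symm (Z.image e) (by
      intro x hx
      rw [Finset.mem_image]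
      exact ⟨e.symm x, hZ' _ (by simpa using hx), by simp⟩) (by
      intro z hz
      obtain ⟨w, hw, rfl⟩ := Finset.mem_image.1 hz
      simp [hs w hw]) t ht
      ⟨e z1, Finset.mem_image_of_mem _ hz1, not_le.1 fun h => (hl (e.symm t) (by
        rw [e.symm_apply_le]; exact h)).2 (by simpa using ht)⟩
      ⟨e z2, Finset.mem_image_of_mem _ hz2, not_le.1 fun h => (hr (e.symm t) (by
        rw [ge_iff_le, e.le_symm_apply]; exact h)).2 (by simpa using ht)⟩
    simpa using this
  choose! Y hY0 hY using hcut
  let k : ℝ → ℝ := fun t => if t ∈ Z then e t else Y t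
  have hk : ∀ t, (t ∈ Z ∨ p.eval t = 0) → ∀ z ∈ Z, (t < z ↔ k t < e z) ∧ (z < t ↔ e z < k t) := by
    intro t ht z hz
    by_cases h : t ∈ Z
    · simp [k, h]
    · simp only [k, if_neg h]
      exact hY t (ht.resolve_left h) z hz
  have hA : ∀ t, t ∈ Z ∪ p.roots.toFinset ↔ (t ∈ Z ∨ p.eval t = 0) := by
    intro t; simp [hp]
  obtain ⟨e', he'⟩ := oi_ext (Z ∪ p.roots.toFinset) k (by
    intro x hx y hy hxy
    have hx := (hA x).1 hx
    have hy := (hA y).1 hy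
    have : ∃ z ∈ Z, x ≤ z ∧ z ≤ y := by
      by_cases h : x ∈ Z
      · exact ⟨x, h, le_rfl, hxy.le⟩
      by_cases h' : y ∈ Z
      · exact ⟨y, h', hxy.le, le_rfl⟩
      obtain ⟨c, h1, h2, h3⟩ := poly_rolle hxy (hx.resolve_left h) (hy.resolve_left h')
      exact ⟨c, hZ c h3, h1.le, h2.le⟩
    obtain ⟨z, hz, h1, h2⟩ := this
    have e1 := hk x hx z hz
    have e2 := hk y hy z hz
    rcases h1.lt_or_eq with h | h
    · have := e1.1.1 h
      have : e z ≤ k y := not_lt.1 fun h => absurd (e2.1.2 h) (not_lt.2 h2)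
      linarith
    · have := e2.2.1 (h ▸ hxy)
      have : k x ≤ e z := not_lt.1 fun h => absurd (e1.2.2 h) (not_lt.2 h1)
      linarith)
  have heZ : ∀ z ∈ Z, e' z = e z := fun z hz => by
    rw [he' z ((hA z).2 (Or.inl hz))]; simp [k, hz]
  have hk0 : ∀ t, p.eval t = 0 → q.eval (e' t) = 0 := by
    intro t ht
    rw [he' t ((hA t).2 (Or.inr ht))]
    simp only [k]
    split_ifs with h
    · have := hs t h
      rwa [ht, sign_zero, eq_comm, sign_eq_zero_iff] at this
    · exact hY0 t ht
  have hk1 : ∀ t, q.eval (e' t) = 0 → p.eval t = 0 := by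
    intro t ht
    obtain ⟨x, hx, hxc⟩ := hcut' _ ht
    have hxk := hk x (Or.inr hx)
    rw [← he' x ((hA x).2 (Or.inr hx))] at hxk
    rcases lt_trichotomy (e' x) (e' t) with h | h | h
    · obtain ⟨c, h1, h2, h3⟩ := poly_rolle h (hk0 x hx) ht
      have hc := hZ' (e.symm c) (by simpa using h3)
      have q1 := hxk _ hc
      have q2 := hxc _ hc
      simp only [OrderIso.apply_symm_apply] at q1 q2
      exact absurd (q1.1.2 h1) (not_lt.2 (q2.2.1 h2).le)
    · rwa [← e'.injective h]
    · obtain ⟨c, h1, h2, h3⟩ := poly_rolle h ht (hk0 x hx)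
      have hc := hZ' (e.symm c) (by simpa using h3)
      have q1 := hxk _ hc
      have q2 := hxc _ hc
      simp only [OrderIso.apply_symm_apply] at q1 q2
      exact absurd (q1.2.2 h2) (not_lt.2 (q2.1.1 h1).le)
  refine ⟨e', heZ, fun t => ?_⟩
  by_cases ht : p.eval t = 0
  · rw [ht, hk0 t ht]
  · obtain ⟨z, hz, hzt⟩ := core_gap hp Z hZ ⟨z1, hz1, fun t h => (hl t h).1⟩
      ⟨z2, hz2, fun t h => (hr t h).1⟩ t ht
    rw [sg_same p.continuous.continuousOn hzt, hs z hz, ← heZ z hz]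
    refine (sg_same (f := fun x => q.eval x) q.continuous.continuousOn ?_).symm
    intro x hx hx0
    refine hzt (e'.symm x) ?_ (hk1 _ (by simpa using hx0))
    rw [Set.mem_uIcc] at hx ⊢
    simpa only [e'.le_symm_apply, e'.symm_apply_le] using hx

end


section

open Polynomial

theorem far_pos {p : ℝ[X]} (hp : 0 < p.natDegree) :
    ∀ᶠ t in atTop, sg (p.eval t) = sg p.leadingCoeff := by
  have hd : 0 < p.degree := natDegree_pos_iff_degree_pos.1 hp
  have h0 : p.leadingCoeff ≠ 0 := by
    rw [Ne, leadingCoeff_eq_zero]; rintro rfl; simp at hp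
  rcases lt_or_gt_of_ne h0 with h | h
  · filter_upwards [(p.tendsto_atBot_of_leadingCoeff_nonpos hd h.le).eventually_lt_atBot 0] with t ht
    rw [sign_neg ht, sign_neg h]
  · filter_upwards [(p.tendsto_atTop_of_leadingCoeff_nonneg hd h.le).eventually_gt_atTop 0] with t ht
    rw [sign_pos ht, sign_pos h]

theorem far_neg {p : ℝ[X]} (hp : 0 < p.natDegree) :
    ∀ᶠ t in atBot, sg (p.eval t) = sg p.leadingCoeff * sg ((-1 : ℝ) ^ p.natDegree) := by
  have h1 : (p.comp (-X)).natDegree = p.natDegree := by rw [natDegree_comp]; simp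
  have h2 : (p.comp (-X)).leadingCoeff = p.leadingCoeff * (-1) ^ p.natDegree := by
    rw [leadingCoeff_comp (by simp)]; simp
  have := tendsto_neg_atBot_atTop.eventually (far_pos (p := p.comp (-X)) (by rw [h1]; exact hp))
  filter_upwards [this] with t ht
  rw [h2, sign_mul] at ht
  simpa using ht

/-- truncation -/
def tr {R : Type*} [CommRing R] (m : ℕ) (Q : R[X]) : R[X] :=
  ∑ i ∈ Finset.range (m + 1), monomial i (Q.coeff i)

theorem coeff_tr {R : Type*} [CommRing R] (m i : ℕ) (Q : R[X]) :
    (tr m Q).coeff i = if i ≤ m then Q.coeff i else 0 := by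
  simp [tr, coeff_monomial, Finset.sum_ite_eq', Nat.lt_succ_iff]

theorem natDegree_tr {R : Type*} [CommRing R] (m : ℕ) (Q : R[X]) : (tr m Q).natDegree ≤ m := by
  rw [natDegree_le_iff_coeff_eq_zero]
  intro i hi
  rw [coeff_tr, if_neg (by lia)]

theorem map_tr {R : Type*} [CommRing R] (φ : R →+* ℝ) (m : ℕ) (Q : R[X])
    (h : ∀ i, m < i → φ (Q.coeff i) = 0) : (tr m Q).map φ = Q.map φ := by
  ext i
  rw [coeff_map, coeff_map, coeff_tr]
  split_ifs with hi
  · rfl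
  · rw [h i (by lia), map_zero]

theorem pseudo {R : Type*} [CommRing R] (k : ℕ) (Q : R[X]) (hQ : Q.natDegree ≤ k + 1) (n : ℕ) :
    ∀ P : R[X], P.natDegree ≤ n → ∃ (N : ℕ) (S Rm : R[X]),
      C (Q.coeff (k + 1) ^ N) * P = Q * S + Rm ∧ Rm.natDegree ≤ k := by
  induction n with
  | zero => exact fun P hP => ⟨0, 0, P, by simp, by lia⟩
  | succ n ih =>
    intro P hP
    by_cases hn : n + 1 ≤ k
    · exact ⟨0, 0, P, by simp, by lia⟩
    obtain ⟨j, rfl⟩ : ∃ j, n = k + j := ⟨n - k, by lia⟩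
    have := ih (C (Q.coeff (k + 1)) * P - C (P.coeff (k + j + 1)) * (X ^ j * Q)) (by
      refine natDegree_le_pred (n := k + j + 1) ?_ ?_
      · refine (natDegree_sub_le _ _).trans (max_le ?_ ?_)
        · exact (natDegree_C_mul_le _ _).trans hP
        · refine (natDegree_C_mul_le _ _).trans (natDegree_mul_le.trans ?_)
          have := natDegree_X_pow_le (R := R) j
          lia
      · rw [coeff_sub, coeff_C_mul, coeff_C_mul, show k + j + 1 = (k + 1) + j by ring,
          coeff_X_pow_mul]
        ring)
    obtain ⟨N, S, Rm, h1, h2⟩ := this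
    refine ⟨N + 1, S + C (Q.coeff (k + 1) ^ N) * (C (P.coeff (k + j + 1)) * X ^ j), Rm, ?_, h2⟩
    rw [pow_succ, C_mul]
    linear_combination h1

theorem pseudo2 {R : Type*} [CommRing R] (P Q : R[X]) (k : ℕ) : ∃ (Rm : R[X]),
    Rm.natDegree ≤ k ∧ ∃ (N : ℕ) (S : R[X]),
      C (Q.coeff (k + 1) ^ (2 * N)) * P = tr (k + 1) Q * S + Rm := by
  obtain ⟨N, S, Rm, h1, h2⟩ := pseudo k (tr (k + 1) Q) (natDegree_tr _ _) _ P le_rfl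
  rw [coeff_tr, if_pos le_rfl] at h1
  refine ⟨C (Q.coeff (k + 1) ^ N) * Rm, (natDegree_C_mul_le _ _).trans h2, N,
    C (Q.coeff (k + 1) ^ N) * S, ?_⟩
  rw [two_mul, pow_add, C_mul]
  linear_combination C (Q.coeff (k + 1) ^ N) * h1

/-- conclusion of the order iso lemma -/
def HC {R : Type*} [CommRing R] (A : Finset R[X]) (B : Finset R) : Prop :=
  ∀ φ ψ : R →+* ℝ, (∀ b ∈ B, sg (φ b) = sg (ψ b)) → ∃ e : ℝ ≃o ℝ, ∀ P ∈ A, ∀ t,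
    sg ((P.map φ).eval t) = sg ((P.map ψ).eval (e t))

theorem HC_step {R : Type*} [CommRing R] (d : ℕ) (P : R[X]) (K : Finset R[X])
    (hP : P.natDegree = d + 1) (hPK : derivative P ∈ K) (hK : ∀ Q ∈ K, Q.natDegree ≤ d + 1)
    (rem : R[X] → ℕ → R[X])
    (hrem : ∀ Q k, ∃ (N : ℕ) (S : R[X]),
      C (Q.coeff (k + 1) ^ (2 * N)) * P = tr (k + 1) Q * S + rem Q k)
    (φ ψ : R →+* ℝ) (hcP : sg (φ (P.coeff (d + 1))) = sg (ψ (P.coeff (d + 1))))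
    (hc0 : φ (P.coeff (d + 1)) ≠ 0)
    (hcK : ∀ Q ∈ K, ∀ i, sg (φ (Q.coeff i)) = sg (ψ (Q.coeff i)))
    (e : ℝ ≃o ℝ)
    (heK : ∀ Q ∈ K, ∀ t, sg ((Q.map φ).eval t) = sg ((Q.map ψ).eval (e t)))
    (heR : ∀ Q ∈ K, ∀ k ≤ d, ∀ t, sg (((rem Q k).map φ).eval t) = sg (((rem Q k).map ψ).eval (e t))) :
    ∃ e : ℝ ≃o ℝ, (∀ t, sg ((P.map φ).eval t) = sg ((P.map ψ).eval (e t))) ∧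
      ∀ Q ∈ K, ∀ t, sg ((Q.map φ).eval t) = sg ((Q.map ψ).eval (e t)) := by
  have hz : ∀ x y : ℝ, sg x = sg y → (x = 0 ↔ y = 0) := fun x y h => by
    rw [← sign_eq_zero_iff, h, sign_eq_zero_iff]
  have hc0' : ψ (P.coeff (d + 1)) ≠ 0 := fun h => hc0 ((hz _ _ hcP).2 h)
  have hdeg : ∀ χ : R →+* ℝ, χ (P.coeff (d + 1)) ≠ 0 → (P.map χ).natDegree = d + 1 ∧
      (P.map χ).leadingCoeff = χ (P.coeff (d + 1)) := by
    intro χ h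
    have : (P.map χ).natDegree = d + 1 := by
      rw [natDegree_map_of_leadingCoeff_ne_zero, hP]
      rwa [leadingCoeff, hP]
    exact ⟨this, by rw [leadingCoeff, this, coeff_map]⟩
  obtain ⟨d1, l1⟩ := hdeg φ hc0
  obtain ⟨d2, l2⟩ := hdeg ψ hc0'
  have hp0 : P.map φ ≠ 0 := by rintro h; rw [h] at d1; simp at d1
  -- far points
  have e1 : Tendsto e atTop atTop := e.tendsto_atTop
  have e2 : Tendsto e atBot atBot := e.tendsto_atBot
  have f1 : ∀ᶠ t in atTop, sg ((P.map φ).eval t) = sg ((P.map ψ).eval (e t)) ∧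
      (P.map φ).eval t ≠ 0 ∧ (P.map ψ).eval (e t) ≠ 0 := by
    filter_upwards [far_pos (p := P.map φ) (by lia),
      e1.eventually (far_pos (p := P.map ψ) (by lia))] with t h1 h2
    rw [l1] at h1
    rw [l2] at h2
    refine ⟨by rw [h1, h2, hcP], fun h => hc0 ?_, fun h => hc0' ?_⟩
    · exact (hz _ _ h1).1 h
    · exact (hz _ _ h2).1 h
  have f2 : ∀ᶠ t in atBot, sg ((P.map φ).eval t) = sg ((P.map ψ).eval (e t)) ∧
      (P.map φ).eval t ≠ 0 ∧ (P.map ψ).eval (e t) ≠ 0 := by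
    filter_upwards [far_neg (p := P.map φ) (by lia),
      e2.eventually (far_neg (p := P.map ψ) (by lia))] with t h1 h2
    rw [l1, d1, ← sign_mul] at h1
    rw [l2, d2, ← sign_mul] at h2
    refine ⟨by rw [h1, h2, sign_mul, sign_mul, hcP], fun h => hc0 ?_, fun h => hc0' ?_⟩
    · simpa using (hz _ _ h1).1 h
    · simpa using (hz _ _ h2).1 h
  obtain ⟨T1, hT1⟩ := eventually_atTop.1 f1
  obtain ⟨T2, hT2⟩ := eventually_atBot.1 f2
  let Z0 : Finset ℝ := K.biUnion fun Q => (Q.map φ).roots.toFinset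
  let Z : Finset ℝ := insert T1 (insert T2 Z0)
  have hZ0 : ∀ t, t ∈ Z0 ↔ ∃ Q ∈ K, Q.map φ ≠ 0 ∧ (Q.map φ).eval t = 0 := by
    intro t; simp [Z0]
  have hder : (derivative P).map φ ≠ 0 := by
    rw [← derivative_map]
    intro h
    have := derivative_eq_zero.1 h
    lia
  have hZ0' : ∀ t, t ∈ Z0 → t ∈ Z := fun t ht => by simp [Z, ht]
  obtain ⟨e', he', hs'⟩ := core_iso (p := P.map φ) (q := P.map ψ) hp0 e Z (by
      intro x hx
      rw [derivative_map] at hx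
      exact hZ0' _ ((hZ0 x).2 ⟨_, hPK, hder, hx⟩)) (by
      intro x hx
      rw [derivative_map] at hx
      exact hZ0' _ ((hZ0 x).2 ⟨_, hPK, hder, (hz _ _ (heK _ hPK x)).2 hx⟩)) (by
      intro z hzZ
      rcases Finset.mem_insert.1 hzZ with rfl | hzZ
      · exact (hT1 _ le_rfl).1
      rcases Finset.mem_insert.1 hzZ with rfl | hzZ
      · exact (hT2 _ le_rfl).1
      obtain ⟨Q, hQ, hQ0, hQz⟩ := (hZ0 z).1 hzZ
      have hQz' : (Q.map ψ).eval (e z) = 0 := (hz _ _ (heK Q hQ z)).1 hQz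
      obtain ⟨m, hm⟩ : ∃ m, (Q.map φ).natDegree = m + 1 := by
        refine ⟨(Q.map φ).natDegree - 1, ?_⟩
        have : (Q.map φ).natDegree ≠ 0 := by
          intro h
          rw [natDegree_eq_zero] at h
          obtain ⟨c, hc⟩ := h
          rw [← hc] at hQz hQ0
          simp at hQz hQ0
          exact hQ0 hQz
        lia
      have hcm : φ (Q.coeff (m + 1)) ≠ 0 := by
        rw [← coeff_map, ← hm, ← leadingCoeff]
        simpa using hQ0
      have hcm' : ψ (Q.coeff (m + 1)) ≠ 0 := fun h => hcm ((hz _ _ (hcK Q hQ _)).2 h)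
      have hmd : m ≤ d := by
        have := hK Q hQ
        have := natDegree_map_le (f := φ) (p := Q)
        lia
      obtain ⟨N, S, hNS⟩ := hrem Q m
      have g : ∀ (χ : R →+* ℝ) (x : ℝ), χ (Q.coeff (m + 1)) ≠ 0 →
          (∀ i, m + 1 < i → χ (Q.coeff i) = 0) → (Q.map χ).eval x = 0 →
          sg ((P.map χ).eval x) = sg (((rem Q m).map χ).eval x) := by
        intro χ x h1 h2 h3
        have := congrArg (fun F => (F.map χ).eval x) hNS
        simp only [Polynomial.map_mul, Polynomial.map_add, map_C, eval_mul, eval_add, eval_C,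
          map_tr χ _ _ h2, h3, zero_mul, zero_add] at this
        have hp : 0 < (χ (Q.coeff (m + 1)) ^ 2) ^ N := by positivity
        rw [← this, map_pow, sign_mul, pow_mul, sign_pos hp, one_mul]
      have g0 : ∀ i, m + 1 < i → φ (Q.coeff i) = 0 := fun i hi => by
        rw [← coeff_map]; exact coeff_eq_zero_of_natDegree_lt (by lia)
      rw [g φ z hcm g0 hQz, g ψ (e z) hcm' (fun i hi => (hz _ _ (hcK Q hQ i)).1 (g0 i hi)) hQz',
        heR Q hQ m hmd])
    ⟨T2, by simp [Z], fun t ht => (hT2 t ht).2⟩ ⟨T1, by simp [Z], fun t ht => (hT1 t ht).2⟩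
  refine ⟨e', hs', fun Q hQ t => ?_⟩
  by_cases hQ0 : Q.map φ = 0
  · have : Q.map ψ = 0 := by
      ext i
      have h := congrArg (fun F => F.coeff i) hQ0
      simp only [coeff_map, coeff_zero] at h ⊢
      exact (hz _ _ (hcK Q hQ i)).1 h
    rw [hQ0, this]; simp
  by_cases ht : t ∈ Z
  · rw [he' t ht]; exact heK Q hQ t
  rw [heK Q hQ t]
  refine sg_same (f := fun x => (Q.map ψ).eval x) (Q.map ψ).continuous.continuousOn ?_
  intro x hx hx0
  have hxZ : e.symm x ∈ Z := hZ0' _ ((hZ0 _).2 ⟨Q, hQ, hQ0, (hz _ _ (heK Q hQ _)).2 (by simpa using hx0)⟩)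
  have hx' : e' (e.symm x) = x := by rw [he' _ hxZ]; simp
  rw [Set.mem_uIcc] at hx
  rcases lt_trichotomy t (e.symm x) with h | h | h
  · have h1 : e t < x := by simpa using e.strictMono h
    have h2 : e' t < x := by simpa [hx'] using e'.strictMono h
    rcases hx with hx | hx <;> linarith [hx.1, hx.2]
  · exact ht (h ▸ hxZ)
  · have h1 : x < e t := by simpa using e.strictMono h
    have h2 : x < e' t := by simpa [hx'] using e'.strictMono h
    rcases hx with hx | hx <;> linarith [hx.1, hx.2]

theorem HC_exists_aux {R : Type*} [CommRing R] (d : ℕ) : ∀ (n : ℕ) (A : Finset R[X]),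
    (∀ P ∈ A, P.natDegree ≤ d) → (A.filter fun P => P.natDegree = d).card ≤ n → ∃ B, HC A B := by
  induction d with
  | zero =>
    intro n A hA _
    refine ⟨A.image fun P => P.coeff 0, fun φ ψ h => ⟨OrderIso.refl ℝ, fun P hP t => ?_⟩⟩
    have := h (P.coeff 0) (Finset.mem_image_of_mem _ hP)
    rw [eq_C_of_natDegree_le_zero (hA P hP)]
    simpa using this
  | succ d ihd =>
    intro n
    induction n with
    | zero =>
      intro A hA h0
      refine ihd _ A (fun P hP => ?_) le_rfl
      have := hA P hP
      rw [Nat.le_zero, Finset.card_eq_zero, Finset.filter_eq_empty_iff] at h0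
      have := h0 hP
      lia
    | succ n ihn =>
      intro A hA hn
      by_cases hn' : (A.filter fun P => P.natDegree = d + 1).card ≤ n
      · exact ihn A hA hn'
      obtain ⟨P, hP⟩ : (A.filter fun P => P.natDegree = d + 1).Nonempty := by
        rw [← Finset.card_pos]; lia
      rw [Finset.mem_filter] at hP
      obtain ⟨hPA, hPd⟩ := hP
      choose rem hrd hrem using fun Q k => pseudo2 P Q k
      let K := insert (derivative P) (A.erase P)
      have hder : (derivative P).natDegree ≤ d := by
        have := natDegree_derivative_le P; lia
      have hcard : ∀ T : Finset R[X], (∀ F ∈ T, F ∈ A.erase P ∨ F.natDegree ≤ d) →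
          (T.filter fun P => P.natDegree = d + 1).card ≤ n := by
        intro T hT
        have : (T.filter fun P => P.natDegree = d + 1) ⊆
            (A.filter fun P => P.natDegree = d + 1).erase P := by
          intro F hF
          rw [Finset.mem_filter] at hF
          rcases hT F hF.1 with h | h
          · rw [Finset.mem_erase] at h
            simp [h.1, h.2, hF.2]
          · lia
        have h2 := Finset.card_le_card this
        rw [Finset.card_erase_of_mem (by simp [hPA, hPd])] at h2
        lia
      have hdegT : ∀ T : Finset R[X], (∀ F ∈ T, F ∈ A.erase P ∨ F.natDegree ≤ d) →
          ∀ F ∈ T, F.natDegree ≤ d + 1 := by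
        intro T hT F hF
        rcases hT F hF with h | h
        · exact hA F (Finset.mem_of_mem_erase h)
        · lia
      have t1 : ∀ F ∈ insert (tr d P) (A.erase P), F ∈ A.erase P ∨ F.natDegree ≤ d := by
        intro F hF
        rcases Finset.mem_insert.1 hF with rfl | hF
        · exact Or.inr (natDegree_tr _ _)
        · exact Or.inl hF
      have t2 : ∀ F ∈ K ∪ (K ×ˢ Finset.range (d + 1)).image (fun x => rem x.1 x.2),
          F ∈ A.erase P ∨ F.natDegree ≤ d := by
        intro F hF
        rcases Finset.mem_union.1 hF with hF | hF
        · rcases Finset.mem_insert.1 hF with rfl | hF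
          · exact Or.inr hder
          · exact Or.inl hF
        · obtain ⟨x, hx, rfl⟩ := Finset.mem_image.1 hF
          rw [Finset.mem_product, Finset.mem_range] at hx
          have := hrd x.1 x.2
          exact Or.inr (by lia)
      obtain ⟨B1, hB1⟩ := ihn _ (hdegT _ t1) (hcard _ t1)
      obtain ⟨B2, hB2⟩ := ihn _ (hdegT _ t2) (hcard _ t2)
      refine ⟨B1 ∪ B2 ∪ (insert P K).biUnion fun Q => (Finset.range (d + 2)).image Q.coeff,
        fun φ ψ h => ?_⟩
      have hco : ∀ Q ∈ insert P K, ∀ i, sg (φ (Q.coeff i)) = sg (ψ (Q.coeff i)) := by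
        intro Q hQ i
        by_cases hi : i < d + 2
        · refine h _ ?_
          rw [Finset.mem_union, Finset.mem_biUnion]
          exact Or.inr ⟨Q, hQ, Finset.mem_image_of_mem _ (Finset.mem_range.2 hi)⟩
        · have : Q.natDegree ≤ d + 1 := by
            rcases Finset.mem_insert.1 hQ with rfl | hQ
            · lia
            · exact hdegT _ t2 _ (Finset.mem_union_left _ hQ)
          rw [coeff_eq_zero_of_natDegree_lt (by lia)]; simp
      have hcP := hco P (by simp)
      by_cases hc : φ (P.coeff (d + 1)) = 0
      · have hc' : ψ (P.coeff (d + 1)) = 0 := by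
          have := hcP (d + 1)
          rwa [hc, sign_zero, eq_comm, sign_eq_zero_iff] at this
        obtain ⟨e, he⟩ := hB1 φ ψ (fun b hb => h b (by simp [hb]))
        refine ⟨e, fun F hF t => ?_⟩
        by_cases hFP : F = P
        · subst hFP
          have := he (tr d F) (by simp) t
          have aux : ∀ χ : R →+* ℝ, χ (F.coeff (d + 1)) = 0 → ∀ i, d < i → χ (F.coeff i) = 0 := by
            intro χ hχ i hi
            rcases Nat.lt_or_ge (d + 1) i with h | h
            · rw [coeff_eq_zero_of_natDegree_lt (by lia), map_zero]
            · rwa [show i = d + 1 by lia]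
          rwa [map_tr φ _ _ (aux φ hc), map_tr ψ _ _ (aux ψ hc')] at this
        · exact he F (by simp [hFP, hF]) t
      · obtain ⟨e, he⟩ := hB2 φ ψ (fun b hb => h b (by simp [hb]))
        obtain ⟨e', h1, h2⟩ := HC_step d P K hPd (by simp [K])
          (fun Q hQ => hdegT _ t2 _ (Finset.mem_union_left _ hQ)) rem hrem φ ψ (hcP _) hc
          (fun Q hQ => hco Q (by simp [hQ])) e (fun Q hQ => he Q (Finset.mem_union_left _ hQ))
          (fun Q hQ k hk => he _ (Finset.mem_union_right _
            (Finset.mem_image.2 ⟨(Q, k), by simp [hQ]; lia, rfl⟩)))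
        refine ⟨e', fun F hF t => ?_⟩
        by_cases hFP : F = P
        · subst hFP; exact h1 t
        · exact h2 F (by simp [K, hFP, hF]) t

theorem HC_exists {R : Type*} [CommRing R] (A : Finset R[X]) : ∃ B, HC A B :=
  HC_exists_aux (A.sup natDegree) _ A (fun _ hP => Finset.le_sup (f := natDegree) hP) le_rfl

end


section

/-- definable predicates -/
def D {ι : Type} (p : (ι → ℝ) → Prop) : Prop := IsRSA ι {x | p x}

/-- definable functions -/
def DF {ι : Type} (F : (ι → ℝ) → ℝ) : Prop :=
  D fun z : Option ι → ℝ => z none = F fun i => z (some i)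

section
variable {ι κ : Type}

theorem D.congr {p q : (ι → ℝ) → Prop} (h : D p) (hpq : ∀ x, q x ↔ p x) : D q := by
  have : q = p := funext fun x => propext (hpq x)
  rwa [this]
theorem D.and {p q : (ι → ℝ) → Prop} (hp : D p) (hq : D q) : D fun x => p x ∧ q x := rsa_inter hp hq
theorem D.or {p q : (ι → ℝ) → Prop} (hp : D p) (hq : D q) : D fun x => p x ∨ q x := IsRSA.union hp hq
theorem D.not {p : (ι → ℝ) → Prop} (hp : D p) : D fun x => ¬ p x := IsRSA.compl hp
theorem D.imp {p q : (ι → ℝ) → Prop} (hp : D p) (hq : D q) : D fun x => p x → q x :=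
  (hp.not.or hq).congr fun x => by tauto
theorem D.const (p : Prop) : D fun _ : ι → ℝ => p := by
  by_cases h : p
  · exact D.congr (p := fun _ => True) (by unfold D; simpa using rsa_univ (ι := ι)) fun _ => by simp [h]
  · exact D.congr (p := fun _ => ¬ True) (D.not (by unfold D; simpa using rsa_univ (ι := ι)))
      fun _ => by simp [h]
theorem D.alli {α : Type*} [Finite α] {p : α → (ι → ℝ) → Prop} (h : ∀ i, D (p i)) :
    D fun x => ∀ i, p i x := by
  have := rsa_iInter _ h
  unfold D
  convert this using 1
  ext x; simp
theorem D.exi {α : Type*} [Finite α] {p : α → (ι → ℝ) → Prop} (h : ∀ i, D (p i)) :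
    D fun x => ∃ i, p i x := by
  have := rsa_iUnion _ h
  unfold D
  convert this using 1
  ext x; simp

theorem D.pcomap {p : (ι → ℝ) → Prop} (hp : D p) (F : ι → MvPolynomial κ ℝ) :
    D fun z : κ → ℝ => p fun i => MvPolynomial.eval z (F i) := by
  obtain ⟨A, hA⟩ := rsa_iff.1 hp
  have he : ∀ (x : κ → ℝ) P, MvPolynomial.eval x (MvPolynomial.bind₁ F P) =
      MvPolynomial.eval (fun i => MvPolynomial.eval x (F i)) P := by
    intro x P
    exact MvPolynomial.eval₂Hom_bind₁ _ _ _ _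
  refine rsa_iff.2 ⟨A.image (MvPolynomial.bind₁ F), fun x y h hx => hA _ _ (fun P hP => ?_) hx⟩
  rw [← he, ← he]
  exact h _ (Finset.mem_image_of_mem _ hP)

theorem D.comap {p : (ι → ℝ) → Prop} (hp : D p) (σ : ι → κ) : D fun z : κ → ℝ => p fun i => z (σ i) := by
  simpa using hp.pcomap fun i => MvPolynomial.X (σ i)

theorem D.ex {p : (ι → ℝ) → ℝ → Prop}
    (h : D fun z : Option ι → ℝ => p (fun i => z (some i)) (z none)) : D fun x => ∃ t, p x t := by
  obtain ⟨A, hA⟩ := rsa_iff.1 h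
  obtain ⟨B, hB⟩ := HC_exists (A.image (MvPolynomial.optionEquivLeft ℝ ι))
  refine rsa_iff.2 ⟨B, fun x y hxy hx => ?_⟩
  obtain ⟨e, he⟩ := hB (MvPolynomial.eval x) (MvPolynomial.eval y) hxy
  obtain ⟨t, ht⟩ := hx
  have key : ∀ (x : ι → ℝ) t P, MvPolynomial.eval (fun i => Option.elim i t x) P =
      Polynomial.eval t (Polynomial.map (MvPolynomial.eval x) (MvPolynomial.optionEquivLeft ℝ ι P)) :=
    fun x t P => MvPolynomial.optionEquivLeft_elim_eval ..
  have := hA (fun i => Option.elim i t x) (fun i => Option.elim i (e t) y) (fun P hP => by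
    rw [key, key]
    exact he _ (Finset.mem_image_of_mem _ hP) t) ht
  exact ⟨e t, this⟩

theorem D.all {p : (ι → ℝ) → ℝ → Prop}
    (h : D fun z : Option ι → ℝ => p (fun i => z (some i)) (z none)) : D fun x => ∀ t, p x t :=
  (D.ex (p := fun x t => ¬ p x t) h.not).not.congr fun x => by simp

theorem D.exs [Finite κ] : ∀ {ι : Type} {p : (ι → ℝ) → (κ → ℝ) → Prop},
    D (fun z : ι ⊕ κ → ℝ => p (fun i => z (.inl i)) (fun i => z (.inr i))) →
    D fun x => ∃ y, p x y := by
  induction κ using Finite.induction_empty_option with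
  | of_equiv e ih =>
    intro ι p h
    refine (ih (p := fun x y => p x (y ∘ e.symm)) (h.comap (Sum.map id e.symm))).congr fun x => ?_
    constructor
    · rintro ⟨y, hy⟩; exact ⟨y ∘ e, by simpa [Function.comp_assoc] using hy⟩
    · rintro ⟨y, hy⟩; exact ⟨_, hy⟩
  | h_empty =>
    intro ι p h
    refine (h.comap (κ := ι) (Sum.elim id PEmpty.elim)).congr fun x => ?_
    constructor
    · rintro ⟨y, hy⟩
      have : y = fun i => x (Sum.elim id PEmpty.elim (Sum.inr i : ι ⊕ PEmpty)) := Subsingleton.elim _ _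
      exact this ▸ hy
    · intro h; exact ⟨_, h⟩
  | h_option ih =>
    intro ι p h
    refine (ih (p := fun x y => ∃ t, p x (fun i => Option.elim i t y)) (D.ex ?_)).congr fun x => ?_
    · refine (h.comap (Sum.elim (fun i => some (.inl i)) (fun k => Option.elim k none fun k => some (.inr k)))).congr fun z => ?_
      have : ∀ a b c, b = c → (p a b ↔ p a c) := fun a b c h => by rw [h]
      apply this
      ext (_ | _) <;> rfl
    · constructor
      · rintro ⟨y, hy⟩
        refine ⟨fun k => y (some k), y none, ?_⟩
        convert hy using 1
        ext (_ | _) <;> rfl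
      · rintro ⟨y, t, h⟩; exact ⟨_, h⟩

theorem D.comp [Finite κ] {p : (κ → ℝ) → Prop} (hp : D p) {F : κ → (ι → ℝ) → ℝ}
    (hF : ∀ k, DF (F k)) : D fun x => p fun k => F k x := by
  refine (D.exs (κ := κ) (p := fun x y => (∀ k, y k = F k x) ∧ p y) ?_).congr fun x => ?_
  · refine (D.alli fun k => ?_).and (hp.comap Sum.inr)
    exact D.comap (κ := ι ⊕ κ) (hF k) (fun i => Option.elim i (Sum.inr k) Sum.inl)
  · constructor
    · intro h; exact ⟨_, fun k => rfl, h⟩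
    · rintro ⟨y, h1, h2⟩
      rwa [← funext h1]

theorem DF.comap {F : (ι → ℝ) → ℝ} (hF : DF F) (σ : ι → κ) : DF fun z : κ → ℝ => F fun i => z (σ i) := by
  exact D.comap hF (Option.map σ)

theorem D.eqz (q : MvPolynomial ι ℝ) : D fun x => MvPolynomial.eval x q = 0 := by
  unfold D; simpa [sign_eq_zero_iff] using rsa_sign q 0

theorem DF.poly (q : MvPolynomial ι ℝ) : DF fun x => MvPolynomial.eval x q := by
  refine (D.eqz (MvPolynomial.X none - MvPolynomial.rename some q)).congr fun z => ?_
  simp [MvPolynomial.eval_rename, sub_eq_zero, Function.comp_def]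

theorem DF.of_poly {F : (ι → ℝ) → ℝ} (q : MvPolynomial ι ℝ) (h : ∀ x, F x = MvPolynomial.eval x q) :
    DF F := by
  rw [funext h]; exact DF.poly q

theorem DF.proj (i : ι) : DF fun x : ι → ℝ => x i := DF.of_poly (MvPolynomial.X i) (by simp)
theorem DF.const (c : ℝ) : DF fun _ : ι → ℝ => c := DF.of_poly (MvPolynomial.C c) (by simp)

theorem DF.comp [Finite κ] {G : (κ → ℝ) → ℝ} (hG : DF G) {F : κ → (ι → ℝ) → ℝ}
    (hF : ∀ k, DF (F k)) : DF fun x => G fun k => F k x :=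
  D.comp (κ := Option κ) (p := fun z => z none = G fun i => z (some i)) hG
    (F := fun k z => Option.elim k (z none) fun k => F k fun i => z (some i))
    (fun k => by cases k with
      | none => exact DF.proj none
      | some k => exact (hF k).comap some)

theorem D.comp2 {p : ℝ → ℝ → Prop} (hp : D fun z : Fin 2 → ℝ => p (z 0) (z 1)) {F G : (ι → ℝ) → ℝ}
    (hF : DF F) (hG : DF G) : D fun x => p (F x) (G x) :=
  D.comp hp (F := ![F, G]) (by intro k; fin_cases k <;> assumption)

theorem DF.comp2 {g : ℝ → ℝ → ℝ} (hp : DF fun z : Fin 2 → ℝ => g (z 0) (z 1)) {F G : (ι → ℝ) → ℝ}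
    (hF : DF F) (hG : DF G) : DF fun x => g (F x) (G x) :=
  DF.comp hp (F := ![F, G]) (by intro k; fin_cases k <;> assumption)

theorem D.lt {F G : (ι → ℝ) → ℝ} (hF : DF F) (hG : DF G) : D fun x => F x < G x :=
  D.comp2 (p := fun a b => a < b) (by
    have := IsRSA.basic (MvPolynomial.X (1 : Fin 2) - MvPolynomial.X 0 : MvPolynomial (Fin 2) ℝ)
    unfold D; simpa using this) hF hG
theorem D.le {F G : (ι → ℝ) → ℝ} (hF : DF F) (hG : DF G) : D fun x => F x ≤ G x :=
  (D.lt hG hF).not.congr fun x => not_lt.symm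
theorem D.eq {F G : (ι → ℝ) → ℝ} (hF : DF F) (hG : DF G) : D fun x => F x = G x :=
  ((D.le hF hG).and (D.le hG hF)).congr fun x => le_antisymm_iff

theorem DF.add {F G : (ι → ℝ) → ℝ} (hF : DF F) (hG : DF G) : DF fun x => F x + G x :=
  DF.comp2 (g := (· + ·)) (DF.of_poly (MvPolynomial.X 0 + MvPolynomial.X 1) (by simp)) hF hG
theorem DF.sub {F G : (ι → ℝ) → ℝ} (hF : DF F) (hG : DF G) : DF fun x => F x - G x :=
  DF.comp2 (g := (· - ·)) (DF.of_poly (MvPolynomial.X 0 - MvPolynomial.X 1) (by simp)) hF hG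
theorem DF.mul {F G : (ι → ℝ) → ℝ} (hF : DF F) (hG : DF G) : DF fun x => F x * G x :=
  DF.comp2 (g := (· * ·)) (DF.of_poly (MvPolynomial.X 0 * MvPolynomial.X 1) (by simp)) hF hG
theorem DF.pow {F : (ι → ℝ) → ℝ} (hF : DF F) (n : ℕ) : DF fun x => F x ^ n :=
  DF.comp2 (g := fun a _ => a ^ n) (DF.of_poly (MvPolynomial.X 0 ^ n) (by simp)) hF hF
theorem DF.sum {α : Type*} (s : Finset α) {F : α → (ι → ℝ) → ℝ} (hF : ∀ i, DF (F i)) :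
    DF fun x => ∑ i ∈ s, F i x := by
  induction s using Finset.induction_on with
  | empty => simpa using DF.const 0
  | insert a s ha ih => simpa [Finset.sum_insert ha] using (hF a).add ih
theorem DF.of_graph {F : (ι → ℝ) → ℝ} {p : (ι → ℝ) → ℝ → Prop}
    (hp : D fun z : Option ι → ℝ => p (fun i => z (some i)) (z none)) (h : ∀ x t, t = F x ↔ p x t) :
    DF F := hp.congr fun z => h _ _
theorem DF.ite {p : (ι → ℝ) → Prop} {F G : (ι → ℝ) → ℝ} (hp : D p) (hF : DF F) (hG : DF G) :
    DF fun x => if p x then F x else G x := by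
  refine ((D.and (D.comap hp some) hF).or (D.and (D.comap hp.not some) hG)).congr fun z => ?_
  by_cases h : p fun i => z (some i) <;> simp [h]
theorem DF.div {F G : (ι → ℝ) → ℝ} (hF : DF F) (hG : DF G) : DF fun x => F x / G x := by
  refine DF.comp2 (g := (· / ·)) ?_ hF hG
  refine DF.of_graph (p := fun x t => (x 1 = 0 ∧ t = 0) ∨ (x 1 ≠ 0 ∧ t * x 1 = x 0)) ?_ fun x t => ?_
  · exact ((D.eq (DF.proj _) (DF.const 0)).and (D.eq (DF.proj none) (DF.const 0))).or
      ((D.eq (DF.proj _) (DF.const 0)).not.and (D.eq ((DF.proj none).mul (DF.proj _)) (DF.proj _)))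
  · by_cases h : x 1 = 0
    · simp [h]
    · simp [h, eq_div_iff h]
theorem DF.max {F G : (ι → ℝ) → ℝ} (hF : DF F) (hG : DF G) : DF fun x => max (F x) (G x) := by
  simpa only [max_def] using DF.ite (D.le hF hG) hG hF
theorem DF.min {F G : (ι → ℝ) → ℝ} (hF : DF F) (hG : DF G) : DF fun x => min (F x) (G x) := by
  simpa only [min_def] using DF.ite (D.le hF hG) hF hG
theorem DF.abs {F : (ι → ℝ) → ℝ} (hF : DF F) : DF fun x => |F x| := by
  have := hF.max ((DF.const 0).sub hF)
  simpa [abs_eq_max_neg] using this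

end

/-- one-variable definable predicates are eventually constant -/
theorem D.germ {p : ℝ → Prop} (hp : D fun z : Unit → ℝ => p (z ())) :
    (∀ᶠ t in 𝓝[>] (0 : ℝ), p t) ∨ ∀ᶠ t in 𝓝[>] (0 : ℝ), ¬ p t := by
  have main : ∀ S : Set (Unit → ℝ), IsRSA Unit S → (∀ᶠ t in 𝓝[>] (0 : ℝ), (fun _ => t) ∈ S) ∨
      ∀ᶠ t in 𝓝[>] (0 : ℝ), (fun _ => t) ∉ S := by
    intro S hS
    induction hS with
    | basic P =>
      let q : Polynomial ℝ := MvPolynomial.aeval (fun _ => Polynomial.X) P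
      have hq : ∀ t : ℝ, MvPolynomial.eval (fun _ : Unit => t) P = q.eval t := by
        intro t
        have : (Polynomial.evalRingHom t).comp (MvPolynomial.aeval (fun _ : Unit => Polynomial.X)).toRingHom
            = MvPolynomial.eval (fun _ : Unit => t) := by
          ext <;> simp
        rw [← this]; rfl
      by_cases h0 : q = 0
      · right; simp [hq, h0]
      have hev : ∀ᶠ t in 𝓝[>] (0 : ℝ), q.eval t ≠ 0 := by
        have : {x | q.eval x = 0}.Finite := by
          convert q.roots.toFinset.finite_toSet using 1
          ext x; simp [h0]
        have h1 := (this.subset (t := {x | q.eval x = 0} \ {0}) Set.sdiff_subset).isClosed.isOpen_compl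
        have h2 := h1.mem_nhds (x := 0) (by simp)
        filter_upwards [nhdsWithin_le_nhds h2, self_mem_nhdsWithin] with t ht ht' hq
        exact ht ⟨hq, by simpa using (Set.mem_Ioi.1 ht').ne'⟩
      obtain ⟨ε, hε, hev⟩ := mem_nhdsGT_iff_exists_Ioo_subset.1 hev
      have hε : 0 < ε := hε
      have hs : ∀ t ∈ Set.Ioo 0 ε, sg (q.eval (ε / 2)) = sg (q.eval t) := by
        intro t ht
        refine sg_same (f := fun x => q.eval x) q.continuous.continuousOn fun x hx => hev ?_
        exact (Set.ordConnected_Ioo.uIcc_subset ⟨by linarith, by linarith⟩ ht) hx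
      have hI : ∀ᶠ t in 𝓝[>] (0 : ℝ), t ∈ Set.Ioo 0 ε := Ioo_mem_nhdsGT hε
      by_cases hpos : 0 < q.eval (ε / 2)
      · left
        filter_upwards [hI] with t ht
        have := hs t ht
        rw [sign_pos hpos] at this
        show 0 < _
        rw [hq]
        exact sign_eq_one_iff.1 this.symm
      · right
        filter_upwards [hI] with t ht h
        change 0 < _ at h
        rw [hq] at h
        have := hs t ht
        rw [sign_pos h] at this
        exact hpos (sign_eq_one_iff.1 this)
    | compl _ ih => 
      rcases ih with h | h
      · right; simpa using h
      · left; simpa using h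
    | union _ _ ih1 ih2 =>
      rcases ih1 with h | h
      · left; filter_upwards [h] with t ht using Or.inl ht
      rcases ih2 with h' | h'
      · left; filter_upwards [h'] with t ht using Or.inr ht
      · right; filter_upwards [h, h'] with t h1 h2 h3
        exact h3.elim h1 h2
  exact main _ hp

end


section

open Polynomial

theorem clear_den {A : Type*} [CommRing A] [IsDomain A] {α : Type*} (s : Finset α)
    (p : α → (FractionRing A)[X]) : ∃ b : A, b ≠ 0 ∧ ∀ i ∈ s, ∃ q : A[X],
      q.map (algebraMap A (FractionRing A)) = C (algebraMap A (FractionRing A) b) * p i := by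
  induction s using Finset.induction_on with
  | empty => exact ⟨1, one_ne_zero, by simp⟩
  | insert a s ha ih =>
    obtain ⟨b, hb, h⟩ := ih
    obtain ⟨c, hc, h'⟩ : ∃ c : A, c ≠ 0 ∧ ∃ q : A[X],
        q.map (algebraMap A (FractionRing A)) = C (algebraMap A (FractionRing A) c) * p a := by
      obtain ⟨c, hcm, hc⟩ := IsLocalization.integerNormalization_spec (nonZeroDivisors A) (p a)
      refine ⟨c, nonZeroDivisors.ne_zero hcm, IsLocalization.integerNormalization (nonZeroDivisors A) (p a), ?_⟩
      rw [hc]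
      ext i
      rw [coeff_smul, coeff_C_mul, Algebra.smul_def]
    refine ⟨b * c, mul_ne_zero hb hc, fun i hi => ?_⟩
    rcases Finset.mem_insert.1 hi with rfl | hi
    · obtain ⟨q, hq⟩ := h'
      exact ⟨C b * q, by simp [hq, mul_assoc]⟩
    · obtain ⟨q, hq⟩ := h i hi
      exact ⟨C c * q, by simp [hq]; ring⟩

/-- content removal over a fraction field -/
theorem content {A : Type*} [CommRing A] [IsDomain A] {α : Type*} (s : Finset α) (c : α → A[X])
    (h0 : ∃ i ∈ s, c i ≠ 0) : ∃ (m : A) (d : A[X]) (c' v : α → A[X]), m ≠ 0 ∧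
      (∀ i ∈ s, C m * c i = d * c' i) ∧ ∑ i ∈ s, v i * c' i = C m := by
  let K := FractionRing A
  let f := algebraMap A K
  have finj : Function.Injective f := IsFractionRing.injective A K
  let I : Ideal K[X] := Ideal.span (Set.range fun i : s => (c i).map f)
  obtain ⟨g, hg⟩ := (IsPrincipalIdealRing.principal I).principal
  have hgI : g ∈ I := by rw [hg]; exact Submodule.mem_span_singleton_self g
  obtain ⟨u, hu⟩ := Ideal.mem_span_range_iff_exists_fun.1 hgI
  have hdiv : ∀ i : s, ∃ e, (c i).map f = g * e := by
    intro i
    have : (c i).map f ∈ I := Ideal.subset_span ⟨i, rfl⟩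
    rw [hg] at this
    obtain ⟨e, he⟩ := Ideal.mem_span_singleton.1 this
    exact ⟨e, he⟩
  choose e he using hdiv
  have hg0 : g ≠ 0 := by
    rintro rfl
    obtain ⟨i, hi, hi0⟩ := h0
    have := he ⟨i, hi⟩
    rw [zero_mul] at this
    exact hi0 ((Polynomial.map_eq_zero_iff finj).1 this)
  have hue : ∑ i, u i * e i = 1 := by
    apply mul_left_cancel₀ hg0
    rw [mul_one, Finset.mul_sum]
    conv_rhs => rw [← hu]
    exact Finset.sum_congr rfl fun i _ => by rw [he i]; ring
  obtain ⟨b, hb, hq⟩ := clear_den (Finset.univ : Finset (Option (s ⊕ s)))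
    (fun x => Option.elim x g (Sum.elim e u))
  obtain ⟨d, hd⟩ := hq none (by simp)
  choose c' hc' using fun i : s => hq (some (.inl i)) (by simp)
  choose v hv using fun i : s => hq (some (.inr i)) (by simp)
  simp only [Option.elim_none, Option.elim_some, Sum.elim_inl, Sum.elim_inr] at hd hc' hv
  have hc2 : ∀ i, (c' i).map f = C (f b) * e i := hc'
  have hv2 : ∀ i, (v i).map f = C (f b) * u i := hv
  have hd2 : d.map f = C (f b) * g := hd
  have minj := Polynomial.map_injective f finj
  refine ⟨b * b, d, fun i => if h : i ∈ s then c' ⟨i, h⟩ else 0,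
    fun i => if h : i ∈ s then v ⟨i, h⟩ else 0, mul_ne_zero hb hb, fun i hi => ?_, ?_⟩
  · simp only [dif_pos hi]
    apply minj
    simp only [Polynomial.map_mul, map_C, hd2, hc2, he ⟨i, hi⟩, map_mul]
    ring
  · apply minj
    rw [← Finset.sum_attach, Polynomial.map_sum]
    simp only [Finset.coe_mem, dite_true, Polynomial.map_mul, hc2, hv2, map_C, map_mul]
    rw [← Finset.univ_eq_attach]
    calc _ = C (f b) * C (f b) * ∑ i, u i * e i := by
          rw [Finset.mul_sum]; exact Finset.sum_congr rfl fun i _ => by ring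
      _ = _ := by rw [hue, mul_one]

end


section

def nx (A : Finset ℝ) (x : ℝ) : ℝ :=
  if h : (A.filter (x < ·)).Nonempty then (A.filter (x < ·)).min' h else 1
def nd (A : Finset ℝ) : ℕ → ℝ
  | 0 => -1
  | i + 1 => nx A (nd A i)
def cl (x : ℝ) : ℝ := max 0 (min 1 x)
def kap (K : ℕ) (A B : Finset ℝ) (t : ℝ) : ℝ :=
  -1 + ∑ i ∈ Finset.range K, (nd B (i + 1) - nd B i) * cl ((t - nd A i) / (nd A (i + 1) - nd A i))

/-- finite subset of the open interval -/
def Iop (A : Finset ℝ) : Prop := ∀ a ∈ A, a ∈ Set.Ioo (-1 : ℝ) 1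

section
variable {A B : Finset ℝ} {x t : ℝ} {i j : ℕ}

theorem nx_pos (h : (A.filter (x < ·)).Nonempty) :
    nx A x ∈ A ∧ x < nx A x ∧ ∀ a ∈ A, x < a → nx A x ≤ a := by
  have h1 := Finset.min'_mem _ h
  rw [nx, dif_pos h]
  refine ⟨(Finset.mem_filter.1 h1).1, (Finset.mem_filter.1 h1).2, fun a ha hx => Finset.min'_le _ _ ?_⟩
  exact Finset.mem_filter.2 ⟨ha, hx⟩

theorem nx_le {a : ℝ} (ha : a ∈ A) (hx : x < a) : nx A x ≤ a :=
  (nx_pos ⟨a, Finset.mem_filter.2 ⟨ha, hx⟩⟩).2.2 a ha hx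

theorem nd_card (hA : Iop A) : ∀ i ≤ A.card, (A.filter (nd A i < ·)).card = A.card - i := by
  intro i
  induction i with
  | zero =>
    intro _
    have : A.filter (nd A 0 < ·) = A := Finset.filter_true_of_mem fun a ha => (hA a ha).1
    rw [this]; rfl
  | succ i ih =>
    intro h
    have h1 := ih (by omega)
    have h2 : (A.filter (nd A i < ·)).Nonempty := Finset.card_pos.1 (by omega)
    obtain ⟨h3, h4, h5⟩ := nx_pos h2
    have : A.filter (nd A (i + 1) < ·) = (A.filter (nd A i < ·)).erase (nd A (i + 1)) := by
      ext a
      simp only [Finset.mem_filter, Finset.mem_erase]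
      change (a ∈ A ∧ nx A (nd A i) < a) ↔ (a ≠ nx A (nd A i) ∧ _)
      constructor
      · rintro ⟨ha, hl⟩; exact ⟨hl.ne', ha, h4.trans hl⟩
      · rintro ⟨hne, ha, hl⟩; exact ⟨ha, lt_of_le_of_ne (h5 a ha hl) hne.symm⟩
    have h6 : nd A (i + 1) ∈ A.filter (nd A i < ·) := Finset.mem_filter.2 ⟨h3, h4⟩
    rw [this, Finset.card_erase_of_mem h6, h1]; omega

theorem nd_mem (hA : Iop A) (h : i < A.card) : nd A (i + 1) ∈ A ∧ nd A i < nd A (i + 1) := by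
  have h2 : (A.filter (nd A i < ·)).Nonempty := Finset.card_pos.1 (by rw [nd_card hA i h.le]; omega)
  exact ⟨(nx_pos h2).1, (nx_pos h2).2.1⟩

theorem nd_ge (hA : Iop A) : ∀ i, A.card < i → nd A i = 1 := by
  intro i h
  have key : ∀ i, A.card ≤ i → A.filter (nd A i < ·) = ∅ := by
    intro i hi
    induction i, hi using Nat.le_induction with
    | base => exact Finset.card_eq_zero.1 (by rw [nd_card hA _ le_rfl]; omega)
    | succ i hi ih =>
      have : nd A (i + 1) = 1 := by rw [nd, nx, dif_neg (by rw [ih]; simp)]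
      rw [this]
      exact Finset.filter_false_of_mem fun a ha => not_lt.2 (hA a ha).2.le
  obtain ⟨j, rfl⟩ : ∃ j, i = j + 1 := ⟨i - 1, by omega⟩
  rw [nd, nx, dif_neg (by rw [key j (by omega)]; simp)]

theorem nd_lt1 (hA : Iop A) (h : i ≤ A.card) : nd A i < 1 := by
  cases i with
  | zero => rw [nd]; norm_num
  | succ i => exact (hA _ (nd_mem hA h).1).2

theorem nd_lt (hA : Iop A) (h : i ≤ A.card) : nd A i < nd A (i + 1) := by
  rcases h.lt_or_eq with h | h
  · exact (nd_mem hA h).2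
  · rw [nd_ge hA (i + 1) (by omega)]; exact nd_lt1 hA h.le

theorem nd_le (hA : Iop A) (h : i ≤ j) : nd A i ≤ nd A j := by
  refine monotone_nat_of_le_succ (fun n => ?_) h
  rcases le_or_gt n A.card with h | h
  · exact (nd_lt hA h).le
  · rw [nd_ge hA _ h, nd_ge hA _ (h.trans (Nat.lt_succ_self n))]

theorem nd_ge1 (hA : Iop A) (i : ℕ) : -1 ≤ nd A i := nd_le hA (Nat.zero_le i)
theorem nd_le1 (hA : Iop A) (i : ℕ) : nd A i ≤ 1 := by
  rcases le_or_gt i A.card with h | h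
  · exact (nd_lt1 hA h).le
  · rw [nd_ge hA _ h]

theorem nd_loc (hA : Iop A) (h1 : -1 ≤ t) (h2 : t < 1) : ∃ i ≤ A.card, nd A i ≤ t ∧ t < nd A (i + 1) := by
  have h0 : nd A 0 ≤ t := h1
  refine ⟨Nat.findGreatest (fun i => nd A i ≤ t) A.card, Nat.findGreatest_le _,
    Nat.findGreatest_spec (P := fun i => nd A i ≤ t) (Nat.zero_le _) h0, ?_⟩
  rcases (Nat.findGreatest_le (P := fun i => nd A i ≤ t) A.card).lt_or_eq with h | h
  · exact not_le.1 (Nat.findGreatest_is_greatest (P := fun i => nd A i ≤ t) (Nat.lt_succ_self _) h)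
  · rw [h, nd_ge hA _ (Nat.lt_succ_self _)]; exact h2

theorem nd_surj (hA : Iop A) (h : x ∈ A) : ∃ i < A.card, x = nd A (i + 1) := by
  obtain ⟨i, hi, h1, h2⟩ := nd_loc hA (hA x h).1.le (hA x h).2
  have h3 : nd A i = x := by
    by_contra hne
    exact absurd (nx_le h (lt_of_le_of_ne h1 hne)) (not_le.2 h2)
  cases i with
  | zero => rw [nd] at h3; exact absurd (hA x h).1 (by simp [h3])
  | succ i => exact ⟨i, hi, h3.symm⟩

/-- no element strictly between consecutive nodes -/
theorem nd_gap (h : x ∈ A) (h1 : nd A i < x) : nd A (i + 1) ≤ x := nx_le h h1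

theorem nd_uniq (hA : Iop A) {n : ℕ} (x : ℕ → ℝ) (hx : ∀ i < n, x i ∈ A)
    (hm : ∀ i, i + 1 < n → x i < x (i + 1)) (hn : A.card = n) : ∀ i < n, nd A (i + 1) = x i := by
  have hlow : ∀ i < n, nd A (i + 1) ≤ x i := by
    intro i
    induction i with
    | zero => intro h; exact nd_gap (hx 0 h) (hA _ (hx 0 h)).1
    | succ i ih => intro h; exact nd_gap (hx _ h) ((ih (by omega)).trans_lt (hm i h))
  have hmono : ∀ i j, i < j → j < n → x i < x j := by
    intro i j hij hj
    induction j, hij using Nat.le_induction with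
    | base => exact hm i hj
    | succ j hij ih => exact (ih (by omega)).trans (hm j hj)
  intro i hi
  by_contra hne
  have hlt := lt_of_le_of_ne (hlow i hi) hne
  have h1 : ((Finset.Ico i n).image x) ⊆ A.filter (nd A (i + 1) < ·) := by
    intro y hy
    obtain ⟨j, hj, rfl⟩ := Finset.mem_image.1 hy
    rw [Finset.mem_Ico] at hj
    refine Finset.mem_filter.2 ⟨hx j hj.2, hlt.trans_le ?_⟩
    rcases hj.1.eq_or_lt with rfl | h
    · exact le_rfl
    · exact (hmono i j h hj.2).le
  have h2 := Finset.card_le_card h1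
  rw [nd_card hA _ (by omega), Finset.card_image_of_injOn, Nat.card_Ico] at h2
  · omega
  · intro a ha b hb hab
    simp only [Finset.coe_Ico, Set.mem_Ico] at ha hb
    by_contra hne
    rcases lt_or_gt_of_ne hne with h | h
    · exact absurd hab (hmono a b h hb.2).ne
    · exact absurd hab (hmono b a h ha.2).ne'

theorem kap_eq (hA : Iop A) (hB : Iop B) (hc : A.card = B.card) {K : ℕ} (hK : A.card < K) (hi : i ≤ A.card)
    (h1 : nd A i ≤ t) (h2 : t ≤ nd A (i + 1)) :
    kap K A B t = nd B i + (nd B (i + 1) - nd B i) * ((t - nd A i) / (nd A (i + 1) - nd A i)) := by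
  set f : ℕ → ℝ := fun i => (nd B (i + 1) - nd B i) * cl ((t - nd A i) / (nd A (i + 1) - nd A i)) with hf
  have s1 : ∀ j ≤ i, ∑ k ∈ Finset.range j, f k = nd B j - nd B 0 := by
    intro j
    induction j with
    | zero => simp
    | succ j ih =>
      intro hj
      rw [Finset.sum_range_succ, ih (by omega)]
      have hd : 0 < nd A (j + 1) - nd A j := sub_pos.2 (nd_lt hA (by omega))
      have : 1 ≤ (t - nd A j) / (nd A (j + 1) - nd A j) := by
        rw [one_le_div hd]
        linarith [nd_le hA hj]
      simp only [hf, cl, min_eq_left this]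
      norm_num
  have s2 : ∀ j, i + 1 ≤ j → ∑ k ∈ Finset.range j, f k =
      nd B i - nd B 0 + (nd B (i + 1) - nd B i) * ((t - nd A i) / (nd A (i + 1) - nd A i)) := by
    intro j hj
    induction j, hj using Nat.le_induction with
    | base =>
      rw [Finset.sum_range_succ, s1 i le_rfl]
      have hd : 0 < nd A (i + 1) - nd A i := sub_pos.2 (nd_lt hA hi)
      have ha : 0 ≤ (t - nd A i) / (nd A (i + 1) - nd A i) := div_nonneg (by linarith) hd.le
      have hb : (t - nd A i) / (nd A (i + 1) - nd A i) ≤ 1 := by rw [div_le_one hd]; linarith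
      simp only [hf, cl, min_eq_right hb, max_eq_right ha]
    | succ j hj ih =>
      rw [Finset.sum_range_succ, ih]
      have : f j = 0 := by
        rcases le_or_gt j A.card with h | h
        · have hd : 0 < nd A (j + 1) - nd A j := sub_pos.2 (nd_lt hA h)
          have : (t - nd A j) / (nd A (j + 1) - nd A j) ≤ 0 :=
            div_nonpos_of_nonpos_of_nonneg (by linarith [nd_le hA hj]) hd.le
          have h' : (t - nd A j) / (nd A (j + 1) - nd A j) ≤ 1 := this.trans zero_le_one
          simp only [hf, cl, min_eq_right h', max_eq_left this, mul_zero]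
        · simp only [hf]
          rw [nd_ge hB j (by omega), nd_ge hB (j + 1) (by omega)]; simp
      rw [this, add_zero]
  have h0 : nd B 0 = -1 := rfl
  rw [kap, s2 K (by omega), h0]; ring

theorem kap_mono (hA : Iop A) (hB : Iop B) (K : ℕ) : Monotone (kap K A B) := by
  intro a b hab
  unfold kap
  gcongr with i hi
  · exact sub_nonneg.2 (nd_le hB (Nat.le_succ i))
  · unfold cl
    gcongr
    exact sub_nonneg.2 (nd_le hA (Nat.le_succ i))

/-- where a point goes -/
theorem kap_loc (hA : Iop A) (hB : Iop B) (hc : A.card = B.card) {K : ℕ} (hK : A.card < K) (hi : i ≤ A.card)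
    (h1 : nd A i ≤ t) (h2 : t < nd A (i + 1)) : nd B i ≤ kap K A B t ∧ kap K A B t < nd B (i + 1) ∧
      (t = nd A i ↔ kap K A B t = nd B i) ∧ (kap K A B t - nd B i) / (nd B (i + 1) - nd B i) =
      (t - nd A i) / (nd A (i + 1) - nd A i) := by
  rw [kap_eq hA hB hc hK hi h1 h2.le]
  have hd : 0 < nd A (i + 1) - nd A i := sub_pos.2 (nd_lt hA hi)
  have hd' : 0 < nd B (i + 1) - nd B i := sub_pos.2 (nd_lt hB (hc ▸ hi))
  have ha : 0 ≤ (t - nd A i) / (nd A (i + 1) - nd A i) := div_nonneg (by linarith) hd.le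
  have hb : (t - nd A i) / (nd A (i + 1) - nd A i) < 1 := by rw [div_lt_one hd]; linarith
  refine ⟨?_, ?_, ?_, ?_⟩
  · nlinarith
  · nlinarith
  · rw [add_eq_left, mul_eq_zero, div_eq_zero_iff]
    constructor
    · intro h; right; left; linarith
    · rintro (h | h | h) <;> linarith
  · rw [add_sub_cancel_left, mul_div_cancel_left₀ _ hd'.ne']

theorem kap_coc {C : Finset ℝ} (hA : Iop A) (hB : Iop B) (hC : Iop C) (hc : A.card = B.card)
    (hc' : B.card = C.card) {K : ℕ} (hK : A.card < K) (h1 : -1 ≤ t) (h2 : t < 1) :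
    kap K B C (kap K A B t) = kap K A C t := by
  obtain ⟨i, hi, h3, h4⟩ := nd_loc hA h1 h2
  obtain ⟨h5, h6, -, h7⟩ := kap_loc hA hB hc hK hi h3 h4
  rw [kap_eq hB hC hc' (hc ▸ hK) (hc ▸ hi) h5 h6.le, kap_eq hA hC (hc.trans hc') hK hi h3 h4.le, h7]

theorem kap_id (hA : Iop A) {K : ℕ} (hK : A.card < K) (h1 : -1 ≤ t) (h2 : t < 1) : kap K A A t = t := by
  obtain ⟨i, hi, h3, h4⟩ := nd_loc hA h1 h2
  rw [kap_eq hA hA rfl hK hi h3 h4.le, mul_div_cancel₀]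
  · ring
  · linarith [nd_lt hA hi]

theorem kap_strict (hA : Iop A) (hB : Iop B) (hc : A.card = B.card) {K : ℕ} (hK : A.card < K) {s : ℝ} (h1 : -1 ≤ t)
    (h2 : t < s) (h3 : s < 1) : kap K A B t < kap K A B s := by
  refine lt_of_le_of_ne (kap_mono hA hB K h2.le) fun h => h2.ne ?_
  rw [← kap_id hA hK h1 (h2.trans h3), ← kap_coc hA hB hA hc hc.symm hK h1 (h2.trans h3), h,
    kap_coc hA hB hA hc hc.symm hK (h1.trans h2.le) h3, kap_id hA hK (h1.trans h2.le) h3]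

theorem kap_mem (hA : Iop A) (hB : Iop B) (hc : A.card = B.card) {K : ℕ} (hK : A.card < K)
    (h : t ∈ Set.Ioo (-1 : ℝ) 1) : kap K A B t ∈ Set.Ioo (-1 : ℝ) 1 := by
  obtain ⟨i, hi, h3, h4⟩ := nd_loc hA h.1.le h.2
  obtain ⟨h5, h6, -, -⟩ := kap_loc hA hB hc hK hi h3 h4
  refine ⟨?_, h6.trans_le (nd_le1 hB _)⟩
  have h7 : kap K A B (-1) = -1 := by
    rw [kap_eq hA hB hc hK (Nat.zero_le _) (le_refl (-1)) (nd_ge1 hA _)]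
    simp [nd]
  have := kap_strict hA hB hc hK le_rfl h.1 h.2
  rwa [h7] at this
end

end


section

theorem kap_in {A B : Finset ℝ} {t : ℝ} (hA : Iop A) (hB : Iop B) (hc : A.card = B.card) {K : ℕ} (hK : A.card < K)
    (h : t ∈ A) : kap K A B t ∈ B := by
  obtain ⟨i, hi, rfl⟩ := nd_surj hA h
  obtain ⟨-, -, h1, -⟩ := kap_loc hA hB hc hK hi le_rfl (nd_lt hA hi)
  rw [h1.1 rfl]
  exact (nd_mem hB (hc ▸ hi)).1

/-- a family of finite sets with constant cardinality in the first parameter -/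
structure Fam {Y : Type*} [TopologicalSpace Y] (A : ℝ → Y → Finset ℝ) (J : Set ℝ) : Prop where
  op : IsOpen J
  oc : J.OrdConnected
  io : ∀ u y, Iop (A u y)
  card : ∀ u ∈ J, ∀ v ∈ J, ∀ y, (A u y).card = (A v y).card
  lsc : ∀ u ∈ J, ∀ y, ∀ a ∈ A u y, ∀ ε > 0, ∀ᶠ p : ℝ × Y in 𝓝 (u, y), ∃ a' ∈ A p.1 p.2, |a' - a| < ε
  cld : ∀ u ∈ J, ∀ y, ∀ t ∈ Set.Ioo (-1 : ℝ) 1, t ∉ A u y →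
    ∀ᶠ q : (ℝ × Y) × ℝ in 𝓝 ((u, y), t), q.2 ∉ A q.1.1 q.1.2

section
variable {Y : Type*} [TopologicalSpace Y] {A : ℝ → Y → Finset ℝ} {J : Set ℝ}

theorem Fam.nd_cont (h : Fam A J) (y : Y) (i : ℕ) : ContinuousOn (fun u => nd (A u y) i) J := by
  intro u0 hu0
  have hJ : ∀ᶠ u in 𝓝 u0, u ∈ J := h.op.mem_nhds hu0
  refine ContinuousAt.continuousWithinAt ?_
  rcases le_or_gt i (A u0 y).card with hi | hi
  swap
  · refine (continuousAt_const (y := (1 : ℝ))).congr ?_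
    filter_upwards [hJ] with u hu
    exact (nd_ge (h.io u y) i (by rw [h.card u hu u0 hu0]; exact hi)).symm
  cases i with
  | zero => exact continuousAt_const
  | succ i =>
    set n := (A u0 y).card with hn
    set N := nd (A u0 y) with hN
    rw [Metric.continuousAt_iff']
    intro ε hε
    obtain ⟨e, ⟨he, he1⟩, he2⟩ : ∃ e : ℝ, (0 < e ∧ e < ε) ∧ ∀ j ∈ Finset.range n, e < (N (j + 2) - N (j + 1)) / 2 := by
      have h1 : ∀ᶠ e in 𝓝[>] (0 : ℝ), ∀ j ∈ Finset.range n, e < (N (j + 2) - N (j + 1)) / 2 := by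
        refine (Finset.eventually_all _).2 fun j hj => ?_
        have : (0 : ℝ) < (N (j + 2) - N (j + 1)) / 2 :=
          half_pos (sub_pos.2 (nd_lt (h.io _ _) (Finset.mem_range.1 hj)))
        exact nhdsWithin_le_nhds (gt_mem_nhds this)
      have h2 : ∀ᶠ e in 𝓝[>] (0 : ℝ), 0 < e ∧ e < ε := Ioo_mem_nhdsGT hε
      exact (h2.and h1).exists
    have h3 : ∀ᶠ u in 𝓝 u0, ∀ j ∈ Finset.range n, ∃ a' ∈ A u y, |a' - N (j + 1)| < e := by
      refine (Finset.eventually_all _).2 fun j hj => ?_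
      have := h.lsc u0 hu0 y (N (j + 1)) (nd_mem (h.io _ _) (Finset.mem_range.1 hj)).1 e he
      exact (Continuous.tendsto (f := fun u : ℝ => (u, y)) (by fun_prop) u0).eventually this
    filter_upwards [hJ, h3] with u hu h3
    choose! x hx hx' using h3
    have := nd_uniq (h.io u y) x (n := n) (fun j hj => hx j (Finset.mem_range.2 hj)) (fun j hj => ?_)
      (h.card u hu u0 hu0 y) i hi
    · rw [this, Real.dist_eq]
      exact (hx' i (Finset.mem_range.2 hi)).trans he1
    · have a1 := abs_lt.1 (hx' j (Finset.mem_range.2 (by omega)))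
      have a2 := abs_lt.1 (hx' (j + 1) (Finset.mem_range.2 hj))
      have a3 := he2 j (Finset.mem_range.2 (by omega))
      linarith [a1.2, a2.1]

theorem nd_cases {A : Finset ℝ} (hA : Iop A) (i : ℕ) : nd A i = -1 ∨ nd A i = 1 ∨ nd A i ∈ A := by
  rcases le_or_gt i A.card with h | h
  · cases i with
    | zero => left; rfl
    | succ i => right; right; exact (nd_mem hA h).1
  · right; left; exact nd_ge hA i h

theorem Fam.gap (h : Fam A J) {u0 : ℝ} (hu0 : u0 ∈ J) (y0 : Y) {i : ℕ} (hi : i ≤ (A u0 y0).card) {t0 : ℝ}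
    (h1 : nd (A u0 y0) i < t0) (h2 : t0 < nd (A u0 y0) (i + 1)) {η : ℝ} (hη : 0 < η) :
    ∀ᶠ q : (ℝ × Y) × ℝ in 𝓝 ((u0, y0), t0), ∃ l ≤ (A q.1.1 q.1.2).card, nd (A q.1.1 q.1.2) l < q.2 ∧
      q.2 < nd (A q.1.1 q.1.2) (l + 1) ∧ |nd (A q.1.1 q.1.2) l - nd (A u0 y0) i| < η ∧
      |nd (A q.1.1 q.1.2) (l + 1) - nd (A u0 y0) (i + 1)| < η := by
  set a := nd (A u0 y0) i with ha
  set b := nd (A u0 y0) (i + 1) with hb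
  have hA0 := h.io u0 y0
  obtain ⟨e, he0, he1, he2, he3⟩ : ∃ e > 0, e < η ∧ e < t0 - a ∧ e < b - t0 := by
    refine ⟨min η (min (t0 - a) (b - t0)) / 2, ?_, ?_, ?_, ?_⟩
    · have : 0 < min η (min (t0 - a) (b - t0)) := lt_min hη (lt_min (by linarith) (by linarith))
      linarith
    all_goals
      have h3 : 0 < min η (min (t0 - a) (b - t0)) := lt_min hη (lt_min (by linarith) (by linarith))
      have h4 := min_le_left η (min (t0 - a) (b - t0))
      have h5 := (min_le_right η (min (t0 - a) (b - t0))).trans (min_le_left _ _)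
      have h6 := (min_le_right η (min (t0 - a) (b - t0))).trans (min_le_right _ _)
      linarith
  have ha1 : -1 ≤ a := nd_ge1 hA0 _
  have hb1 : b ≤ 1 := nd_le1 hA0 _
  have e1 : ∀ᶠ p : ℝ × Y in 𝓝 (u0, y0), ∀ x ∈ Set.Icc (a + e) (b - e), x ∉ A p.1 p.2 := by
    refine isCompact_Icc.eventually_forall_of_forall_eventually fun x hx => ?_
    refine h.cld u0 hu0 y0 x ⟨by linarith [hx.1], by linarith [hx.2]⟩ fun hxA => ?_
    have := nd_gap hxA (i := i) (by linarith [hx.1])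
    linarith [hx.2]
  have e2 : ∀ᶠ p : ℝ × Y in 𝓝 (u0, y0), a = -1 ∨ ∃ a' ∈ A p.1 p.2, |a' - a| < e := by
    rcases nd_cases hA0 i with h' | h' | h'
    · exact Eventually.of_forall fun _ => Or.inl h'
    · exact absurd h' (nd_lt1 hA0 hi).ne
    · exact (h.lsc u0 hu0 y0 a h' e he0).mono fun _ => Or.inr
  have e3 : ∀ᶠ p : ℝ × Y in 𝓝 (u0, y0), b = 1 ∨ ∃ a' ∈ A p.1 p.2, |a' - b| < e := by
    rcases nd_cases hA0 (i + 1) with h' | h' | h'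
    · exact absurd h' ((nd_ge1 hA0 i).trans_lt (nd_lt hA0 hi)).ne'
    · exact Eventually.of_forall fun _ => Or.inl h'
    · exact (h.lsc u0 hu0 y0 b h' e he0).mono fun _ => Or.inr
  have e4 : ∀ᶠ t in 𝓝 t0, t ∈ Set.Ioo (a + e) (b - e) := Ioo_mem_nhds (by linarith) (by linarith)
  filter_upwards [((e1.and e2).and e3).prod_nhds e4]
  rintro ⟨⟨u, y⟩, t⟩ ⟨⟨⟨k1, k2⟩, k3⟩, k4⟩
  dsimp only at k1 k2 k3 k4 ⊢
  have hA := h.io u y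
  obtain ⟨l, hl, l1, l2⟩ := nd_loc hA (t := t) (by linarith [k4.1]) (by linarith [k4.2])
  have l3 : nd (A u y) l < a + e := by
    by_contra hcon
    rcases nd_cases hA l with h' | h' | h'
    · linarith
    · linarith [k4.2]
    · exact k1 _ ⟨not_lt.1 hcon, by linarith [k4.2]⟩ h'
  have l4 : b - e < nd (A u y) (l + 1) := by
    by_contra hcon
    rcases nd_cases hA (l + 1) with h' | h' | h'
    · linarith [k4.1]
    · linarith
    · exact k1 _ ⟨by linarith [k4.1], not_lt.1 hcon⟩ h'
  refine ⟨l, hl, by linarith [k4.1], l2, abs_lt.2 ⟨?_, by linarith⟩, abs_lt.2 ⟨by linarith, ?_⟩⟩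
  · rcases k2 with k2 | ⟨a', k2, k5⟩
    · linarith [nd_ge1 hA l]
    · have k6 := abs_lt.1 k5
      by_contra hcon
      have := nd_gap k2 (i := l) (by linarith)
      linarith [k4.1]
  · rcases k3 with k3 | ⟨a', k3, k5⟩
    · linarith [nd_le1 hA (l + 1)]
    · have k6 := abs_lt.1 k5
      have := nd_gap k3 (i := l) (by linarith [k4.1, k4.2])
      linarith

theorem nd_gap_unique {A : Finset ℝ} (hA : Iop A) {t : ℝ} {i j : ℕ} (h1 : nd A i < t) (h2 : t < nd A (i + 1))
    (h3 : nd A j < t) (h4 : t < nd A (j + 1)) : i = j := by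
  rcases lt_trichotomy i j with h | h | h
  · linarith [nd_le hA h]
  · exact h
  · linarith [nd_le hA h]

theorem Fam.pt (h : Fam A J) {K : ℕ} (hK : ∀ u y, (A u y).card < K) {u0 v0 : ℝ} (hu0 : u0 ∈ J) (hv0 : v0 ∈ J)
    (y0 : Y) {t1 : ℝ} (ht : t1 ∈ Set.Ioo (-1 : ℝ) 1) (ht' : t1 ∉ A u0 y0) :
    Tendsto (fun p : ℝ × ℝ × Y => kap K (A p.1 p.2.2) (A p.2.1 p.2.2) t1) (𝓝 (u0, v0, y0))
      (𝓝 (kap K (A u0 y0) (A v0 y0) t1)) := by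
  have hA0 := h.io u0 y0
  obtain ⟨i, hi, h1, h2⟩ := nd_loc hA0 ht.1.le ht.2
  have h1 : nd (A u0 y0) i < t1 := by
    refine lt_of_le_of_ne h1 fun heq => ?_
    rcases nd_cases hA0 i with h' | h' | h'
    · linarith [ht.1]
    · linarith [ht.2]
    · exact ht' (heq ▸ h')
  set θ : ℝ → ℝ := fun u => kap K (A u0 y0) (A u y0) t1 with hθ
  have hθ0 : θ u0 = t1 := kap_id hA0 (hK _ _) ht.1.le ht.2
  have hθl : ∀ u ∈ J, nd (A u y0) i < θ u ∧ θ u < nd (A u y0) (i + 1) := by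
    intro u hu
    obtain ⟨a1, a2, a3, -⟩ := kap_loc hA0 (h.io u y0) (h.card u0 hu0 u hu y0) (hK u0 y0) hi h1.le h2
    exact ⟨lt_of_le_of_ne a1 fun h' => h1.ne' (a3.2 h'.symm), a2⟩
  have hθi : ∀ u ∈ J, θ u ∈ Set.Ioo (-1 : ℝ) 1 := fun u hu =>
    kap_mem hA0 (h.io u y0) (h.card u0 hu0 u hu y0) (hK u0 y0) ht
  have hθA : ∀ u ∈ J, θ u ∉ A u y0 := fun u hu hm => by
    linarith [nd_gap hm (hθl u hu).1, (hθl u hu).2]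
  have hθc : ContinuousOn θ J := by
    have : ContinuousOn (fun u => nd (A u y0) i + (nd (A u y0) (i + 1) - nd (A u y0) i) *
        ((t1 - nd (A u0 y0) i) / (nd (A u0 y0) (i + 1) - nd (A u0 y0) i))) J := by
      have a1 := h.nd_cont y0 i
      have a2 := h.nd_cont y0 (i + 1)
      fun_prop
    exact this.congr fun u hu => kap_eq hA0 (h.io u y0) (h.card u0 hu0 u hu y0) (hK u0 y0) hi h1.le h2.le
  have hθa : ∀ u ∈ J, ContinuousAt θ u := fun u hu => hθc.continuousAt (h.op.mem_nhds hu)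
  obtain ⟨c, d, hcd, hc, hd⟩ : ∃ c d, Set.Icc c d ⊆ J ∧ c < min u0 v0 ∧ max u0 v0 < d := by
    have m1 : min u0 v0 ∈ J := by rcases min_choice u0 v0 with h | h <;> rw [h] <;> assumption
    have m2 : max u0 v0 ∈ J := by rcases max_choice u0 v0 with h | h <;> rw [h] <;> assumption
    obtain ⟨c, hc, hcJ⟩ := exists_Ioc_subset_of_mem_nhds (h.op.mem_nhds m1) ⟨_, sub_one_lt _⟩
    obtain ⟨d, hd, hdJ⟩ := exists_Ico_subset_of_mem_nhds (h.op.mem_nhds m2) ⟨_, lt_add_one _⟩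
    refine ⟨(c + min u0 v0) / 2, (d + max u0 v0) / 2, h.oc.out (hcJ ⟨?_, ?_⟩) (hdJ ⟨?_, ?_⟩), ?_, ?_⟩ <;> linarith
  have tube : ∀ᶠ y in 𝓝 y0, ∀ u ∈ Set.Icc c d, θ u ∉ A u y := by
    refine isCompact_Icc.eventually_forall_of_forall_eventually fun u hu => ?_
    have a1 := h.cld u (hcd hu) y0 (θ u) (hθi u (hcd hu)) (hθA u (hcd hu))
    have a2 : Tendsto (fun q : Y × ℝ => ((q.2, q.1), θ q.2)) (𝓝 (y0, u)) (𝓝 ((u, y0), θ u)) := by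
      refine ((continuous_snd.tendsto _).prodMk_nhds (continuous_fst.tendsto _)).prodMk_nhds ?_
      exact (hθa u (hcd hu)).tendsto.comp (continuous_snd.tendsto (y0, u))
    exact a2.eventually a1
  -- index constancy
  have idx : ∀ y, (∀ u ∈ Set.Icc c d, θ u ∉ A u y) → ∀ u ∈ Set.Icc c d, ∀ v ∈ Set.Icc c d, ∀ l,
      sg (θ u - nd (A u y) l) = sg (θ v - nd (A v y) l) := by
    intro y hy u hu v hv l
    have hsub : Set.uIcc u v ⊆ Set.Icc c d := Set.ordConnected_Icc.uIcc_subset hu hv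
    refine sg_same (f := fun u => θ u - nd (A u y) l)
      ((hθc.sub (h.nd_cont y l)).mono (hsub.trans hcd)) fun x hx h0 => ?_
    have hx := hsub hx
    have h0 : θ x = nd (A x y) l := sub_eq_zero.1 h0
    have := hθi x (hcd hx)
    rcases nd_cases (h.io x y) l with h' | h' | h'
    · linarith [this.1]
    · linarith [this.2]
    · exact hy x hx (h0 ▸ h')
  set Φ : ℝ × ℝ × ℝ × ℝ → ℝ := fun q => q.2.2.1 + (q.2.2.2 - q.2.2.1) * ((t1 - q.1) / (q.2.1 - q.1)) with hΦ
  set q0 : ℝ × ℝ × ℝ × ℝ := (nd (A u0 y0) i, nd (A u0 y0) (i + 1), nd (A v0 y0) i, nd (A v0 y0) (i + 1))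
  have hval : kap K (A u0 y0) (A v0 y0) t1 = Φ q0 :=
    kap_eq hA0 (h.io v0 y0) (h.card u0 hu0 v0 hv0 y0) (hK u0 y0) hi h1.le h2.le
  rw [hval]
  intro W hW
  have hΦc : ContinuousAt Φ q0 := by
    have : q0.2.1 - q0.1 ≠ 0 := (sub_pos.2 (h1.trans h2)).ne'
    have a1 : ContinuousAt (fun q : ℝ × ℝ × ℝ × ℝ => (t1 - q.1) / (q.2.1 - q.1)) q0 :=
      ContinuousAt.div (by fun_prop) (by fun_prop) this
    fun_prop
  have hE : ∀ᶠ q in 𝓝 q0, Φ q ∈ W ∧ q.1 < t1 ∧ t1 < q.2.1 := by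
    refine (hΦc.eventually hW).and (Eventually.and ?_ ?_)
    · exact (continuous_fst.tendsto q0).eventually (gt_mem_nhds h1)
    · exact ((continuous_fst.comp continuous_snd).tendsto q0).eventually (lt_mem_nhds h2)
  obtain ⟨η, hη, hE⟩ := Metric.eventually_nhds_iff.1 hE
  have g1 := h.gap hu0 y0 hi h1 h2 hη
  have g2 := h.gap hv0 y0 (h.card u0 hu0 v0 hv0 y0 ▸ hi) (hθl v0 hv0).1 (hθl v0 hv0).2 hη
  have tu : Tendsto (fun p : ℝ × ℝ × Y => ((p.1, p.2.2), θ p.1)) (𝓝 (u0, v0, y0)) (𝓝 ((u0, y0), t1)) := by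
    refine ((continuous_fst.tendsto (u0, v0, y0)).prodMk_nhds
      ((continuous_snd.comp continuous_snd).tendsto (u0, v0, y0))).prodMk_nhds ?_
    rw [← hθ0]
    exact (hθa u0 hu0).tendsto.comp (continuous_fst.tendsto (u0, v0, y0))
  have tv : Tendsto (fun p : ℝ × ℝ × Y => ((p.2.1, p.2.2), θ p.2.1)) (𝓝 (u0, v0, y0)) (𝓝 ((v0, y0), θ v0)) := by
    have c1 : Continuous (fun p : ℝ × ℝ × Y => p.2.1) := by fun_prop
    refine ((c1.tendsto (u0, v0, y0)).prodMk_nhds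
      ((continuous_snd.comp continuous_snd).tendsto (u0, v0, y0))).prodMk_nhds ?_
    exact (hθa v0 hv0).tendsto.comp (c1.tendsto (u0, v0, y0))
  have eu : ∀ᶠ p : ℝ × ℝ × Y in 𝓝 (u0, v0, y0), p.1 ∈ Set.Icc c d :=
    (continuous_fst.tendsto (u0, v0, y0)).eventually (Icc_mem_nhds (hc.trans_le (min_le_left _ _))
      ((le_max_left _ _).trans_lt hd))
  have ev : ∀ᶠ p : ℝ × ℝ × Y in 𝓝 (u0, v0, y0), p.2.1 ∈ Set.Icc c d :=
    (Continuous.tendsto (f := fun p : ℝ × ℝ × Y => p.2.1) (by fun_prop) (u0, v0, y0)).eventually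
      (Icc_mem_nhds (hc.trans_le (min_le_right _ _)) ((le_max_right _ _).trans_lt hd))
  have ey := (Continuous.tendsto (f := fun p : ℝ × ℝ × Y => p.2.2) (by fun_prop) (u0, v0, y0)).eventually tube
  rw [mem_map]
  filter_upwards [tu.eventually g1, tv.eventually g2, eu, ev, ey]
  rintro ⟨u, v, y⟩ ⟨l, hl, b1, b2, b3, b4⟩ ⟨l', hl', d1, d2, d3, d4⟩ hu hv hy
  dsimp only at *
  have hll : l = l' := by
    refine nd_gap_unique (h.io v y) (t := θ v) ?_ ?_ d1 d2
    · have := idx y hy u hu v hv l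
      rw [sign_pos (sub_pos.2 b1)] at this
      exact sub_pos.1 (sign_eq_one_iff.1 this.symm)
    · have := idx y hy u hu v hv (l + 1)
      rw [sign_neg (sub_neg.2 b2)] at this
      exact sub_neg.1 (sign_eq_neg_one_iff.1 this.symm)
  subst hll
  obtain ⟨r1, r2, r3⟩ := @hE (nd (A u y) l, nd (A u y) (l + 1), nd (A v y) l, nd (A v y) (l + 1)) (by
    simp only [q0, Prod.dist_eq, Real.dist_eq]
    exact max_lt b3 (max_lt b4 (max_lt d3 d4)))
  show kap K (A u y) (A v y) t1 ∈ W
  rw [kap_eq (h.io u y) (h.io v y) (h.card u (hcd hu) v (hcd hv) y) (hK u y) hl r2.le r3.le]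
  exact r1

theorem Fam.cont (h : Fam A J) {K : ℕ} (hK : ∀ u y, (A u y).card < K) {u0 v0 : ℝ} (hu0 : u0 ∈ J) (hv0 : v0 ∈ J)
    (y0 : Y) {t0 : ℝ} (ht : t0 ∈ Set.Ioo (-1 : ℝ) 1) :
    ContinuousAt (fun q : (ℝ × ℝ × Y) × ℝ => kap K (A q.1.1 q.1.2.2) (A q.1.2.1 q.1.2.2) q.2) ((u0, v0, y0), t0) := by
  have hA := h.io u0 y0
  have hB := h.io v0 y0
  have hc := h.card u0 hu0 v0 hv0 y0
  have hk := hK u0 y0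
  have hk' := hK v0 y0
  set κ0 := kap K (A u0 y0) (A v0 y0)
  set s0 := κ0 t0 with hs0
  have hs := kap_mem hA hB hc hk ht
  have inv : ∀ s ∈ Set.Ioo (-1 : ℝ) 1, s ∉ A v0 y0 → ∃ t ∈ Set.Ioo (-1 : ℝ) 1, t ∉ A u0 y0 ∧ κ0 t = s := by
    intro s hs hsB
    have : κ0 (kap K (A v0 y0) (A u0 y0) s) = s := by
      show kap K _ _ _ = s
      rw [kap_coc hB hA hB hc.symm hc hk' hs.1.le hs.2, kap_id hB hk' hs.1.le hs.2]
    exact ⟨_, kap_mem hB hA hc.symm hk' hs, fun hm => hsB (this ▸ kap_in hA hB hc hk hm), this⟩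
  rw [Metric.continuousAt_iff']
  intro ε hε
  obtain ⟨s1, hs1, hs1B⟩ := (Set.Ioo_infinite (a := max (-1) (s0 - ε)) (b := s0)
    (max_lt hs.1 (by linarith))).exists_notMem_finset (A v0 y0)
  obtain ⟨s2, hs2, hs2B⟩ := (Set.Ioo_infinite (a := s0) (b := min 1 (s0 + ε))
    (lt_min hs.2 (by linarith))).exists_notMem_finset (A v0 y0)
  obtain ⟨p1, p2⟩ := max_lt_iff.1 hs1.1
  obtain ⟨p3, p4⟩ := lt_min_iff.1 hs2.2
  obtain ⟨t1, ht1, ht1A, e1⟩ := inv s1 ⟨p1, hs1.2.trans hs.2⟩ hs1B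
  obtain ⟨t2, ht2, ht2A, e2⟩ := inv s2 ⟨hs.1.trans hs2.1, p3⟩ hs2B
  have l1 : t1 < t0 := (kap_mono hA hB K).reflect_lt (by show κ0 t1 < κ0 t0; rw [e1]; exact hs1.2)
  have l2 : t0 < t2 := (kap_mono hA hB K).reflect_lt (by show κ0 t0 < κ0 t2; rw [e2]; exact hs2.1)
  have c1 := (h.pt hK hu0 hv0 y0 ht1 ht1A).eventually (lt_mem_nhds (a := s0 - ε) (by show _ < κ0 t1; rw [e1]; exact p2))
  have c2 := (h.pt hK hu0 hv0 y0 ht2 ht2A).eventually (gt_mem_nhds (show κ0 t2 < s0 + ε by rw [e2]; exact p4))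
  filter_upwards [(c1.and c2).prod_nhds (Ioo_mem_nhds l1 l2)]
  rintro ⟨⟨u, v, y⟩, t⟩ ⟨⟨d1, d2⟩, d3⟩
  dsimp only at *
  have m := kap_mono (h.io u y) (h.io v y) K
  rw [Real.dist_eq, abs_lt]
  have m1 := m d3.1.le
  have m2 := m d3.2.le
  constructor <;> linarith

end

end


section

open Polynomial

def cp (t : ℝ) : ℝ := t / (1 + |t|)
def ci (s : ℝ) : ℝ := s / (1 - |s|)

theorem cp_mem (t : ℝ) : cp t ∈ Set.Ioo (-1 : ℝ) 1 := by
  have : 0 < 1 + |t| := by positivity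
  show -1 < cp t ∧ cp t < 1
  rw [← abs_lt, cp, abs_div, abs_of_pos this, div_lt_one this]; linarith
theorem ci_cp (t : ℝ) : ci (cp t) = t := by
  have h : 0 < 1 + |t| := by positivity
  rw [ci, cp, abs_div, abs_of_pos h]
  field_simp
  simp
theorem cp_ci {s : ℝ} (hs : s ∈ Set.Ioo (-1 : ℝ) 1) : cp (ci s) = s := by
  have h : 0 < 1 - |s| := sub_pos.2 (abs_lt.2 hs)
  rw [ci, cp, abs_div, abs_of_pos h]
  field_simp
  simp
theorem cp_cont : Continuous cp :=
  Continuous.div continuous_id (by fun_prop) fun t => by positivity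
theorem ci_cont {s : ℝ} (hs : s ∈ Set.Ioo (-1 : ℝ) 1) : ContinuousAt ci s :=
  ContinuousAt.div continuousAt_id (by fun_prop) (sub_pos.2 (abs_lt.2 hs)).ne'
theorem cp_mono : StrictMono cp := by
  intro a b h
  unfold cp
  rw [div_lt_div_iff₀ (by positivity) (by positivity)]
  rcases abs_cases a with ⟨h1, h2⟩ | ⟨h1, h2⟩ <;> rcases abs_cases b with ⟨h3, h4⟩ | ⟨h3, h4⟩ <;>
    rw [h1, h3] <;> nlinarith
theorem ci_mono {s t : ℝ} (hs : s ∈ Set.Ioo (-1 : ℝ) 1) (ht : t ∈ Set.Ioo (-1 : ℝ) 1) (h : s < t) : ci s < ci t := by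
  rwa [← cp_mono.lt_iff_lt, cp_ci hs, cp_ci ht]

section
variable {R : Type*} [CommRing R]

def rts (F : Finset R[X]) (φ : R →+* ℝ) : Finset ℝ :=
  F.biUnion fun P => (P.map φ).roots.toFinset.image cp
def KK (F : Finset R[X]) : ℕ := ∑ P ∈ F, P.natDegree + 1

theorem mem_rts {F : Finset R[X]} {φ : R →+* ℝ} {s : ℝ} :
    s ∈ rts F φ ↔ ∃ P ∈ F, P.map φ ≠ 0 ∧ ∃ t, (P.map φ).eval t = 0 ∧ cp t = s := by
  simp only [rts, Finset.mem_biUnion, Finset.mem_image, Multiset.mem_toFinset]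
  constructor
  · rintro ⟨P, hP, t, ht, rfl⟩
    obtain ⟨h1, h2⟩ := mem_roots'.1 ht
    exact ⟨P, hP, h1, t, h2, rfl⟩
  · rintro ⟨P, hP, h, t, ht, rfl⟩
    exact ⟨P, hP, t, (mem_roots h).2 ht, rfl⟩

theorem cp_mem_rts {F : Finset R[X]} {φ : R →+* ℝ} {t : ℝ} :
    cp t ∈ rts F φ ↔ ∃ P ∈ F, P.map φ ≠ 0 ∧ (P.map φ).eval t = 0 := by
  rw [mem_rts]
  constructor
  · rintro ⟨P, hP, h, t', ht, he⟩
    rw [← ci_cp t, ← he, ci_cp]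
    exact ⟨P, hP, h, ht⟩
  · rintro ⟨P, hP, h, ht⟩
    exact ⟨P, hP, h, t, ht, rfl⟩

theorem rts_io (F : Finset R[X]) (φ : R →+* ℝ) : Iop (rts F φ) := by
  intro s hs
  obtain ⟨_, _, _, t, _, rfl⟩ := mem_rts.1 hs
  exact cp_mem t

theorem rts_card (F : Finset R[X]) (φ : R →+* ℝ) : (rts F φ).card < KK F := by
  refine Nat.lt_succ_of_le (Finset.card_biUnion_le.trans (Finset.sum_le_sum fun P _ => ?_))
  exact Finset.card_image_le.trans ((Multiset.toFinset_card_le _).trans ((card_roots' _).trans (natDegree_map_le)))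

/-- sign transfer through the interpolation -/
theorem rts_sign {F : Finset R[X]} {φ ψ : R →+* ℝ} (hφ : ∀ P ∈ F, P.map φ ≠ 0) (hψ : ∀ P ∈ F, P.map ψ ≠ 0)
    (e : ℝ ≃o ℝ) (he : ∀ P ∈ F, ∀ t, sg ((P.map φ).eval t) = sg ((P.map ψ).eval (e t))) :
    (rts F φ).card = (rts F ψ).card ∧ ∀ P ∈ F, ∀ t, sg ((P.map φ).eval t) =
      sg ((P.map ψ).eval (ci (kap (KK F) (rts F φ) (rts F ψ) (cp t)))) := by
  have hin : ∀ t, cp t ∈ rts F φ ↔ cp (e t) ∈ rts F ψ := by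
    intro t
    rw [cp_mem_rts, cp_mem_rts]
    refine exists_congr fun P => and_congr_right fun hP => ?_
    rw [← sign_eq_zero_iff, he P hP t, sign_eq_zero_iff]
    simp [hφ P hP, hψ P hP]
  have hA := rts_io F φ
  have hB := rts_io F ψ
  set A := rts F φ
  set B := rts F ψ
  set E : ℝ → ℝ := fun a => cp (e (ci a))
  have Emono : ∀ a ∈ Set.Ioo (-1 : ℝ) 1, ∀ b ∈ Set.Ioo (-1 : ℝ) 1, a < b → E a < E b :=
    fun a ha b hb h => cp_mono (e.strictMono (ci_mono ha hb h))
  have EA : ∀ a ∈ A, E a ∈ B := by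
    intro a ha
    have := (hin (ci a)).1 (by rwa [cp_ci (hA a ha)])
    exact this
  have hcard : A.card = B.card := by
    refine Finset.card_bij (fun a _ => E a) EA ?_ ?_
    · intro a ha b hb h
      by_contra hne
      rcases lt_or_gt_of_ne hne with h' | h'
      · exact (Emono a (hA a ha) b (hA b hb) h').ne h
      · exact (Emono b (hA b hb) a (hA a ha) h').ne' h
    · intro b hb
      refine ⟨cp (e.symm (ci b)), (hin _).2 ?_, ?_⟩
      · rwa [e.apply_symm_apply, cp_ci (hB b hb)]
      · show cp (e (ci (cp _))) = b
        rw [ci_cp, e.apply_symm_apply, cp_ci (hB b hb)]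
  have hnd : ∀ i < A.card, nd B (i + 1) = E (nd A (i + 1)) := by
    refine nd_uniq hB (fun i => E (nd A (i + 1))) (fun i hi => EA _ (nd_mem hA hi).1) (fun i hi => ?_) hcard.symm
    exact Emono _ (hA _ (nd_mem hA (by omega)).1) _ (hA _ (nd_mem hA hi).1) (nd_lt hA hi.le)
  refine ⟨hcard, fun P hP t => ?_⟩
  have hK := rts_card F φ
  obtain ⟨i, hi, h1, h2⟩ := nd_loc hA (cp_mem t).1.le (cp_mem t).2
  obtain ⟨k1, k2, k3, -⟩ := kap_loc hA hB hcard hK hi h1 h2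
  have kI := kap_mem hA hB hcard hK (cp_mem t)
  set κ := kap (KK F) A B (cp t)
  have hEt : E (cp t) = cp (e t) := by simp only [E, ci_cp]
  rcases h1.eq_or_lt with h1 | h1
  · cases i with
    | zero => exact absurd h1 (cp_mem t).1.ne
    | succ i =>
      rw [k3.1 h1.symm, hnd i hi, h1, hEt, ci_cp]
      exact he P hP t
  · have k4 : nd B i < κ := lt_of_le_of_ne k1 fun h => h1.ne' (k3.2 h.symm)
    have m1 : nd B i < cp (e t) := by
      cases i with
      | zero => exact (cp_mem _).1
      | succ i =>
        rw [hnd i hi, ← hEt]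
        exact Emono _ (hA _ (nd_mem hA hi).1) _ (cp_mem t) h1
    have m2 : cp (e t) < nd B (i + 1) := by
      rcases hi.lt_or_eq with hi | hi
      · rw [hnd i hi, ← hEt]
        exact Emono _ (cp_mem t) _ (hA _ (nd_mem hA hi).1) h2
      · rw [nd_ge hB _ (by omega)]; exact (cp_mem _).2
    rw [he P hP t]
    refine sg_same (f := fun x => (P.map ψ).eval x) (P.map ψ).continuous.continuousOn fun x hx h0 => ?_
    have hxB : cp x ∈ B := cp_mem_rts.2 ⟨P, hP, hψ P hP, h0⟩
    have hx2 : cp x ∈ Set.Ioo (nd B i) (nd B (i + 1)) := by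
      have := Set.mem_uIcc.1 hx
      have hk : cp (ci κ) = κ := cp_ci kI
      rcases this with ⟨a1, a2⟩ | ⟨a1, a2⟩
      · have b1 := cp_mono.monotone a1
        have b2 := cp_mono.monotone a2
        rw [hk] at b2
        exact ⟨m1.trans_le b1, b2.trans_lt k2⟩
      · have b1 := cp_mono.monotone a1
        have b2 := cp_mono.monotone a2
        rw [hk] at b1
        exact ⟨k4.trans_le b1, b2.trans_lt m2⟩
    exact absurd (nd_gap hxB hx2.1) (not_le.2 hx2.2)

/-- evaluation homs depending nicely on parameters -/
structure Ev {k : ℕ} (ev : ℝ → (Fin k → ℝ) → (R →+* ℝ)) : Prop where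
  cont : ∀ r, Continuous fun p : ℝ × (Fin k → ℝ) => ev p.1 p.2 r
  df : ∀ r, DF fun q : Option (Fin k) → ℝ => ev (q none) (fun i => q (some i)) r

/-- transport -/
structure Tr {k : ℕ} (J : Set ℝ) (τ : ℝ → ℝ → (Fin k → ℝ) → (Fin k → ℝ)) : Prop where
  cont : ∀ u ∈ J, ∀ v ∈ J, ∀ z, ContinuousAt (fun p : ℝ × ℝ × (Fin k → ℝ) => τ p.1 p.2.1 p.2.2) (u, v, z)
  id : ∀ u ∈ J, ∀ z, τ u u z = z
  coc : ∀ u ∈ J, ∀ v ∈ J, ∀ w ∈ J, ∀ z, τ v w (τ u v z) = τ u w z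
  df : ∀ {ι : Type} {U V : (ι → ℝ) → ℝ} {Z : Fin k → (ι → ℝ) → ℝ}, DF U → DF V → (∀ i, DF (Z i)) →
    ∀ i, DF fun x => τ (U x) (V x) (fun j => Z j x) i

def SP {k : ℕ} (J : Set ℝ) (ev : ℝ → (Fin k → ℝ) → (R →+* ℝ)) (τ : ℝ → ℝ → (Fin k → ℝ) → (Fin k → ℝ))
    (B : Finset R) : Prop := ∀ u ∈ J, ∀ v ∈ J, ∀ z, ∀ b ∈ B, sg (ev u z b) = sg (ev v (τ u v z) b)

variable {k : ℕ} {ev : ℝ → (Fin k → ℝ) → (R →+* ℝ)} {τ : ℝ → ℝ → (Fin k → ℝ) → (Fin k → ℝ)} {J : Set ℝ}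
  {F : Finset R[X]}

theorem pe_eq (φ : R →+* ℝ) (P : R[X]) (t : ℝ) :
    (P.map φ).eval t = ∑ i ∈ Finset.range (P.natDegree + 1), φ (P.coeff i) * t ^ i := by
  rw [eval_map, eval₂_eq_sum_range]

theorem Ev.pcont (h : Ev ev) (P : R[X]) :
    Continuous fun p : (ℝ × (Fin k → ℝ)) × ℝ => (P.map (ev p.1.1 p.1.2)).eval p.2 := by
  simp only [pe_eq]
  refine continuous_finsetSum _ fun i _ => ((h.cont _).comp continuous_fst).mul (by fun_prop)

theorem Ev.dfc (h : Ev ev) {ι : Type} {U : (ι → ℝ) → ℝ} {Z : Fin k → (ι → ℝ) → ℝ} (hU : DF U)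
    (hZ : ∀ i, DF (Z i)) (r : R) : DF fun x => ev (U x) (fun j => Z j x) r :=
  DF.comp (h.df r) (F := fun i => Option.elim i U Z) (by rintro (_ | i); exacts [hU, hZ i])

theorem Ev.pdf (h : Ev ev) {ι : Type} {U T : (ι → ℝ) → ℝ} {Z : Fin k → (ι → ℝ) → ℝ} (hU : DF U)
    (hZ : ∀ i, DF (Z i)) (hT : DF T) (P : R[X]) : DF fun x => (P.map (ev (U x) (fun j => Z j x))).eval (T x) := by
  simp only [pe_eq]
  exact DF.sum _ fun i => (h.dfc hU hZ _).mul (hT.pow i)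

/-- every root is a simple root of some member -/
theorem simple_root {G : Finset ℝ[X]} (hder : ∀ P ∈ G, derivative P = 0 ∨ ∃ Q ∈ G, ∃ c : ℝ, derivative P = C c * Q)
    {t : ℝ} : ∀ (n : ℕ) (P : ℝ[X]), P ∈ G → P ≠ 0 → P.natDegree ≤ n → P.eval t = 0 →
      ∃ Q ∈ G, Q.eval t = 0 ∧ (derivative Q).eval t ≠ 0 := by
  intro n
  induction n with
  | zero =>
    intro P _ h0 hn ht
    rw [Nat.le_zero] at hn
    rw [eq_C_of_natDegree_eq_zero hn] at ht h0
    rw [eval_C] at ht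
    rw [ht] at h0; simp at h0
  | succ n ih =>
    intro P hP h0 hn ht
    by_cases hd : (derivative P).eval t = 0
    swap
    · exact ⟨P, hP, ht, hd⟩
    have hd0 : derivative P ≠ 0 := by
      intro h
      have := Polynomial.derivative_eq_zero.1 h
      rw [eq_C_of_natDegree_eq_zero this] at ht h0
      rw [eval_C] at ht
      rw [ht] at h0; simp at h0
    obtain h | ⟨Q, hQ, c, hc⟩ := hder P hP
    · exact absurd h hd0
    have hc0 : c ≠ 0 := by rintro rfl; exact hd0 (by simpa only [C_0, zero_mul, mul_zero] using hc)
    have hdeg : Q.natDegree ≤ n := by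
      have h1 := natDegree_derivative_le P
      rw [hc, natDegree_C_mul hc0] at h1
      omega
    refine ih Q hQ ?_ hdeg ?_
    · rintro rfl; exact hd0 (by simpa only [C_0, zero_mul, mul_zero] using hc)
    · rw [hc, eval_mul, eval_C] at hd
      exact (mul_eq_zero.1 hd).resolve_left hc0

theorem sign_change {P : ℝ[X]} {t : ℝ} (h0 : P.eval t = 0) (h1 : (derivative P).eval t ≠ 0) {δ : ℝ} (hδ : 0 < δ) :
    ∃ a b, t - δ < a ∧ a < b ∧ b < t + δ ∧ P.eval a * P.eval b < 0 := by
  obtain ⟨q, hq⟩ := dvd_iff_isRoot.2 (show P.IsRoot t from h0)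
  have hqt : q.eval t ≠ 0 := by
    rw [hq] at h1
    simpa [derivative_mul] using h1
  have hev : ∀ᶠ x in 𝓝 t, q.eval x * q.eval t > 0 :=
    (q.continuous.mul continuous_const).continuousAt.eventually (lt_mem_nhds (by positivity [mul_self_pos.2 hqt]))
  obtain ⟨e, he, hev⟩ := Metric.eventually_nhds_iff.1 hev
  set m := min e δ / 2 with hm
  have m0 : 0 < min e δ := lt_min he hδ
  have m1 := min_le_left e δ
  have m2 := min_le_right e δ
  have ha := @hev (t - m) (by rw [Real.dist_eq, abs_lt]; constructor <;> linarith)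
  have hb := @hev (t + m) (by rw [Real.dist_eq, abs_lt]; constructor <;> linarith)
  refine ⟨t - m, t + m, by linarith, by linarith, by linarith, ?_⟩
  rw [hq]
  simp only [eval_mul, eval_sub, eval_X, eval_C]
  have h3 : 0 < q.eval (t - m) * q.eval (t + m) := by
    have h4 : 0 < (q.eval (t - m) * q.eval (t + m)) * (q.eval t) ^ 2 := by nlinarith [mul_pos ha hb]
    exact (pos_iff_pos_of_mul_pos h4).2 (by positivity)
  have h5 : 0 < m := by linarith
  nlinarith [mul_pos (mul_pos h5 h5) h3]

/-- hypotheses on the family -/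
structure Good (ev : ℝ → (Fin k → ℝ) → (R →+* ℝ)) (J : Set ℝ) (F : Finset R[X]) : Prop where
  nv : ∀ u ∈ J, ∀ z, ∀ P ∈ F, P.map (ev u z) ≠ 0
  der : ∀ u ∈ J, ∀ z, ∀ P ∈ F, derivative (P.map (ev u z)) = 0 ∨
    ∃ Q ∈ F, ∃ c : ℝ, derivative (P.map (ev u z)) = C c * Q.map (ev u z)

theorem Good.lsc (hg : Good ev J F) (he : Ev ev) (hJ : IsOpen J) {u : ℝ} (hu : u ∈ J) (z : Fin k → ℝ) {a : ℝ}
    (ha : a ∈ rts F (ev u z)) {ε : ℝ} (hε : 0 < ε) :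
    ∀ᶠ p : ℝ × (Fin k → ℝ) in 𝓝 (u, z), ∃ a' ∈ rts F (ev p.1 p.2), |a' - a| < ε := by
  obtain ⟨P, hP, hP0, t, ht, rfl⟩ := mem_rts.1 ha
  obtain ⟨Q', hQ', hQ0, hQ1⟩ := simple_root (G := F.image fun P => P.map (ev u z)) (t := t) (by
    intro P' hP'
    obtain ⟨P, hP, rfl⟩ := Finset.mem_image.1 hP'
    rcases hg.der u hu z P hP with h | ⟨Q, hQ, c, h⟩
    · exact Or.inl h
    · exact Or.inr ⟨_, Finset.mem_image_of_mem _ hQ, c, h⟩) _ _ (Finset.mem_image_of_mem _ hP) hP0 le_rfl ht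
  obtain ⟨Q, hQ, rfl⟩ := Finset.mem_image.1 hQ'
  obtain ⟨δ, hδ, hc⟩ := Metric.continuousAt_iff.1 (cp_cont.continuousAt (x := t)) ε hε
  obtain ⟨x, y, h1, h2, h3, h4⟩ := sign_change hQ0 hQ1 hδ
  have hev : ∀ᶠ p : ℝ × (Fin k → ℝ) in 𝓝 (u, z),
      (Q.map (ev p.1 p.2)).eval x * (Q.map (ev p.1 p.2)).eval y < 0 := by
    have : Continuous fun p : ℝ × (Fin k → ℝ) => (Q.map (ev p.1 p.2)).eval x * (Q.map (ev p.1 p.2)).eval y :=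
      ((he.pcont Q).comp (continuous_id.prodMk continuous_const)).mul
        ((he.pcont Q).comp (continuous_id.prodMk continuous_const))
    exact this.continuousAt.eventually (gt_mem_nhds h4)
  have hJ' : ∀ᶠ p : ℝ × (Fin k → ℝ) in 𝓝 (u, z), p.1 ∈ J :=
    (continuous_fst.tendsto (u, z)).eventually (hJ.mem_nhds hu)
  filter_upwards [hev, hJ'] with p hp hpJ
  obtain ⟨s, hs, hs0⟩ : ∃ s ∈ Set.Icc x y, (Q.map (ev p.1 p.2)).eval s = 0 := by
    by_contra hcon
    push Not at hcon
    have := sg_same (f := fun s => (Q.map (ev p.1 p.2)).eval s) (a := x) (b := y)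
      (Q.map (ev p.1 p.2)).continuous.continuousOn (by rw [Set.uIcc_of_le h2.le]; exact hcon)
    rcases mul_neg_iff.1 hp with ⟨a1, a2⟩ | ⟨a1, a2⟩
    · rw [sign_pos a1, sign_neg a2] at this; exact absurd this (by decide)
    · rw [sign_neg a1, sign_pos a2] at this; exact absurd this (by decide)
  refine ⟨cp s, cp_mem_rts.2 ⟨Q, hQ, hg.nv _ hpJ _ Q hQ, hs0⟩, ?_⟩
  have := @hc s (by rw [Real.dist_eq, abs_lt]; constructor <;> linarith [hs.1, hs.2])
  rwa [Real.dist_eq] at this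

theorem Good.cld (hg : Good ev J F) (he : Ev ev) {u : ℝ} (hu : u ∈ J) (z : Fin k → ℝ) {t : ℝ}
    (ht : t ∈ Set.Ioo (-1 : ℝ) 1) (ht' : t ∉ rts F (ev u z)) :
    ∀ᶠ q : (ℝ × (Fin k → ℝ)) × ℝ in 𝓝 ((u, z), t), q.2 ∉ rts F (ev q.1.1 q.1.2) := by
  have h1 : ∀ P ∈ F, ∀ᶠ q : (ℝ × (Fin k → ℝ)) × ℝ in 𝓝 ((u, z), t), (P.map (ev q.1.1 q.1.2)).eval (ci q.2) ≠ 0 := by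
    intro P hP
    have hc : ContinuousAt (fun q : (ℝ × (Fin k → ℝ)) × ℝ => (P.map (ev q.1.1 q.1.2)).eval (ci q.2)) ((u, z), t) :=
      ContinuousAt.comp (f := fun q : (ℝ × (Fin k → ℝ)) × ℝ => (q.1, ci q.2)) (he.pcont P).continuousAt
        (continuousAt_fst.prodMk (ContinuousAt.comp (g := ci) (x := ((u, z), t)) (f := fun q : (ℝ × (Fin k → ℝ)) × ℝ => q.2) (ci_cont ht) continuousAt_snd))
    refine hc.eventually_ne fun h0 => ht' ?_
    rw [← cp_ci ht]
    exact cp_mem_rts.2 ⟨P, hP, hg.nv u hu z P hP, h0⟩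
  filter_upwards [(Finset.eventually_all F).2 h1] with q hq hm
  obtain ⟨P, hP, -, s, hs, hs'⟩ := mem_rts.1 hm
  refine hq P hP ?_
  rw [← hs', ci_cp]; exact hs

end

end


section

open Polynomial

section
variable {ι : Type}

/-- definable families of finite sets -/
def DA (A : (ι → ℝ) → Finset ℝ) : Prop := D fun z : Option ι → ℝ => z none ∈ A fun i => z (some i)

theorem DA.nd {A : (ι → ℝ) → Finset ℝ} (hA : DA A) (i : ℕ) : DF fun x => nd (A x) i := by
  induction i with
  | zero => exact DF.const (-1)
  | succ i ih =>
    refine DF.of_graph (p := fun x t => (t ∈ A x ∧ RealMilnor.nd (A x) i < t ∧ ∀ a, a ∈ A x → RealMilnor.nd (A x) i < a → t ≤ a) ∨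
      ((∀ a, a ∈ A x → ¬ RealMilnor.nd (A x) i < a) ∧ t = 1)) ?_ ?_
    · have m2 : D fun z : Option (Option ι) → ℝ => z none ∈ A fun i => z (some (some i)) :=
        (D.comap hA (Option.map some)).congr fun z => Iff.rfl
      have n2 : DF fun z : Option (Option ι) → ℝ => RealMilnor.nd (A fun i => z (some (some i))) i :=
        ih.comap (fun i => some (some i))
      refine ((D.and hA ((D.lt (ih.comap some) (DF.proj none)).and (D.all ?_)))).or
        ((D.all ?_).and (D.eq (DF.proj none) (DF.const 1)))
      · exact m2.imp ((D.lt n2 (DF.proj none)).imp (D.le (DF.proj (some none)) (DF.proj none)))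
      · exact m2.imp (D.lt n2 (DF.proj none)).not
    · intro x t
      show t = nx (A x) (RealMilnor.nd (A x) i) ↔ _
      by_cases h : ((A x).filter (RealMilnor.nd (A x) i < ·)).Nonempty
      · obtain ⟨h1, h2, h3⟩ := nx_pos h
        constructor
        · rintro rfl; exact Or.inl ⟨h1, h2, h3⟩
        · rintro (⟨k1, k2, k3⟩ | ⟨k1, -⟩)
          · exact le_antisymm (k3 _ h1 h2) (h3 _ k1 k2)
          · exact absurd h2 (k1 _ h1)
      · have h' : ∀ a, a ∈ A x → ¬ RealMilnor.nd (A x) i < a := fun a ha hl =>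
          h ⟨a, Finset.mem_filter.2 ⟨ha, hl⟩⟩
        rw [nx, dif_neg h]
        constructor
        · rintro rfl; exact Or.inr ⟨h', rfl⟩
        · rintro (⟨k1, k2, -⟩ | ⟨-, k2⟩)
          · exact absurd k2 (h' _ k1)
          · exact k2

theorem DA.kap {A B : (ι → ℝ) → Finset ℝ} {T : (ι → ℝ) → ℝ} (hA : DA A) (hB : DA B) (hT : DF T) (K : ℕ) :
    DF fun x => kap K (A x) (B x) (T x) := by
  refine (DF.const (-1)).add (DF.sum _ fun i => ((hB.nd _).sub (hB.nd _)).mul ?_)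
  exact (DF.const 0).max ((DF.const 1).min ((hT.sub (hA.nd _)).div ((hA.nd _).sub (hA.nd _))))

theorem DF.cp {T : (ι → ℝ) → ℝ} (hT : DF T) : DF fun x => cp (T x) := hT.div ((DF.const 1).add hT.abs)
theorem DF.ci {T : (ι → ℝ) → ℝ} (hT : DF T) : DF fun x => ci (T x) := hT.div ((DF.const 1).sub hT.abs)
end

section
variable {R : Type*} [CommRing R] {k : ℕ} {ev : ℝ → (Fin k → ℝ) → (R →+* ℝ)}
  {τ : ℝ → ℝ → (Fin k → ℝ) → (Fin k → ℝ)} {J : Set ℝ} {F : Finset R[X]}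

theorem Ev.rts (h : Ev ev) {ι : Type} {U : (ι → ℝ) → ℝ} {Z : Fin k → (ι → ℝ) → ℝ} (hU : DF U)
    (hZ : ∀ i, DF (Z i)) (F : Finset R[X]) : DA fun x => rts F (ev (U x) fun j => Z j x) := by
  refine (D.exi (α := F) fun P => ?_).congr (p := fun z : Option ι → ℝ => ∃ P : F,
    (∃ t, (P.1.map (ev (U fun i => z (some i)) fun j => Z j fun i => z (some i))).eval t ≠ 0) ∧
    ∃ t, (P.1.map (ev (U fun i => z (some i)) fun j => Z j fun i => z (some i))).eval t = 0 ∧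
      RealMilnor.cp t = z none) fun z => ?_
  · have hp : DF fun z : Option (Option ι) → ℝ => (P.1.map (ev (U fun i => z (some (some i)))
        fun j => Z j fun i => z (some (some i)))).eval (z none) :=
      h.pdf (hU.comap fun i => some (some i)) (fun j => (hZ j).comap fun i => some (some i)) (DF.proj none) _
    exact (D.ex (D.eq hp (DF.const 0)).not).and
      (D.ex ((D.eq hp (DF.const 0)).and (D.eq (DF.proj none).cp (DF.proj (some none)))))
  · rw [mem_rts]
    simp only [Subtype.exists, exists_prop]
    refine exists_congr fun P => and_congr_right fun _ => and_congr_left fun _ => ?_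
    constructor
    · intro h
      by_contra hc
      push Not at hc
      exact h (Polynomial.funext fun t => by simpa using hc t)
    · rintro ⟨t, ht⟩ h0
      exact ht (by rw [h0]; simp)

def stp (ev : ℝ → (Fin k → ℝ) → (R →+* ℝ)) (τ : ℝ → ℝ → (Fin k → ℝ) → (Fin k → ℝ)) (F : Finset R[X])
    (u v : ℝ) (y : Fin (k + 1) → ℝ) : Fin (k + 1) → ℝ :=
  Fin.cons (ci (kap (KK F) (rts F (ev u (Fin.tail y))) (rts F (ev v (τ u v (Fin.tail y)))) (cp (y 0))))
    (τ u v (Fin.tail y))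

theorem stp_tail (u v : ℝ) (y : Fin (k + 1) → ℝ) : Fin.tail (stp ev τ F u v y) = τ u v (Fin.tail y) := by
  simp [stp]

theorem stp_sign (hg : Good ev J F) {B : Finset R} (hB : HC F B) (hs : SP J ev τ B) {u v : ℝ} (hu : u ∈ J)
    (hv : v ∈ J) (z : Fin k → ℝ) : (rts F (ev u z)).card = (rts F (ev v (τ u v z))).card ∧
      ∀ P ∈ F, ∀ t, sg ((P.map (ev u z)).eval t) = sg ((P.map (ev v (τ u v z))).eval
        (ci (kap (KK F) (rts F (ev u z)) (rts F (ev v (τ u v z))) (cp t)))) := by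
  obtain ⟨e, he⟩ := hB (ev u z) (ev v (τ u v z)) (fun b hb => hs u hu v hv z b hb)
  exact rts_sign (hg.nv u hu z) (hg.nv v hv _) e he

theorem stp_fam (hE : Ev ev) (hJ : IsOpen J) (hJ' : J.OrdConnected) (ht : Tr J τ) (hg : Good ev J F)
    {B : Finset R} (hB : HC F B) (hs : SP J ev τ B) {u0 : ℝ} (hu0 : u0 ∈ J) :
    Fam (fun u y => rts F (ev u (τ u0 u y))) J := by
  have hc : ∀ u ∈ J, ∀ y, Tendsto (fun p : ℝ × (Fin k → ℝ) => (p.1, τ u0 p.1 p.2)) (𝓝 (u, y))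
      (𝓝 (u, τ u0 u y)) := by
    intro u hu y
    refine (continuous_fst.tendsto (u, y)).prodMk_nhds ?_
    exact ContinuousAt.comp (g := fun p : ℝ × ℝ × (Fin k → ℝ) => τ p.1 p.2.1 p.2.2)
      (f := fun p : ℝ × (Fin k → ℝ) => (u0, p.1, p.2)) (x := (u, y)) (ht.cont u0 hu0 u hu y) (by fun_prop)
  refine ⟨hJ, hJ', fun u y => rts_io _ _, fun u hu v hv y => ?_, fun u hu y a ha ε hε => ?_,
    fun u hu y t htI htn => ?_⟩
  · have := (stp_sign hg hB hs hu hv (τ u0 u y)).1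
    rwa [ht.coc u0 hu0 u hu v hv] at this
  · exact (hc u hu y).eventually (hg.lsc hE hJ hu _ ha hε)
  · have h1 := hg.cld hE hu _ htI htn
    have h2 : Tendsto (fun q : (ℝ × (Fin k → ℝ)) × ℝ => ((q.1.1, τ u0 q.1.1 q.1.2), q.2)) (𝓝 ((u, y), t))
        (𝓝 ((u, τ u0 u y), t)) :=
      ((hc u hu y).comp (continuous_fst.tendsto ((u, y), t))).prodMk_nhds (continuous_snd.tendsto ((u, y), t))
    exact h2.eventually h1

theorem stp_tr (hE : Ev ev) (hJ : IsOpen J) (hJ' : J.OrdConnected) (ht : Tr J τ) (hg : Good ev J F)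
    {B : Finset R} (hB : HC F B) (hs : SP J ev τ B) : Tr J (stp ev τ F) := by
  have cK := fun φ => rts_card F φ
  have cio := fun φ => rts_io F φ
  have cc : ∀ u ∈ J, ∀ v ∈ J, ∀ z, (rts F (ev u z)).card = (rts F (ev v (τ u v z))).card :=
    fun u hu v hv z => (stp_sign hg hB hs hu hv z).1
  constructor
  · intro u0 hu0 v0 hv0 y0
    have hfam := stp_fam hE hJ hJ' ht hg hB hs hu0
    have htail : Continuous (fun y : Fin (k + 1) → ℝ => Fin.tail y) :=
      continuous_pi fun i => continuous_apply _
    have c0 : ContinuousAt (fun p : ℝ × ℝ × (Fin (k + 1) → ℝ) => τ p.1 p.2.1 (Fin.tail p.2.2)) (u0, v0, y0) :=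
      ContinuousAt.comp (g := fun p : ℝ × ℝ × (Fin k → ℝ) => τ p.1 p.2.1 p.2.2)
        (f := fun p : ℝ × ℝ × (Fin (k + 1) → ℝ) => (p.1, p.2.1, Fin.tail p.2.2)) (x := (u0, v0, y0))
        (ht.cont u0 hu0 v0 hv0 _) (by fun_prop)
    have c1 : ContinuousAt (fun p : ℝ × ℝ × (Fin (k + 1) → ℝ) => τ p.1 u0 (Fin.tail p.2.2)) (u0, v0, y0) :=
      ContinuousAt.comp (g := fun p : ℝ × ℝ × (Fin k → ℝ) => τ p.1 p.2.1 p.2.2)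
        (f := fun p : ℝ × ℝ × (Fin (k + 1) → ℝ) => (p.1, u0, Fin.tail p.2.2)) (x := (u0, v0, y0))
        (ht.cont u0 hu0 u0 hu0 _) (by fun_prop)
    refine continuousAt_pi.2 fun i => ?_
    refine Fin.cases ?_ (fun i => ?_) i
    · have hm := kap_mem (hfam.io u0 (τ u0 u0 (Fin.tail y0))) (hfam.io v0 (τ u0 u0 (Fin.tail y0)))
        (hfam.card u0 hu0 v0 hv0 _) (cK _) (cp_mem (y0 0))
      have c2 := hfam.cont (K := KK F) (fun u y => cK _) hu0 hv0 (τ u0 u0 (Fin.tail y0)) (cp_mem (y0 0))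
      have c3 : ContinuousAt (fun p : ℝ × ℝ × (Fin (k + 1) → ℝ) =>
          (((p.1, p.2.1, τ p.1 u0 (Fin.tail p.2.2)), cp (p.2.2 0)) : (ℝ × ℝ × (Fin k → ℝ)) × ℝ)) (u0, v0, y0) := by
        have : ContinuousAt (fun p : ℝ × ℝ × (Fin (k + 1) → ℝ) => cp (p.2.2 0)) (u0, v0, y0) :=
          (cp_cont.comp (by fun_prop)).continuousAt
        exact (continuousAt_fst.prodMk ((by fun_prop : ContinuousAt (fun p : ℝ × ℝ × (Fin (k + 1) → ℝ) => p.2.1)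
          (u0, v0, y0)).prodMk c1)).prodMk this
      have c4 := ContinuousAt.comp (x := (u0, v0, y0)) c2 c3
      have c5 := ContinuousAt.comp (g := ci) (x := (u0, v0, y0)) (ci_cont hm) c4
      refine c5.congr ?_
      have e1 : ∀ᶠ p : ℝ × ℝ × (Fin (k + 1) → ℝ) in 𝓝 (u0, v0, y0), p.1 ∈ J :=
        (continuous_fst.tendsto (u0, v0, y0)).eventually (hJ.mem_nhds hu0)
      have e2 : ∀ᶠ p : ℝ × ℝ × (Fin (k + 1) → ℝ) in 𝓝 (u0, v0, y0), p.2.1 ∈ J :=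
        (Continuous.tendsto (f := fun p : ℝ × ℝ × (Fin (k + 1) → ℝ) => p.2.1) (by fun_prop)
          (u0, v0, y0)).eventually (hJ.mem_nhds hv0)
      filter_upwards [e1, e2] with p h1 h2
      simp only [Function.comp_apply, stp, Fin.cons_zero]
      rw [ht.coc _ h1 _ hu0 _ h1, ht.coc _ h1 _ hu0 _ h2, ht.id _ h1]
    · simp only [stp, Fin.cons_succ]
      exact continuousAt_pi.1 c0 i
  · intro u hu y
    rw [stp, ht.id u hu, kap_id (cio _) (cK _) (cp_mem _).1.le (cp_mem _).2, ci_cp, Fin.cons_self_tail]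
  · intro u hu v hv w hw y
    rw [stp, stp_tail, ht.coc u hu v hv w hw]
    conv_rhs => rw [stp]
    congr 1
    have hm := kap_mem (cio _) (cio _) (cc u hu v hv (Fin.tail y)) (cK _) (cp_mem (y 0))
    have h2 := cc v hv w hw (τ u v (Fin.tail y))
    rw [ht.coc u hu v hv w hw] at h2
    simp only [stp, Fin.cons_zero]
    rw [cp_ci hm, kap_coc (cio _) (cio _) (cio _) (cc u hu v hv _) h2 (cK _) (cp_mem _).1.le (cp_mem _).2]
  · intro ι U V Z hU hV hZ i
    refine Fin.cases ?_ (fun i => ?_) i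
    · simp only [stp, Fin.cons_zero]
      refine DF.ci (DA.kap ?_ ?_ (hZ 0).cp _)
      · exact hE.rts hU (Z := fun i => Z i.succ) (fun i => hZ _) F
      · exact hE.rts hV (Z := fun i x => τ (U x) (V x) (fun j => Z j.succ x) i)
          (fun i => ht.df hU hV (fun j => hZ _) i) F
    · simp only [stp, Fin.cons_succ]
      exact ht.df hU hV (Z := fun i => Z i.succ) (fun j => hZ _) i

end

end


section

open Polynomial

section
variable {α : Type*} {A : Type*} [CommRing A] [IsDomain A] {M : Type*} [CommRing M]
  (i : A[X] →+* M) (f : α → M[X]) (T : α → ℕ)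

theorem top_coeff (hf : ∀ x, (f x).Monic) (hd : ∀ x, (f x).natDegree = T x) {s : Finset α}
    (hT : Set.InjOn T s) (φ : M →+* ℝ) (c : α → M) (j : ℕ) (hj : ∀ x ∈ s, j ≤ T x)
    (h : ∃ x ∈ s, φ (c x) ≠ 0) : (derivative^[j] (∑ x ∈ s, C (c x) * f x)).map φ ≠ 0 := by
  obtain ⟨x, hx, hmax⟩ := (s.filter fun x => φ (c x) ≠ 0).exists_max_image T
    (by obtain ⟨x, h1, h2⟩ := h; exact ⟨x, Finset.mem_filter.2 ⟨h1, h2⟩⟩)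
  rw [Finset.mem_filter] at hx
  intro h0
  have h1 := congrArg (fun p => p.coeff (T x - j)) h0
  simp only [coeff_map, coeff_iterate_derivative, coeff_zero, map_nsmul, Nat.sub_add_cancel (hj x hx.1)] at h1
  rw [nsmul_eq_mul, mul_eq_zero, Nat.cast_eq_zero, Nat.descFactorial_eq_zero_iff_lt] at h1
  have h2 := h1.resolve_left (by have := hj x hx.1; omega)
  rw [finsetSum_coeff, map_sum, Finset.sum_eq_single_of_mem x hx.1] at h2
  · rw [coeff_C_mul, ← hd x, Monic.coeff_natDegree (hf x), mul_one] at h2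
    exact hx.2 h2
  · intro y hy hyx
    rw [coeff_C_mul, map_mul]
    by_cases hc : φ (c y) = 0
    · rw [hc, zero_mul]
    · have h3 := hmax y (Finset.mem_filter.2 ⟨hy, hc⟩)
      have h4 : T y < T x := lt_of_le_of_ne h3 fun h => hyx (hT hy hx.1 h)
      rw [coeff_eq_zero_of_natDegree_lt (by rw [hd]; exact h4), map_zero, mul_zero]

theorem fam [Nontrivial M] (hf : ∀ x, (f x).Monic) (hd : ∀ x, (f x).natDegree = T x) {s : Finset α}
    (hT : Set.InjOn T s) : ∀ (n j : ℕ) (c : α → A[X]), (∀ x ∈ s, T x < j + n) → (∃ x ∈ s, j ≤ T x ∧ c x ≠ 0) →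
    ∃ (m : A) (d : A[X]) (F : Finset M[X]) (F0 : M[X]), m ≠ 0 ∧ F0 ∈ F ∧
      C (i (C m)) * derivative^[j] (∑ x ∈ s with j ≤ T x, C (i (c x)) * f x) = C (i d) * F0 ∧
      ∀ φ : M →+* ℝ, φ (i (C m)) ≠ 0 → ∀ P ∈ F, P.map φ ≠ 0 ∧ (derivative (P.map φ) = 0 ∨
        ∃ Q ∈ F, ∃ c : ℝ, derivative (P.map φ) = C c * Q.map φ) := by
  intro n
  induction n with
  | zero => rintro j c h1 ⟨x, hx, h2, -⟩; have := h1 x hx; omega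
  | succ n ih =>
    rintro j c h1 ⟨x, hx, h2, h3⟩
    obtain ⟨m0, d0, c', v, hm0, hc, hv⟩ := content (s.filter (j ≤ T ·)) c ⟨x, Finset.mem_filter.2 ⟨hx, h2⟩, h3⟩
    set F0 : M[X] := derivative^[j] (∑ x ∈ s with j ≤ T x, C (i (c' x)) * f x) with hF0
    have r0 : C (i (C m0)) * derivative^[j] (∑ x ∈ s with j ≤ T x, C (i (c x)) * f x) = C (i d0) * F0 := by
      rw [hF0, ← iterate_derivative_C_mul, ← iterate_derivative_C_mul, Finset.mul_sum, Finset.mul_sum]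
      congr 1
      refine Finset.sum_congr rfl fun x hx => ?_
      rw [← mul_assoc, ← mul_assoc, ← C_mul, ← C_mul, ← map_mul, ← map_mul, hc x hx]
    have nv : ∀ φ : M →+* ℝ, φ (i (C m0)) ≠ 0 → F0.map φ ≠ 0 := by
      intro φ hφ
      refine top_coeff f T hf hd (hT.mono (Finset.filter_subset _ _)) φ (fun x => i (c' x)) j
        (fun x hx => (Finset.mem_filter.1 hx).2) ?_
      by_contra hcon
      push Not at hcon
      refine hφ ?_
      rw [← hv, map_sum, map_sum]
      exact Finset.sum_eq_zero fun x hx => by rw [map_mul, map_mul, hcon x hx, mul_zero]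
    have hder : derivative F0 = derivative^[j + 1] (∑ x ∈ s with j + 1 ≤ T x, C (i (c' x)) * f x) := by
      rw [hF0, ← Function.iterate_succ_apply' derivative]
      rw [iterate_derivative_sum, iterate_derivative_sum]
      symm
      refine Finset.sum_subset (fun x hx => ?_) (fun x hx hx' => ?_)
      · rw [Finset.mem_filter] at hx ⊢; exact ⟨hx.1, by omega⟩
      · rw [Finset.mem_filter] at hx hx'
        rw [iterate_derivative_C_mul, iterate_derivative_eq_zero, mul_zero]
        rw [hd]
        by_contra h
        exact hx' ⟨hx.1, by omega⟩
    by_cases hz : ∃ x ∈ s, j + 1 ≤ T x ∧ c' x ≠ 0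
    · obtain ⟨m1, d1, F, F1, hm1, hF1, r1, hF⟩ := ih (j + 1) c' (fun x hx => by have := h1 x hx; omega) hz
      rw [← hder] at r1
      refine ⟨m0 * m1, C m1 * d0, insert F0 F, F0, mul_ne_zero hm0 hm1, Finset.mem_insert_self _ _, ?_, ?_⟩
      · rw [map_mul, map_mul, map_mul, map_mul, map_mul, mul_comm (C (i (C m0))), mul_assoc, r0, mul_assoc]
      · intro φ hφ P hP
        rw [map_mul, map_mul, map_mul, mul_ne_zero_iff] at hφ
        rw [Finset.mem_insert] at hP
        rcases hP with rfl | hP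
        · refine ⟨nv φ hφ.1, Or.inr ⟨F1, Finset.mem_insert_of_mem hF1, φ (i d1) / φ (i (C m1)), ?_⟩⟩
          have h5 := congrArg (Polynomial.map φ) r1
          rw [Polynomial.map_mul, Polynomial.map_mul, map_C, map_C] at h5
          rw [derivative_map, div_eq_inv_mul, C_mul, mul_assoc, ← h5, ← mul_assoc, ← C_mul, inv_mul_cancel₀ hφ.2, C_1, one_mul]
        · obtain ⟨a1, a2⟩ := hF φ hφ.2 P hP
          refine ⟨a1, a2.imp id ?_⟩
          rintro ⟨Q, hQ, c, h⟩
          exact ⟨Q, Finset.mem_insert_of_mem hQ, c, h⟩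
    · push Not at hz
      refine ⟨m0, d0, {F0}, F0, hm0, Finset.mem_singleton_self _, r0, ?_⟩
      intro φ hφ P hP
      rw [Finset.mem_singleton] at hP
      subst hP
      refine ⟨nv φ hφ, Or.inl ?_⟩
      rw [derivative_map, hder, Finset.sum_eq_zero, iterate_derivative_zero, Polynomial.map_zero]
      intro x hx
      rw [Finset.mem_filter] at hx
      rw [hz x hx.1 hx.2, map_zero, C_0, zero_mul]
end

theorem dig_inj {e : ℕ} : ∀ {k : ℕ} {x y : Fin k → ℕ}, (∀ j, x j < e) → (∀ j, y j < e) →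
    ∑ j, x j * e ^ (j : ℕ) = ∑ j, y j * e ^ (j : ℕ) → x = y := by
  intro k
  induction k with
  | zero => intros; exact Subsingleton.elim _ _
  | succ k ih =>
    intro x y hx hy h
    have e1 : ∀ x : Fin (k + 1) → ℕ, ∑ j, x j * e ^ (j : ℕ) = x 0 + e * ∑ j : Fin k, x j.succ * e ^ (j : ℕ) := by
      intro x
      rw [Fin.sum_univ_succ, Finset.mul_sum]
      simp only [Fin.val_zero, pow_zero, mul_one, Fin.val_succ, pow_succ]
      congr 1
      exact Finset.sum_congr rfl fun j _ => by ring
    rw [e1, e1] at h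
    have h0 : x 0 = y 0 := by
      have := congrArg (· % e) h
      simpa [Nat.add_mul_mod_self_left, Nat.mod_eq_of_lt (hx 0), Nat.mod_eq_of_lt (hy 0)] using this
    rw [h0] at h
    have h1 := Nat.eq_of_mul_eq_mul_left (lt_of_le_of_lt (Nat.zero_le _) (hx 0)) (Nat.add_left_cancel h)
    have h2 := ih (fun j => hx j.succ) (fun j => hy j.succ) h1
    ext j
    refine Fin.cases h0 (fun j => ?_) j
    exact congrFun h2 j

section
variable {A : Type*} [CommRing A] [IsDomain A] {k : ℕ}

/-- Nagata variables -/
def Nb (A : Type*) [CommRing A] {k : ℕ} (e : ℕ) (j : Fin (k + 1)) : (MvPolynomial (Fin k) A[X])[X] :=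
  X ^ (e ^ (j : ℕ)) + C (Fin.cases (motive := fun _ => MvPolynomial (Fin k) A[X]) 0 (fun j => MvPolynomial.X j) j)

/-- Nagata substitution -/
def Ng (A : Type*) [CommRing A] (k e : ℕ) : MvPolynomial (Fin (k + 1)) A[X] →+* (MvPolynomial (Fin k) A[X])[X] :=
  MvPolynomial.eval₂Hom ((C : _ →+* (MvPolynomial (Fin k) A[X])[X]).comp MvPolynomial.C)
    (Nb A e)

theorem Ng_fam {e : ℕ} (Q : MvPolynomial (Fin (k + 1)) A[X]) (he : ∀ x ∈ Q.support, ∀ j, x j < e) (he0 : 0 < e)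
    (hQ : Q ≠ 0) : ∃ (m : A) (d : A[X]) (F : Finset (MvPolynomial (Fin k) A[X])[X])
      (F0 : (MvPolynomial (Fin k) A[X])[X]), m ≠ 0 ∧ F0 ∈ F ∧
      C (MvPolynomial.C (C m)) * Ng A k e Q = C (MvPolynomial.C d) * F0 ∧
      ∀ φ : MvPolynomial (Fin k) A[X] →+* ℝ, φ (MvPolynomial.C (C m)) ≠ 0 → ∀ P ∈ F, P.map φ ≠ 0 ∧
        (derivative (P.map φ) = 0 ∨ ∃ Q ∈ F, ∃ c : ℝ, derivative (P.map φ) = C c * Q.map φ) := by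
  have hm1 : ∀ j : Fin (k + 1), (Nb A e j).Monic := fun j => monic_X_pow_add_C _ (pow_pos he0 _).ne'
  have hm2 : ∀ j : Fin (k + 1), (Nb A e j).natDegree = e ^ (j : ℕ) := fun j => natDegree_X_pow_add_C
  obtain ⟨x, hx⟩ := MvPolynomial.support_nonempty.2 hQ
  have hd : ∀ x : Fin (k + 1) →₀ ℕ, (∏ j : Fin (k + 1), Nb A e j ^ x j).natDegree = ∑ j : Fin (k + 1), x j * e ^ (j : ℕ) := by
    intro x
    rw [natDegree_prod_of_monic _ _ fun j _ => (hm1 j).pow _]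
    refine Finset.sum_congr rfl fun j _ => ?_
    rw [(hm1 j).natDegree_pow, hm2]
  have hm : ∀ x : Fin (k + 1) →₀ ℕ, (∏ j : Fin (k + 1), Nb A e j ^ x j).Monic :=
    fun x => monic_prod_of_monic _ _ fun j _ => (hm1 j).pow _
  have hi : Set.InjOn (fun x : Fin (k + 1) →₀ ℕ => ∑ j : Fin (k + 1), x j * e ^ (j : ℕ)) (Q.support : Set _) :=
    fun x hx y hy h => DFunLike.coe_injective (dig_inj (he x hx) (he y hy) h)
  obtain ⟨N, hN⟩ : ∃ N, ∀ x ∈ Q.support, ∑ j : Fin (k + 1), x j * e ^ (j : ℕ) < 0 + N :=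
    ⟨Q.support.sup (fun x : Fin (k + 1) →₀ ℕ => ∑ j : Fin (k + 1), x j * e ^ (j : ℕ)) + 1, fun x hx => by
      rw [zero_add]
      exact Nat.lt_succ_of_le (Finset.le_sup (f := fun x : Fin (k + 1) →₀ ℕ => ∑ j : Fin (k + 1), x j * e ^ (j : ℕ)) hx)⟩
  obtain ⟨m, d, F, F0, h1, h2, h3, h4⟩ := fam (A := A) (M := MvPolynomial (Fin k) A[X]) MvPolynomial.C
    _ _ hm hd hi N 0 (fun x => Q.coeff x) hN ⟨x, hx, Nat.zero_le _, MvPolynomial.mem_support_iff.1 hx⟩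
  refine ⟨m, d, F, F0, h1, h2, ?_, h4⟩
  have h5 : Ng A k e Q = ∑ x ∈ Q.support, C (MvPolynomial.C (Q.coeff x)) * ∏ j : Fin (k + 1), Nb A e j ^ x j :=
    MvPolynomial.eval₂_eq' _ _ _
  rw [← h3, Function.iterate_zero_apply, Finset.filter_true_of_mem (fun _ _ => Nat.zero_le _), h5]
end

end


section

open Polynomial

section
variable {R N : Type*} [CommRing R]

/-- coefficientwise map -/
def mc (d : R →+ R) (P : R[X]) : R[X] := ∑ i ∈ Finset.range (P.natDegree + 1), monomial i (d (P.coeff i))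

theorem mc_coeff (d : R →+ R) (P : R[X]) (i : ℕ) : (mc d P).coeff i = d (P.coeff i) := by
  simp only [mc, finsetSum_coeff, coeff_monomial, Finset.sum_ite_eq', Finset.mem_range]
  split_ifs with h
  · rfl
  · rw [coeff_eq_zero_of_natDegree_lt (by omega), map_zero]

def mch (d : R →+ R) : R[X] →+ R[X] where
  toFun := mc d
  map_zero' := by ext; simp [mc_coeff]
  map_add' := by intros; ext; simp [mc_coeff]

theorem mch_coeff (d : R →+ R) (P : R[X]) (i : ℕ) : (mch d P).coeff i = d (P.coeff i) := mc_coeff d P i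

theorem mch_iter (d : R →+ R) (P : R[X]) (i n : ℕ) : ((mch d)^[n] P).coeff i = d^[n] (P.coeff i) := by
  induction n generalizing P with
  | zero => rfl
  | succ n ih => rw [Function.iterate_succ_apply, ih, mch_coeff, Function.iterate_succ_apply]

theorem mch_der (d : R →+ R) (P : R[X]) : mch d (derivative P) = derivative (mch d P) := by
  ext i
  have : (((i : ℕ) : R) + 1) = ((i + 1 : ℕ) : R) := by push_cast; ring
  rw [mch_coeff, coeff_derivative, coeff_derivative, mch_coeff, this, mul_comm, ← nsmul_eq_mul, map_nsmul,
    nsmul_eq_mul, mul_comm]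

theorem mch_deriv (d : R →+ R) (φ : ℝ → R →+* ℝ) (u x : ℝ)
    (h : ∀ r, HasDerivAt (fun u => φ u r) (φ u (d r)) u) (P : R[X]) :
    HasDerivAt (fun u => P.eval₂ (φ u) x) ((mch d P).eval₂ (φ u) x) u := by
  have hd : (mch d P).natDegree < P.natDegree + 1 := by
    rw [Nat.lt_succ_iff, natDegree_le_iff_coeff_eq_zero]
    intro n hn
    rw [mch_coeff, coeff_eq_zero_of_natDegree_lt hn, map_zero]
  simp only [eval₂_eq_sum_range' _ hd, eval₂_eq_sum_range, mch_coeff]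
  exact HasDerivAt.fun_sum fun i _ => (h _).mul_const _
end

def A0 := Polynomial (Polynomial ℝ)
instance : CommRing A0 := inferInstanceAs (CommRing (Polynomial (Polynomial ℝ)))
instance : IsDomain A0 := inferInstanceAs (IsDomain (Polynomial (Polynomial ℝ)))
abbrev SS := Polynomial A0
def ph (a u : ℝ) : A0 →+* ℝ := eval₂RingHom (R := ℝ[X]) (evalRingHom u) a
def du0 : A0 →+ A0 := mch (R := ℝ[X]) (derivative (R := ℝ)).toAddMonoidHom
def du : SS →+ SS := mch du0

theorem mch_nil {R : Type*} [CommRing R] (d : R →+ R) (h : ∀ r, ∃ N, ∀ n, N ≤ n → d^[n] r = 0) (P : R[X]) :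
    ∃ N, ∀ n, N ≤ n → (mch d)^[n] P = 0 := by
  choose N hN using h
  refine ⟨P.support.sup fun i => N (P.coeff i), fun n hn => ?_⟩
  ext1 i
  rw [mch_iter, coeff_zero]
  by_cases h : P.coeff i = 0
  · rw [h]; exact Function.iterate_fixed (map_zero _) _
  · exact hN _ _ ((Finset.le_sup (f := fun i => N (P.coeff i)) (mem_support_iff.2 h)).trans hn)

theorem ph_deriv (a u : ℝ) (r : A0) : HasDerivAt (fun u => ph a u r) (ph a u (du0 r)) u :=
  mch_deriv (R := ℝ[X]) (derivative (R := ℝ)).toAddMonoidHom (fun u => evalRingHom u) u a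
    (fun r => Polynomial.hasDerivAt r u) r

theorem du_deriv (a u w : ℝ) (P : SS) :
    HasDerivAt (fun u => (P.map (ph a u)).eval w) (((du P).map (ph a u)).eval w) u := by
  simp only [eval_map]
  exact mch_deriv _ (fun u => ph a u) u w (fun r => ph_deriv a u r) P

theorem du_nil (P : SS) : ∃ N, ∀ n, N ≤ n → du^[n] P = 0 :=
  mch_nil _ (fun r => mch_nil (R := ℝ[X]) _ (fun r => ⟨r.natDegree + 1, fun n hn => iterate_derivative_eq_zero hn⟩) r) P

/-- polynomial form of `ph` -/
def Ph0 {κ : Type} (o : κ) (a : ℝ) : A0 →+* MvPolynomial κ ℝ :=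
  eval₂RingHom (R := ℝ[X]) (eval₂RingHom MvPolynomial.C (MvPolynomial.X o)) (MvPolynomial.C a)

theorem Ph0_eq {κ : Type} (o : κ) (a : ℝ) (q : κ → ℝ) : (MvPolynomial.eval q).comp (Ph0 o a) = ph a (q o) := by
  have : (MvPolynomial.eval q).comp (eval₂RingHom (R := ℝ[X]) (eval₂RingHom MvPolynomial.C (MvPolynomial.X o))
    (MvPolynomial.C a)) = eval₂RingHom (R := ℝ[X]) (evalRingHom (q o)) a := by ext <;> simp
  exact this

theorem cont_ph (a : ℝ) (r : A0) : Continuous fun u => ph a u r :=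
  continuous_iff_continuousAt.2 fun u => (ph_deriv a u r).continuousAt

theorem sgJ {a : ℝ} {J : Set ℝ} (hJ : J.OrdConnected) {s : A0} (hs : ∀ u ∈ J, ph a u s ≠ 0) {u v : ℝ} (hu : u ∈ J)
    (hv : v ∈ J) : sg (ph a u s) = sg (ph a v s) :=
  sg_same (f := fun u => ph a u s) (cont_ph a s).continuousOn fun x hx => hs x (hJ.uIcc_subset hu hv hx)

def ev0 (a : ℝ) (u : ℝ) (_ : Fin 0 → ℝ) : A0 →+* ℝ := ph a u

abbrev RH (R : Type*) [CommRing R] := R →+* ℝ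

def evk (a : ℝ) (k : ℕ) (u : ℝ) (z : Fin (k + 1) → ℝ) : RH (MvPolynomial (Fin k) SS) :=
  MvPolynomial.eval₂Hom (eval₂RingHom (ph a u) (z (Fin.last k))) (fun i => z i.castSucc)

theorem Ev.of {R : Type*} [CommRing R] {k : ℕ} {ev : ℝ → (Fin k → ℝ) → (R →+* ℝ)}
    (Φ : R →+* MvPolynomial (Option (Fin k)) ℝ)
    (h : ∀ u z, ev u z = (MvPolynomial.eval fun o => Option.elim o u z).comp Φ) : Ev ev := by
  constructor
  · intro r
    simp only [h, RingHom.comp_apply]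
    refine (MvPolynomial.continuous_eval (Φ r)).comp (continuous_pi fun o => ?_)
    cases o with
    | none => exact continuous_fst
    | some i => exact (continuous_apply i).comp continuous_snd
  · intro r
    simp only [h, RingHom.comp_apply]
    refine DF.of_poly (Φ r) fun x => ?_
    congr 2
    ext (_ | _) <;> rfl

theorem ev0_Ev (a : ℝ) : Ev (ev0 a) := Ev.of (Ph0 none a) fun u z => (Ph0_eq none a fun o => Option.elim o u z).symm

theorem evk_Ev (a : ℝ) (k : ℕ) : Ev (evk a k) :=
  Ev.of (MvPolynomial.eval₂Hom (eval₂RingHom (Ph0 none a)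
    (MvPolynomial.X (some (Fin.last k)))) fun i => MvPolynomial.X (some i.castSucc)) fun u z => by
    apply MvPolynomial.ringHom_ext'
    · apply Polynomial.ringHom_ext'
      · ext x
        have := RingHom.congr_fun (Ph0_eq none a fun o => Option.elim o u z) x
        simp only [RingHom.comp_apply] at this
        simp [evk, this]
      · simp [evk]
    · intro i; simp [evk]

/-- level zero family -/
theorem L0 (W : Finset SS) : ∃ (s : A0) (P0 : Finset SS), s ≠ 0 ∧ (∀ P ∈ W, P ≠ 0 → P ∈ P0) ∧
    (∀ P ∈ P0, (du P = 0 ∨ du P ∈ P0) ∧ (derivative P = 0 ∨ derivative P ∈ P0)) ∧ ∃ B, HC P0 B ∧ ∀ a (J : Set ℝ), J.OrdConnected → (∀ u ∈ J, ph a u s ≠ 0) →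
      Good (ev0 a) J P0 ∧ SP J (ev0 a) (fun _ _ z => z) B := by
  choose N hN using du_nil
  let n := W.sup N + W.sup natDegree + 1
  have h1 : ∀ P ∈ W, ∀ i j, n ≤ i ∨ n ≤ j → derivative^[i] (du^[j] P) = 0 := by
    intro P hP i j hij
    have a1 := Finset.le_sup (f := N) hP
    have a2 := Finset.le_sup (f := natDegree) hP
    rcases hij with h | h
    · have : ∀ j, (du^[j] P).natDegree ≤ P.natDegree := by
        intro j
        rw [natDegree_le_iff_coeff_eq_zero]
        intro l hl
        rw [du, mch_iter, coeff_eq_zero_of_natDegree_lt hl]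
        exact Function.iterate_fixed (map_zero _) _
      exact iterate_derivative_eq_zero (lt_of_le_of_lt (this j) (by omega))
    · rw [hN P j (by omega), iterate_derivative_zero]
  have hcom : ∀ i (P : SS), du (derivative^[i] P) = derivative^[i] (du P) := by
    intro i
    induction i with
    | zero => intro P; rfl
    | succ i ih => intro P; rw [Function.iterate_succ_apply, ih, Function.iterate_succ_apply, du, mch_der]
  let P0 : Finset SS := ((W ×ˢ Finset.range n ×ˢ Finset.range n).image fun p => derivative^[p.2.1] (du^[p.2.2] p.1)).erase 0
  have hmem : ∀ P ∈ W, ∀ i j, derivative^[i] (du^[j] P) ≠ 0 → derivative^[i] (du^[j] P) ∈ P0 := by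
    intro P hP i j h0
    refine Finset.mem_erase.2 ⟨h0, Finset.mem_image.2 ⟨(P, i, j), ?_, rfl⟩⟩
    simp only [Finset.mem_product, Finset.mem_range]
    refine ⟨hP, ?_, ?_⟩
    · by_contra h; exact h0 (h1 P hP i j (Or.inl (by omega)))
    · by_contra h; exact h0 (h1 P hP i j (Or.inr (by omega)))
  have hinv : ∀ P ∈ P0, P ≠ 0 ∧ ∃ P' ∈ W, ∃ i j, P = derivative^[i] (du^[j] P') := by
    intro P hP
    obtain ⟨h0, hP⟩ := Finset.mem_erase.1 hP
    obtain ⟨⟨P', i, j⟩, hm, rfl⟩ := Finset.mem_image.1 hP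
    exact ⟨h0, P', (Finset.mem_product.1 hm).1, i, j, rfl⟩
  obtain ⟨B, hB⟩ := HC_exists P0
  refine ⟨(∏ P ∈ P0, P.leadingCoeff) * ∏ b ∈ B.erase 0, b, P0, ?_, ?_, ?_, B, hB, ?_⟩
  · refine mul_ne_zero (Finset.prod_ne_zero_iff.2 fun P hP => leadingCoeff_ne_zero.2 (hinv P hP).1)
      (Finset.prod_ne_zero_iff.2 fun b hb => (Finset.mem_erase.1 hb).1)
  · intro P hP h0; exact hmem P hP 0 0 h0
  · intro P hP
    obtain ⟨-, P', hP', i, j, rfl⟩ := hinv P hP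
    rw [hcom, ← Function.iterate_succ_apply' du, ← Function.iterate_succ_apply' derivative]
    exact ⟨or_iff_not_imp_left.2 (hmem _ hP' _ _), or_iff_not_imp_left.2 (hmem _ hP' _ _)⟩
  · intro a J hJ hs
    have hs1 : ∀ u ∈ J, (∀ P ∈ P0, ph a u P.leadingCoeff ≠ 0) ∧ ∀ b ∈ B.erase 0, ph a u b ≠ 0 := by
      intro u hu
      have := hs u hu
      rw [map_mul, map_prod, map_prod, mul_ne_zero_iff, Finset.prod_ne_zero_iff, Finset.prod_ne_zero_iff] at this
      exact this
    refine ⟨⟨fun u hu z P hP h0 => ?_, fun u hu z P hP => ?_⟩, fun u hu v hv z b hb => ?_⟩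
    · have := congrArg (fun q => q.coeff P.natDegree) h0
      simp only [coeff_map, coeff_zero] at this
      exact (hs1 u hu).1 P hP this
    · rw [derivative_map]
      obtain ⟨-, P', hP', i, j, rfl⟩ := hinv P hP
      rw [← Function.iterate_succ_apply' derivative]
      by_cases h : derivative^[i + 1] (du^[j] P') = 0
      · left; rw [h, Polynomial.map_zero]
      · right; exact ⟨_, hmem _ hP' _ _ h, 1, by rw [C_1, one_mul]⟩
    · by_cases h : b = 0
      · subst h; simp only [map_zero]
      · exact sgJ hJ (fun x hx => (hs1 x hx).2 b (Finset.mem_erase.2 ⟨h, hb⟩)) hu hv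

theorem Tr.conj {k : ℕ} {J : Set ℝ} {τ : ℝ → ℝ → (Fin k → ℝ) → (Fin k → ℝ)} (ht : Tr J τ)
    {σ ρ : (Fin k → ℝ) → (Fin k → ℝ)} (h1 : ∀ x, ρ (σ x) = x) (h2 : ∀ x, σ (ρ x) = x) (c1 : Continuous σ)
    (c2 : Continuous ρ) (d1 : ∀ i, DF fun x => σ x i) (d2 : ∀ i, DF fun x => ρ x i) :
    Tr J fun u v x => σ (τ u v (ρ x)) := by
  constructor
  · intro u hu v hv z
    refine c1.continuousAt.comp ?_
    exact ContinuousAt.comp (g := fun p : ℝ × ℝ × (Fin k → ℝ) => τ p.1 p.2.1 p.2.2)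
      (f := fun p : ℝ × ℝ × (Fin k → ℝ) => (p.1, p.2.1, ρ p.2.2)) (x := (u, v, z)) (ht.cont u hu v hv _) (by fun_prop)
  · intro u hu z; rw [ht.id u hu, h2]
  · intro u hu v hv w hw z; rw [h1, ht.coc u hu v hv w hw]
  · intro ι U V Z hU hV hZ i
    exact DF.comp (d1 i) fun j => ht.df hU hV (Z := fun j x => ρ (fun l => Z l x) j) (fun j => DF.comp (d2 j) hZ) j

theorem Tr.id0 (J : Set ℝ) : Tr J (fun _ _ (z : Fin 0 → ℝ) => z) :=
  ⟨fun _ _ _ _ _ => Continuous.continuousAt (by fun_prop), fun _ _ _ => rfl, fun _ _ _ _ _ _ _ => rfl, fun _ _ hZ i => hZ i⟩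

/-- level zero transport -/
def om (a : ℝ) (P0 : Finset SS) (u v w : ℝ) : ℝ :=
  ci (kap (KK P0) (rts P0 (ph a u)) (rts P0 (ph a v)) (cp w))

theorem GG (W : Finset SS) : ∀ (k : ℕ) (Q : Finset (MvPolynomial (Fin k) SS)), ∃ (s : A0) (P0 : Finset SS), s ≠ 0 ∧
    (∀ P ∈ W, P ≠ 0 → P ∈ P0) ∧ (∀ P ∈ P0, (du P = 0 ∨ du P ∈ P0) ∧ (derivative P = 0 ∨ derivative P ∈ P0)) ∧ ∃ B, HC P0 B ∧
    ∀ a (J : Set ℝ), IsOpen J → J.OrdConnected → (∀ u ∈ J, ph a u s ≠ 0) →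
      (Good (ev0 a) J P0 ∧ SP J (ev0 a) (fun _ _ z => z) B) ∧ ∃ τ, Tr J τ ∧ SP J (evk a k) τ Q ∧
        ∀ u ∈ J, ∀ v ∈ J, ∀ z, τ u v z (Fin.last k) = om a P0 u v (z (Fin.last k)) := by
  intro k
  induction k with
  | zero =>
    intro Q
    obtain ⟨s, P0, h1, h2, h3, B, hB, h4⟩ := L0 (W ∪ Q.image MvPolynomial.constantCoeff)
    refine ⟨s, P0, h1, fun P hP => h2 P (Finset.mem_union_left _ hP), h3, B, hB, fun a J hJ hJ' hs => ?_⟩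
    obtain ⟨hg, hsp⟩ := h4 a J hJ' hs
    refine ⟨⟨hg, hsp⟩, stp (ev0 a) (fun _ _ z => z) P0, stp_tr (ev0_Ev a) hJ hJ' (Tr.id0 J) hg hB hsp, ?_, ?_⟩
    · intro u hu v hv z b hb
      have he : ∀ u z, evk a 0 u z b = ((MvPolynomial.constantCoeff b).map (ph a u)).eval (z 0) := by
        intro u z
        conv_lhs => rw [MvPolynomial.eq_C_of_isEmpty b]
        simp [evk, eval_map, MvPolynomial.constantCoeff_eq]
      rw [he, he]
      by_cases h0 : MvPolynomial.constantCoeff b = 0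
      · simp [h0]
      · exact (stp_sign hg hB hsp hu hv (Fin.tail z)).2 _
          (h2 _ (Finset.mem_union_right _ (Finset.mem_image_of_mem _ hb)) h0) (z 0)
    · intro u hu v hv z; rfl
  | succ k ih =>
    intro Q
    let e := (Q.sup fun q => q.support.sup fun x => Finset.univ.sup fun j => x j) + 1
    have he : ∀ q ∈ Q, ∀ x ∈ q.support, ∀ j, x j < e := fun q hq x hx j => Nat.lt_succ_of_le
      ((Finset.le_sup (f := fun j => x j) (Finset.mem_univ j)).trans ((Finset.le_sup
        (f := fun x : Fin (k + 1) →₀ ℕ => Finset.univ.sup fun j => x j) hx).trans (Finset.le_sup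
        (f := fun q : MvPolynomial (Fin (k + 1)) SS => q.support.sup fun x => Finset.univ.sup fun j => x j) hq)))
    have hfam : ∀ q : MvPolynomial (Fin (k + 1)) SS, ∃ (m : A0) (d : SS) (F : Finset (MvPolynomial (Fin k) SS)[X])
      (F0 : (MvPolynomial (Fin k) SS)[X]), q ∈ Q → q ≠ 0 → m ≠ 0 ∧ F0 ∈ F ∧
      C (MvPolynomial.C (C m)) * Ng A0 k e q = C (MvPolynomial.C d) * F0 ∧
      ∀ φ : MvPolynomial (Fin k) SS →+* ℝ, φ (MvPolynomial.C (C m)) ≠ 0 → ∀ P ∈ F, P.map φ ≠ 0 ∧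
        (derivative (P.map φ) = 0 ∨ ∃ Q ∈ F, ∃ c : ℝ, derivative (P.map φ) = C c * Q.map φ) := by
      intro q
      by_cases h : q ∈ Q ∧ q ≠ 0
      · obtain ⟨m, d, F, F0, h1⟩ := Ng_fam (A := A0) q (he q h.1) (Nat.succ_pos _) h.2
        exact ⟨m, d, F, F0, fun _ _ => h1⟩
      · exact ⟨0, 0, ∅, 0, fun h1 h2 => absurd ⟨h1, h2⟩ h⟩
    choose m d F F0 hF using hfam
    let FF := (Q.erase 0).biUnion F
    obtain ⟨B1, hB1⟩ := HC_exists FF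
    obtain ⟨s, P0, h1, h2, h3, B, hB, h4⟩ := ih (B1 ∪ Q.image fun q => MvPolynomial.C (d q))
    refine ⟨s * ∏ q ∈ Q.erase 0, m q, P0, mul_ne_zero h1 (Finset.prod_ne_zero_iff.2 fun q hq =>
      (hF q (Finset.mem_of_mem_erase hq) (Finset.ne_of_mem_erase hq)).1), h2, h3, B, hB, fun a J hJ hJ' hs => ?_⟩
    have hs' : ∀ u ∈ J, ph a u s ≠ 0 ∧ ∀ q ∈ Q.erase 0, ph a u (m q) ≠ 0 := by
      intro u hu
      have := hs u hu
      rwa [map_mul, map_prod, mul_ne_zero_iff, Finset.prod_ne_zero_iff] at this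
    obtain ⟨h5, τ, hτ, hsp, hom⟩ := h4 a J hJ hJ' fun u hu => (hs' u hu).1
    refine ⟨h5, ?_⟩
    have evC : ∀ u z (c : A0), evk a k u z (MvPolynomial.C (C c)) = ph a u c := by
      intro u z c; simp [evk]
    have hg : Good (evk a k) J FF := by
      have key : ∀ u ∈ J, ∀ z, ∀ P ∈ FF, P.map (evk a k u z) ≠ 0 ∧ (derivative (P.map (evk a k u z)) = 0 ∨
          ∃ Q ∈ FF, ∃ c : ℝ, derivative (P.map (evk a k u z)) = C c * Q.map (evk a k u z)) := by
        intro u hu z P hP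
        obtain ⟨q, hq, hP⟩ := Finset.mem_biUnion.1 hP
        obtain ⟨a1, a2⟩ := (hF q (Finset.mem_of_mem_erase hq) (Finset.ne_of_mem_erase hq)).2.2.2 (evk a k u z)
          (by rw [evC]; exact (hs' u hu).2 q hq) P hP
        refine ⟨a1, a2.imp id ?_⟩
        rintro ⟨Q', hQ', c, h⟩
        exact ⟨Q', Finset.mem_biUnion.2 ⟨q, hq, hQ'⟩, c, h⟩
      exact ⟨fun u hu z P hP => (key u hu z P hP).1, fun u hu z P hP => (key u hu z P hP).2⟩
    have hsp1 : SP J (evk a k) τ B1 := fun u hu v hv z b hb => hsp u hu v hv z b (Finset.mem_union_left _ hb)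
    have htr := stp_tr (evk_Ev a k) hJ hJ' hτ hg hB1 hsp1
    let pe : Fin (k + 2) → ℝ → ℝ := fun j t => if j = 0 ∨ j = Fin.last _ then 0 else t ^ (e ^ (j : ℕ))
    have pe0 : ∀ t, pe 0 t = 0 := fun t => if_pos (Or.inl rfl)
    have pel : ∀ t, pe (Fin.last _) t = 0 := fun t => if_pos (Or.inr rfl)
    have pec : ∀ j, Continuous (pe j) := by
      intro j
      by_cases h : j = 0 ∨ j = Fin.last _
      · simp only [pe, if_pos h]; fun_prop
      · simp only [pe, if_neg h]; fun_prop
    have ped : ∀ j, DF fun x : Fin (k + 2) → ℝ => pe j (x 0) := by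
      intro j
      by_cases h : j = 0 ∨ j = Fin.last _
      · simp only [pe, if_pos h]; exact DF.const 0
      · simp only [pe, if_neg h]; exact (DF.proj 0).pow _
    let σ : (Fin (k + 2) → ℝ) → (Fin (k + 2) → ℝ) := fun y j => y j + pe j (y 0)
    let ρ : (Fin (k + 2) → ℝ) → (Fin (k + 2) → ℝ) := fun y j => y j - pe j (y 0)
    have hρσ : ∀ x, ρ (σ x) = x := by intro x; ext j; simp [σ, ρ, pe0]
    have hσρ : ∀ x, σ (ρ x) = x := by intro x; ext j; simp [σ, ρ, pe0]
    have hev : ∀ u x q, evk a (k + 1) u x q = ((Ng A0 k e q).map (evk a k u (Fin.tail (ρ x)))).eval (x 0) := by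
      intro u x q
      have : evk a (k + 1) u x = (eval₂RingHom (evk a k u (Fin.tail (ρ x))) (x 0)).comp (Ng A0 k e) := by
        apply MvPolynomial.ringHom_ext'
        · ext
          · simp [evk, Ng]
          · simp [evk, Ng, Fin.tail, ρ, pel]
        · intro j
          refine Fin.cases ?_ (fun j => ?_) j
          · simp [evk, Ng, Nb]
          · have hj : pe j.castSucc.succ (x 0) = x 0 ^ (e ^ ((j : ℕ) + 1)) := by
              refine (if_neg ?_).trans (by simp)
              rintro (h | h)
              · exact Fin.succ_ne_zero _ h
              · rw [← Fin.succ_last] at h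
                exact (Fin.castSucc_lt_last j).ne (Fin.succ_injective _ h)
            simp [evk, Ng, Nb, Fin.tail, ρ, hj]
      rw [this, eval_map]; rfl
    refine ⟨fun u v x => σ (stp (evk a k) τ FF u v (ρ x)), htr.conj hρσ hσρ
      (continuous_pi fun j => (continuous_apply j).add ((pec j).comp (continuous_apply 0)))
      (continuous_pi fun j => (continuous_apply j).sub ((pec j).comp (continuous_apply 0)))
      (fun j => (DF.proj j).add (ped j)) (fun j => (DF.proj j).sub (ped j)), ?_, ?_⟩
    · intro u hu v hv x q hq
      by_cases hq0 : q = 0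
      · simp [hq0]
      obtain ⟨c1, c2, c3, -⟩ := hF q hq hq0
      set x' := σ (stp (evk a k) τ FF u v (ρ x)) with hx'
      have hz : Fin.tail (ρ x') = τ u v (Fin.tail (ρ x)) := by rw [hx', hρσ, stp_tail]
      have hrel : ∀ u x, ph a u (m q) * evk a (k + 1) u x q = evk a k u (Fin.tail (ρ x)) (MvPolynomial.C (d q)) *
          ((F0 q).map (evk a k u (Fin.tail (ρ x)))).eval (x 0) := by
        intro u x
        have := congrArg (fun p => (p.map (evk a k u (Fin.tail (ρ x)))).eval (x 0)) c3
        simp only [Polynomial.map_mul, map_C, eval_mul, eval_C, evC] at this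
        rw [hev, this]
      have s1 := congrArg sg (hrel u x)
      have s2 := congrArg sg (hrel v x')
      rw [sign_mul, sign_mul] at s1 s2
      have hqe : q ∈ Q.erase 0 := Finset.mem_erase.2 ⟨hq0, hq⟩
      have s3 := sgJ hJ' (fun u hu => (hs' u hu).2 q hqe) hu hv
      have s4 := hsp u hu v hv (Fin.tail (ρ x)) (MvPolynomial.C (d q))
        (Finset.mem_union_right _ (Finset.mem_image_of_mem _ hq))
      have s5 := (stp_sign hg hB1 hsp1 hu hv (Fin.tail (ρ x))).2 (F0 q) (Finset.mem_biUnion.2 ⟨q, hqe, c2⟩) (x 0)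
      have s6 : x' 0 = ci (kap (KK FF) (rts FF (evk a k u (Fin.tail (ρ x)))) (rts FF (evk a k v (τ u v (Fin.tail (ρ x))))) (cp (x 0))) := by
        simp [hx', σ, pe0, stp, ρ]
      rw [hz, s6, ← s4, ← s5, ← s1, ← s3] at s2
      have s7 : sg (ph a u (m q)) ≠ 0 := by rw [Ne, sign_eq_zero_iff]; exact (hs' u hu).2 q hqe
      exact (mul_left_cancel₀ s7 s2).symm
    · intro u hu v hv x
      have := hom u hu v hv (Fin.tail (ρ x))
      rw [← stp_tail (ev := evk a k) (τ := τ) (F := FF)] at this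
      simp only [Fin.tail, Fin.succ_last] at this
      simpa [σ, ρ, pel] using this

end


section

open Polynomial

theorem mvt (p : ℝ[X]) (x y : ℝ) : ∃ ξ, |ξ - x| ≤ |y - x| ∧ p.eval y - p.eval x = (y - x) * (derivative p).eval ξ := by
  rcases lt_trichotomy x y with h | rfl | h
  · obtain ⟨ξ, h1, h2⟩ := exists_hasDerivAt_eq_slope (fun t => p.eval t) (fun t => (derivative p).eval t) h
      p.continuous.continuousOn fun t _ => p.hasDerivAt t
    refine ⟨ξ, ?_, ?_⟩
    · rw [abs_of_pos (sub_pos.2 h1.1), abs_of_pos (sub_pos.2 h)]; linarith [h1.2]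
    · rw [h2, mul_div_cancel₀ _ (sub_pos.2 h).ne']
  · exact ⟨x, by simp, by simp⟩
  · obtain ⟨ξ, h1, h2⟩ := exists_hasDerivAt_eq_slope (fun t => p.eval t) (fun t => (derivative p).eval t) h
      p.continuous.continuousOn fun t _ => p.hasDerivAt t
    refine ⟨ξ, ?_, ?_⟩
    · rw [abs_of_neg (sub_neg.2 h1.2), abs_of_neg (sub_neg.2 h)]; linarith [h1.1]
    · rw [h2, ← neg_sub x y, neg_mul, mul_div_cancel₀ _ (sub_pos.2 h).ne', neg_sub]

section
variable {a : ℝ} {J : Set ℝ} {P0 : Finset SS} {B : Finset A0}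

theorem om_sign (hg : Good (ev0 a) J P0) (hB : HC P0 B) (hsp : SP J (ev0 a) (fun _ _ z => z) B) {u v : ℝ} (hu : u ∈ J)
    (hv : v ∈ J) {P : SS} (hP : P ∈ P0) (w : ℝ) :
    sg ((P.map (ph a u)).eval w) = sg ((P.map (ph a v)).eval (om a P0 u v w)) :=
  (stp_sign hg hB hsp hu hv Fin.elim0).2 P hP w

theorem om_card (hg : Good (ev0 a) J P0) (hB : HC P0 B) (hsp : SP J (ev0 a) (fun _ _ z => z) B) {u v : ℝ} (hu : u ∈ J)
    (hv : v ∈ J) : (rts P0 (ph a u)).card = (rts P0 (ph a v)).card :=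
  (stp_sign hg hB hsp hu hv Fin.elim0).1

theorem om_tr (hJ : IsOpen J) (hJ' : J.OrdConnected) (hg : Good (ev0 a) J P0) (hB : HC P0 B)
    (hsp : SP J (ev0 a) (fun _ _ z => z) B) : Tr J (stp (ev0 a) (fun _ _ z => z) P0) :=
  stp_tr (ev0_Ev a) hJ hJ' (Tr.id0 J) hg hB hsp

theorem om_cont (hJ : IsOpen J) (hJ' : J.OrdConnected) (hg : Good (ev0 a) J P0) (hB : HC P0 B)
    (hsp : SP J (ev0 a) (fun _ _ z => z) B) {u v : ℝ} (hu : u ∈ J) (hv : v ∈ J) (w : ℝ) :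
    ContinuousAt (fun p : ℝ × ℝ × ℝ => om a P0 p.1 p.2.1 p.2.2) (u, v, w) := by
  have h1 := continuousAt_pi.1 ((om_tr hJ hJ' hg hB hsp).cont u hu v hv fun _ => w) 0
  exact ContinuousAt.comp (x := (u, v, w))
    (f := fun p : ℝ × ℝ × ℝ => ((p.1, p.2.1, fun _ => p.2.2) : ℝ × ℝ × (Fin 1 → ℝ))) h1 (by fun_prop)

theorem om_coc (hJ : IsOpen J) (hJ' : J.OrdConnected) (hg : Good (ev0 a) J P0) (hB : HC P0 B)
    (hsp : SP J (ev0 a) (fun _ _ z => z) B) {u v x : ℝ} (hu : u ∈ J) (hv : v ∈ J) (hx : x ∈ J) (w : ℝ) :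
    om a P0 v x (om a P0 u v w) = om a P0 u x w := by
  have h1 := congrFun ((om_tr hJ hJ' hg hB hsp).coc u hu v hv x hx fun _ => w) 0
  exact h1

theorem om_root (hJ : IsOpen J) (hJ' : J.OrdConnected) (hg : Good (ev0 a) J P0) (hB : HC P0 B)
    (hsp : SP J (ev0 a) (fun _ _ z => z) B) (hdu : ∀ P ∈ P0, (du P = 0 ∨ du P ∈ P0) ∧ (derivative P = 0 ∨ derivative P ∈ P0)) {u : ℝ} (hu : u ∈ J) {w : ℝ}
    (hw : cp w ∈ rts P0 (ph a u)) :
    StrictMonoOn (fun v => om a P0 u v w) J ∨ AntitoneOn (fun v => om a P0 u v w) J := by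
  set c := fun v => om a P0 u v w with hc
  obtain ⟨P1, hP1, hP10, ht1⟩ := cp_mem_rts.1 hw
  obtain ⟨Q', hQ', hQ0, hQ1⟩ := simple_root (G := P0.image fun P => P.map (ph a u)) (t := w) (by
    intro P' hP'
    obtain ⟨P, hP, rfl⟩ := Finset.mem_image.1 hP'
    rcases hg.der u hu Fin.elim0 P hP with h | ⟨Q, hQ, c, h⟩
    · exact Or.inl h
    · exact Or.inr ⟨_, Finset.mem_image_of_mem _ hQ, c, h⟩) _ _ (Finset.mem_image_of_mem _ hP1) hP10 le_rfl ht1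
  obtain ⟨P, hP, rfl⟩ := Finset.mem_image.1 hQ'
  -- signs along the curve
  have z0 : ∀ v ∈ J, (P.map (ph a v)).eval (c v) = 0 := by
    intro v hv
    have := om_sign hg hB hsp hu hv hP w
    rw [hQ0, sign_zero] at this
    exact sign_eq_zero_iff.1 this.symm
  have su : ∀ v ∈ J, sg (((du P).map (ph a u)).eval w) = sg (((du P).map (ph a v)).eval (c v)) := by
    intro v hv
    rcases (hdu P hP).1 with h | h
    · simp [h]
    · exact om_sign hg hB hsp hu hv h w
  have hcc : ∀ v ∈ J, ContinuousAt c v := fun v hv =>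
    ContinuousAt.comp (x := v) (f := fun v => (u, v, w)) (om_cont hJ hJ' hg hB hsp hu hv w) (by fun_prop)
  have sw : ∀ v ∈ J, sg ((derivative (P.map (ph a u))).eval w) = sg ((derivative (P.map (ph a v))).eval (c v)) := by
    intro v hv
    rw [derivative_map, derivative_map]
    rcases (hdu P hP).2 with h | h
    · simp [h]
    · exact om_sign hg hB hsp hu hv h w
  have hd : ∀ v ∈ J, HasDerivAt c (-(((du P).map (ph a v)).eval (c v)) / (derivative (P.map (ph a v))).eval (c v)) v := by
    intro v hv
    have nz : (derivative (P.map (ph a v))).eval (c v) ≠ 0 := by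
      rw [← sign_ne_zero, ← sw v hv, sign_ne_zero]; exact hQ1
    have hq := hasDerivAt_iff_tendsto_slope.1 (du_deriv a v (c v) P)
    choose ξ x1 x2 using fun v' => mvt (P.map (ph a v')) (c v) (c v')
    have hξ : Tendsto ξ (𝓝[≠] v) (𝓝 (c v)) := by
      rw [tendsto_iff_norm_sub_tendsto_zero]
      refine squeeze_zero (fun _ => norm_nonneg _) (fun v' => x1 v') ?_
      exact tendsto_iff_norm_sub_tendsto_zero.1 ((hcc v hv).mono_left nhdsWithin_le_nhds)
    have hw' : Tendsto (fun v' => (derivative (P.map (ph a v'))).eval (ξ v')) (𝓝[≠] v)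
        (𝓝 ((derivative (P.map (ph a v))).eval (c v))) := by
      have h1 := ((ev0_Ev a).pcont (derivative P)).tendsto ((v, Fin.elim0), c v)
      have h2 : Tendsto (fun v' : ℝ => (((v', Fin.elim0), ξ v') : (ℝ × (Fin 0 → ℝ)) × ℝ)) (𝓝[≠] v) (𝓝 ((v, Fin.elim0), c v)) :=
        (Tendsto.prodMk_nhds (tendsto_id.mono_left nhdsWithin_le_nhds) tendsto_const_nhds).prodMk_nhds hξ
      have h3 := h1.comp h2
      simp only [derivative_map]
      exact h3
    rw [hasDerivAt_iff_tendsto_slope]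
    refine (hq.neg.div hw' nz).congr' ?_
    filter_upwards [hw'.eventually_ne nz, self_mem_nhdsWithin, mem_nhdsWithin_of_mem_nhds (hJ.mem_nhds hv)] with v' h1 h2 h3
    have h4 := x2 v'
    rw [z0 v' h3, zero_sub] at h4
    have h5 := z0 v hv
    simp only [Pi.div_apply, slope_def_field, h5, sub_zero]
    rw [div_eq_iff h1, ← neg_div, h4]
    ring
  have hsgn : ∀ v ∈ J, sg (deriv c v) = sg (-(((du P).map (ph a u)).eval w) / (derivative (P.map (ph a u))).eval w) := by
    intro v hv
    have sinv : ∀ x : ℝ, sg x⁻¹ = sg x := by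
      intro x
      rcases lt_trichotomy x 0 with h | rfl | h
      · rw [sign_neg h, sign_neg (inv_lt_zero.2 h)]
      · simp
      · rw [sign_pos h, sign_pos (inv_pos.2 h)]
    rw [(hd v hv).deriv, div_eq_mul_inv, div_eq_mul_inv, neg_mul, neg_mul, Left.sign_neg, Left.sign_neg, sign_mul,
      sign_mul, su v hv, sinv, sinv, sw v hv]
  have hco : ContinuousOn c J := fun v hv => (hcc v hv).continuousWithinAt
  by_cases hpos : 0 < -(((du P).map (ph a u)).eval w) / (derivative (P.map (ph a u))).eval w
  · left
    refine strictMonoOn_of_deriv_pos hJ'.convex hco fun v hv => ?_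
    rw [← sign_eq_one_iff, hsgn v (interior_subset hv), sign_eq_one_iff]; exact hpos
  · right
    refine antitoneOn_of_deriv_nonpos hJ'.convex hco
      (fun v hv => (hd v (interior_subset hv)).differentiableAt.differentiableWithinAt) fun v hv => ?_
    by_contra h
    rw [not_le, ← sign_eq_one_iff, hsgn v (interior_subset hv), sign_eq_one_iff] at h
    exact hpos h

theorem om_strict (hJ : IsOpen J) (hJ' : J.OrdConnected) (hg : Good (ev0 a) J P0) (hB : HC P0 B)
    (hsp : SP J (ev0 a) (fun _ _ z => z) B) (hdu : ∀ P ∈ P0, (du P = 0 ∨ du P ∈ P0) ∧ (derivative P = 0 ∨ derivative P ∈ P0))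
    {u : ℝ} (hu : u ∈ J) {W : Set ℝ} (hW : IsCompact W)
    (hs : ∀ w ∈ W, ∀ t, (∀ P ∈ P0, sg ((P.map (ph a u)).eval w) = sg ((P.map (ph a u)).eval t)) → t ∈ W) {u0 u1 : ℝ}
    (h0 : u0 ∈ J) (h1 : u1 ∈ J) (h01 : u0 ≤ u1) (h : ∀ w ∈ W, om a P0 u u0 w < om a P0 u u1 w) :
    ∀ w ∈ W, StrictMonoOn (fun v => om a P0 u v w) J := by
  intro w hw
  have root : ∀ w ∈ W, cp w ∈ rts P0 (ph a u) → StrictMonoOn (fun v => om a P0 u v w) J := by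
    intro w hw hr
    refine (om_root hJ hJ' hg hB hsp hdu hu hr).resolve_right fun h' => ?_
    exact absurd (h' h0 h1 h01) (not_le.2 (h w hw))
  by_cases hr : cp w ∈ rts P0 (ph a u)
  · exact root w hw hr
  set A := fun v => rts P0 (ph a v) with hA
  have io : ∀ v, Iop (A v) := fun v => rts_io _ _
  obtain ⟨i, hi, l1, l2⟩ := nd_loc (io u) (cp_mem w).1.le (cp_mem w).2
  have l1 : nd (A u) i < cp w := by
    refine lt_of_le_of_ne l1 fun he => ?_
    cases i with
    | zero => exact absurd he (cp_mem w).1.ne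
    | succ i => exact hr (he ▸ (nd_mem (io u) hi).1)
  have gap : ∀ t, nd (A u) i < cp t → cp t < nd (A u) (i + 1) → t ∈ W := by
    intro t ht1 ht2
    refine hs w hw t fun P hP => sg_same (P.map (ph a u)).continuous.continuousOn fun x hx he => ?_
    have hm : cp x ∈ A u := cp_mem_rts.2 ⟨P, hP, hg.nv u hu Fin.elim0 P hP, he⟩
    have hx1 := cp_mono.monotone hx.1
    have hx2 := cp_mono.monotone hx.2
    rcases le_total w t with hwt | hwt <;> simp only [hwt, inf_of_le_left, inf_of_le_right, sup_of_le_left, sup_of_le_right] at hx1 hx2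
    · exact absurd (nd_gap hm (l1.trans_le hx1)) (not_le.2 (hx2.trans_lt ht2))
    · exact absurd (nd_gap hm (ht1.trans_le hx1)) (not_le.2 (hx2.trans_lt l2))
  obtain ⟨i, rfl⟩ : ∃ j, i = j + 1 := by
    cases i with
    | succ i => exact ⟨i, rfl⟩
    | zero =>
      obtain ⟨b, hb⟩ := hW.bddBelow
      have := hb (gap (min w b - 1) (cp_mem _).1 ((cp_mono.monotone (by linarith [min_le_left w b])).trans_lt l2))
      linarith [min_le_right w b]
  have hi2 : i + 1 < (A u).card := by
    refine lt_of_le_of_ne hi fun he => ?_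
    obtain ⟨b, hb⟩ := hW.bddAbove
    have := hb (gap (max w b + 1) (l1.trans_le (cp_mono.monotone (by linarith [le_max_left w b])))
      (by rw [nd_ge (io u) _ (by omega)]; exact (cp_mem _).2))
    linarith [le_max_right w b]
  have m1 := (nd_mem (io u) (show i < (A u).card by omega)).1
  have m2 := (nd_mem (io u) hi2).1
  have e1 := cp_ci (io u _ m1)
  have e2 := cp_ci (io u _ m2)
  set w1 := ci (nd (A u) (i + 1))
  set w2 := ci (nd (A u) (i + 1 + 1))
  rw [← e1] at l1
  rw [← e2] at l2
  have hcl : Set.Icc w1 w2 ⊆ W := by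
    rw [← closure_Ioo ((cp_mono.lt_iff_lt.1 l1).trans (cp_mono.lt_iff_lt.1 l2)).ne]
    refine hW.isClosed.closure_subset_iff.2 fun t ht => gap t ?_ ?_
    · rw [← e1]; exact cp_mono ht.1
    · rw [← e2]; exact cp_mono ht.2
  have w12 : w1 ≤ w2 := ((cp_mono.lt_iff_lt.1 l1).trans (cp_mono.lt_iff_lt.1 l2)).le
  have r1 := root w1 (hcl ⟨le_rfl, w12⟩) (by rw [e1]; exact m1)
  have r2 := root w2 (hcl ⟨w12, le_rfl⟩) (by rw [e2]; exact m2)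
  set θ := (cp w - cp w1) / (cp w2 - cp w1) with hθ
  have hpos : 0 < cp w2 - cp w1 := by linarith
  have t0 : 0 < θ := div_pos (by linarith) hpos
  have t1 : θ < 1 := (div_lt_one hpos).2 (by linarith)
  have key : ∀ v ∈ J, cp (om a P0 u v w) = cp (om a P0 u v w1) + (cp (om a P0 u v w2) - cp (om a P0 u v w1)) * θ := by
    intro v hv
    have hc : (A u).card = (A v).card := om_card hg hB hsp hu hv
    have hK := rts_card P0 (ph a u)
    have q : ∀ t, cp (om a P0 u v t) = kap (KK P0) (A u) (A v) (cp t) := fun t =>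
      cp_ci (kap_mem (io u) (io v) hc hK (cp_mem t))
    have hle : nd (A u) (i + 1) ≤ nd (A u) (i + 1 + 1) := by rw [← e1, ← e2]; linarith
    rw [q, q, q, kap_eq (io u) (io v) hc hK hi (e1 ▸ l1.le) (e2 ▸ l2.le), e1, e2,
      kap_eq (io u) (io v) hc hK hi le_rfl hle, kap_eq (io u) (io v) hc hK hi hle le_rfl, div_self (by rw [← e1, ← e2]; exact hpos.ne'), hθ, e1, e2]
    simp
  intro v hv v' hv' hvv
  have q1 := cp_mono (r1 hv hv' hvv)
  have q2 := cp_mono (r2 hv hv' hvv)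
  rw [← cp_mono.lt_iff_lt]
  simp only at q1 q2 ⊢
  rw [key v hv, key v' hv']
  nlinarith
end

end


section

open Polynomial

def cA : ℝ →+* A0 := (C : ℝ[X] →+* ℝ[X][X]).comp C
def aA : A0 := (X : ℝ[X][X])
def uA : A0 := (C (X : ℝ[X]) : ℝ[X][X])
theorem ph_c (a u r : ℝ) : ph a u (cA r) = r := by
  change eval₂RingHom (R := ℝ[X]) (evalRingHom u) a (C (C r)) = r; simp
theorem ph_a (a u : ℝ) : ph a u aA = a := by
  change eval₂RingHom (R := ℝ[X]) (evalRingHom u) a X = a; simp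
theorem ph_u (a u : ℝ) : ph a u uA = u := by
  change eval₂RingHom (R := ℝ[X]) (evalRingHom u) a (C X) = u; simp
theorem ph_cc (a u : ℝ) : (ph a u).comp cA = RingHom.id ℝ := RingHom.ext fun r => ph_c a u r

def tw : MvPolynomial (Bool ⊕ Unit) ℝ →+* SS :=
  MvPolynomial.eval₂Hom ((C : A0 →+* SS).comp cA) (Sum.elim (fun b => C (if b then uA else aA)) fun _ => X)
def tk (k : ℕ) : MvPolynomial (Bool ⊕ Fin (k + 1)) ℝ →+* MvPolynomial (Fin k) SS :=
  MvPolynomial.eval₂Hom ((MvPolynomial.C : SS →+* _).comp ((C : A0 →+* SS).comp cA))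
    (Sum.elim (fun b => MvPolynomial.C (C (if b then uA else aA)))
      (Fin.lastCases (MvPolynomial.C X) fun i => MvPolynomial.X i))
def pt {κ : Type} (a u : ℝ) (z : κ → ℝ) : Bool ⊕ κ → ℝ := Sum.elim (fun b => if b then u else a) z

theorem tw_eq (a u w : ℝ) (p) : ((tw p).map (ph a u)).eval w = MvPolynomial.eval (pt a u fun _ => w) p := by
  rw [eval_map]
  have : (eval₂RingHom (ph a u) w).comp tw = MvPolynomial.eval (pt a u fun _ => w) := by
    apply MvPolynomial.ringHom_ext
    · intro r; simp [tw, ph_c]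
    · rintro ((_ | _) | _) <;> simp [tw, pt, ph_a, ph_u]
  exact RingHom.congr_fun this p
theorem tk_eq (a : ℝ) (k : ℕ) (u : ℝ) (z) (p) : evk a k u z (tk k p) = MvPolynomial.eval (pt a u z) p := by
  have : (evk a k u z).comp (tk k) = MvPolynomial.eval (pt a u z) := by
    apply MvPolynomial.ringHom_ext
    · intro r; simp [tk, evk, ph_c]
    · rintro ((_ | _) | i)
      · simp [tk, pt, evk, ph_a]
      · simp [tk, pt, evk, ph_u]
      · refine Fin.lastCases ?_ (fun i => ?_) i <;> simp [tk, pt, evk]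
  exact RingHom.congr_fun this p

theorem T1 {k : ℕ} {X : ℝ → ℝ → (Fin (k + 1) → ℝ) → Prop}
    (hX : D fun q : Bool ⊕ Fin (k + 1) → ℝ => X (q (.inl false)) (q (.inl true)) fun i => q (.inr i)) :
    ∃ s : A0, s ≠ 0 ∧ ∀ a (J : Set ℝ), IsOpen J → J.OrdConnected → (∀ u ∈ J, ph a u s ≠ 0) →
    ∃ (τ : ℝ → ℝ → (Fin (k + 1) → ℝ) → (Fin (k + 1) → ℝ)) (ω : ℝ → ℝ → ℝ → ℝ), Tr J τ ∧
      (∀ u ∈ J, ∀ v ∈ J, ∀ z, X a u z → X a v (τ u v z)) ∧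
      (∀ u ∈ J, ∀ v ∈ J, ∀ z, τ u v z (Fin.last k) = ω u v (z (Fin.last k))) ∧
      ∀ u ∈ J, IsCompact {w | ∃ z, X a u z ∧ z (Fin.last k) = w} → ∀ u0 ∈ J, ∀ u1 ∈ J, u0 ≤ u1 →
        (∀ z, X a u z → ω u u0 (z (Fin.last k)) < ω u u1 (z (Fin.last k))) →
        ∀ z, X a u z → StrictMonoOn (fun v => ω u v (z (Fin.last k))) J := by
  have hW : D fun q : Bool ⊕ Unit → ℝ => ∃ z, X (q (.inl false)) (q (.inl true)) z ∧ z (Fin.last k) = q (.inr ()) :=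
    D.exs (κ := Fin (k + 1)) (p := fun (q : Bool ⊕ Unit → ℝ) z => X (q (.inl false)) (q (.inl true)) z ∧ z (Fin.last k) = q (.inr ()))
      ((hX.comap (Sum.elim (fun b => Sum.inl (Sum.inl b)) Sum.inr)).and (D.eq (DF.proj _) (DF.proj _)))
  obtain ⟨Q, hQ⟩ := rsa_iff.1 hX
  obtain ⟨R, hR⟩ := rsa_iff.1 hW
  obtain ⟨s, P0, h1, h2, h3, B, hB, h4⟩ := GG (R.image tw) k (Q.image (tk k))
  refine ⟨s, h1, fun a J hJ hJ' hs => ?_⟩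
  obtain ⟨⟨hg, hsp⟩, τ, hτ, hq, hl⟩ := h4 a J hJ hJ' hs
  refine ⟨τ, om a P0, hτ, fun u hu v hv z hz => ?_, hl, fun u hu hc u0 h0 u1 h1 h01 hlt z hz => ?_⟩
  · refine hQ (pt a u z) (pt a v (τ u v z)) (fun P hP => ?_) hz
    rw [← tk_eq, ← tk_eq]
    exact hq u hu v hv z _ (Finset.mem_image_of_mem _ hP)
  · refine om_strict hJ hJ' hg hB hsp h3 hu hc (fun w hw t ht => ?_) h0 h1 h01 ?_ _ ⟨z, hz, rfl⟩
    · refine hR (pt a u fun _ => w) (pt a u fun _ => t) (fun P hP => ?_) hw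
      rw [← tw_eq, ← tw_eq]
      by_cases hz : tw P = 0
      · simp [hz]
      · exact ht _ (h2 _ (Finset.mem_image_of_mem _ hP) hz)
    · rintro w ⟨z, hz, rfl⟩
      exact hlt z hz

end


section

open Polynomial

theorem poly_nv {q : ℝ[X]} (h : q ≠ 0) : ∃ ε > 0, ∀ u ∈ Set.Ioc (0 : ℝ) ε, q.eval u ≠ 0 := by
  have h1 := ((q.roots.toFinset.erase 0).finite_toSet).isClosed.isOpen_compl
  obtain ⟨ε, hε, h2⟩ := Metric.isOpen_iff.1 h1 0 (by simp)
  refine ⟨ε / 2, by positivity, fun u hu hq => ?_⟩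
  have := h2 (show u ∈ Metric.ball 0 ε by rw [Metric.mem_ball, dist_zero_right, Real.norm_of_nonneg hu.1.le]; linarith [hu.2])
  exact this (by simp [h, hu.1.ne']; exact hq)

theorem NV1 {s : A0} (hs : s ≠ 0) : ∃ a : ℝ, ∃ ε > 0, ∀ u ∈ Set.Ioo (0 : ℝ) ε, ph a u s ≠ 0 := by
  have key : ∀ s : ℝ[X][X], s ≠ 0 → ∃ a : ℝ, s.eval (C a) ≠ 0 := by
    intro s hs
    by_contra! hc
    refine hs (eq_zero_of_infinite_isRoot _ ((Set.infinite_range_of_injective (C_injective (R := ℝ))).mono ?_))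
    rintro _ ⟨a, rfl⟩
    exact hc a
  obtain ⟨a, ha⟩ := key s hs
  obtain ⟨ε, hε, h⟩ := poly_nv ha
  refine ⟨a, ε, hε, fun u hu => ?_⟩
  convert h u ⟨hu.1, hu.2.le⟩ using 1
  have := eval₂_at_apply (R := ℝ[X]) (p := s) (evalRingHom u) (C a)
  rw [coe_evalRingHom, eval_C] at this
  exact this

theorem NV2 {s : A0} (hs : s ≠ 0) : ∃ u1 > (0 : ℝ), ∀ u0 > (0 : ℝ), ∃ a0 > (0 : ℝ), ∀ a ∈ Set.Ioc 0 a0,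
    ∀ u ∈ Set.Icc u0 u1, ph a u s ≠ 0 := by
  obtain ⟨q, h1, h2⟩ := exists_eq_pow_rootMultiplicity_mul_and_not_dvd (R := ℝ[X]) s hs 0
  rw [C_0, sub_zero] at h1 h2
  rw [X_dvd_iff] at h2
  obtain ⟨u1, hu1, h3⟩ := poly_nv h2
  refine ⟨u1, hu1, fun u0 hu0 => ?_⟩
  have hc : Continuous fun p : ℝ × ℝ => eval₂ (evalRingHom p.2) p.1 q := by
    simp only [eval₂_eq_sum_range, coe_evalRingHom]
    exact continuous_finsetSum _ fun i _ => ((q.coeff i).continuous.comp continuous_snd).mul (by fun_prop)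
  have hk := (isCompact_Icc (a := u0) (b := u1)).eventually_forall_of_forall_eventually (x₀ := (0 : ℝ))
    (P := fun a u => eval₂ (evalRingHom u) a q ≠ 0) fun u hu => by
      refine hc.continuousAt.eventually_ne ?_
      have := h3 u ⟨hu0.trans_le hu.1, hu.2⟩
      simpa [eval₂_at_zero] using this
  obtain ⟨ε, hε, h4⟩ := Metric.eventually_nhds_iff.1 hk
  refine ⟨ε / 2, by positivity, fun a ha u hu => ?_⟩
  have h5 := h4 (y := a) (by rw [dist_zero_right, Real.norm_of_nonneg ha.1.le]; linarith [ha.2]) u hu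
  change eval₂ (evalRingHom u) a s ≠ 0
  rw [h1, eval₂_mul, eval₂_pow, eval₂_X]
  exact mul_ne_zero (pow_ne_zero _ ha.1.ne') h5

end


section

def N {n : ℕ} (x : Fin n → ℝ) : ℝ := ∑ i, x i ^ 2
theorem N_nonneg {n : ℕ} (x : Fin n → ℝ) : 0 ≤ N x := Finset.sum_nonneg fun _ _ => sq_nonneg _
theorem N_cont {n : ℕ} : Continuous (N (n := n)) := continuous_finsetSum _ fun i _ => (continuous_apply i).pow 2
theorem N_zero {n : ℕ} : N (0 : Fin n → ℝ) = 0 := by simp [N]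
theorem N_df {n : ℕ} {ι : Type} {F : Fin n → (ι → ℝ) → ℝ} (h : ∀ i, DF (F i)) : DF fun x => N fun i => F i x :=
  DF.sum _ fun i => (h i).pow 2
theorem N_eq0 {n : ℕ} {x : Fin n → ℝ} (h : N x = 0) : x = 0 := by
  ext i
  have := (Finset.sum_eq_zero_iff_of_nonneg (fun i _ => sq_nonneg (x i))).1 h i (Finset.mem_univ i)
  simpa using this
theorem N_small {n : ℕ} {η : ℝ} (h : 0 < η) : ∀ᶠ x : Fin n → ℝ in 𝓝 0, N x < η :=
  N_cont.continuousAt.eventually_lt continuousAt_const (by rw [N_zero]; exact h)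
theorem N_tend {n : ℕ} {α : Type*} {l : Filter α} {γ : α → Fin n → ℝ} (h : ∀ η > 0, ∀ᶠ t in l, N (γ t) < η) :
    Tendsto γ l (𝓝 0) := by
  rw [tendsto_pi_nhds]
  intro i
  rw [Metric.tendsto_nhds]
  intro ε hε
  filter_upwards [h (ε ^ 2) (by positivity)] with t ht
  have : γ t i ^ 2 ≤ N (γ t) := Finset.single_le_sum (f := fun i => γ t i ^ 2) (fun i _ => sq_nonneg _) (Finset.mem_univ i)
  simpa using abs_lt_of_sq_lt_sq (this.trans_lt ht) hε.le

theorem D.alls {ι κ : Type} [Finite κ] {p : (ι → ℝ) → (κ → ℝ) → Prop}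
    (h : D (fun z : ι ⊕ κ → ℝ => p (fun i => z (.inl i)) (fun i => z (.inr i)))) : D fun x => ∀ y, p x y :=
  (D.exs (κ := κ) (p := fun x y => ¬ p x y) h.not).not.congr fun x => by simp

theorem DF.polyc {n : ℕ} {ι : Type} (P : MvPolynomial (Fin n) ℝ) {F : Fin n → (ι → ℝ) → ℝ} (h : ∀ i, DF (F i)) :
    DF fun x => MvPolynomial.eval (fun i => F i x) P := DF.comp (DF.poly P) h

theorem CSL {n : ℕ} (P : MvPolynomial (Fin n) ℝ) {f : (Fin n → ℝ) → ℝ} (hf : f = fun x => MvPolynomial.eval x P)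
    (h0 : f 0 = 0) {S : (Fin n → ℝ) → Prop}
    (hS : D S) (hpos : ∀ x, S x → 0 < f x) (hacc : ∃ᶠ x in 𝓝 0, S x) :
    ∃ γ ∈ ArcFib f, ∀ᶠ t in 𝓝[>] (0 : ℝ), S (γ t) := by
  have hfc : Continuous f := by rw [hf]; exact MvPolynomial.continuous_eval P
  have dfc : ∀ {ι : Type} {F : Fin n → (ι → ℝ) → ℝ}, (∀ i, DF (F i)) → DF fun x => f fun i => F i x := by
    intro ι F h; rw [hf]; exact DF.polyc P h
  have T : ∀ η > 0, ∀ᶠ t in 𝓝[>] (0 : ℝ), ∃ x, S x ∧ N x < η ∧ f x = t := by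
    intro η hη
    refine (D.germ (p := fun t => ∃ x, S x ∧ N x < η ∧ f x = t) ?_).resolve_right fun hc => ?_
    · exact D.exs (κ := Fin n) (p := fun z x => S x ∧ N x < η ∧ f x = z ()) ((hS.comap Sum.inr).and
        ((D.lt (N_df fun i => DF.proj _) (DF.const η)).and (D.eq (dfc fun i => DF.proj _) (DF.proj _))))
    · obtain ⟨ε, hε, h1⟩ := mem_nhdsGT_iff_exists_Ioo_subset.1 hc
      obtain ⟨x, hx, h2, h3⟩ := (hacc.and_eventually ((N_small hη).and
        (hfc.continuousAt.eventually_lt continuousAt_const (show f 0 < ε by rw [h0]; exact hε)))).exists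
      exact h1 ⟨hpos x hx, h3⟩ ⟨x, hx, h2, rfl⟩
  let X : ℝ → ℝ → (Fin (n + 1) → ℝ) → Prop := fun _ u z => S (fun i => z i.castSucc) ∧ f (fun i => z i.castSucc) = u ∧
    ∀ x, S x → f x = u → N (fun i => z i.castSucc) ≤ N x + u
  obtain ⟨s, hs, hT⟩ := T1 (X := X) ((hS.comap _).and ((D.eq (dfc fun i => DF.proj _) (DF.proj _)).and
    (D.alls (κ := Fin n) (p := fun (q : Bool ⊕ Fin (n + 1) → ℝ) x => S x → f x = q (.inl true) →
      N (fun i => q (.inr (Fin.castSucc i))) ≤ N x + q (.inl true)) ((hS.comap Sum.inr).imp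
        ((D.eq (dfc fun i => DF.proj _) (DF.proj _)).imp (D.le (N_df fun i => DF.proj _)
          ((N_df fun i => DF.proj _).add (DF.proj _))))))))
  obtain ⟨a, ε, hε, hne⟩ := NV1 hs
  obtain ⟨τ, -, hτ, hX, -, -⟩ := hT a _ isOpen_Ioo Set.ordConnected_Ioo hne
  obtain ⟨u, ⟨x1, hx1, -, hx1'⟩, hu⟩ := ((T 1 one_pos).and (Ioo_mem_nhdsGT hε)).exists
  obtain ⟨x, hx, hxm⟩ : ∃ x, (S x ∧ f x = u) ∧ ∀ x', S x' → f x' = u → N x ≤ N x' + u := by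
    let Y := N '' {x | S x ∧ f x = u}
    have hb : BddBelow Y := ⟨0, by rintro _ ⟨x, -, rfl⟩; exact N_nonneg x⟩
    obtain ⟨_, ⟨x, hx, rfl⟩, hlt⟩ := exists_lt_of_csInf_lt (s := Y) ⟨_, x1, ⟨hx1, hx1'⟩, rfl⟩ (lt_add_of_pos_right (sInf Y) hu.1)
    exact ⟨x, hx, fun x' h1 h2 => hlt.le.trans (add_le_add_left (csInf_le hb ⟨x', ⟨h1, h2⟩, rfl⟩) u)⟩
  let z : Fin (n + 1) → ℝ := Fin.lastCases 0 x
  have hz : (fun i : Fin n => z i.castSucc) = x := by ext i; simp [z]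
  have hXz : X a u z := by
    show S (fun i => z i.castSucc) ∧ f (fun i => z i.castSucc) = u ∧ _
    rw [hz]; exact ⟨hx.1, hx.2, hxm⟩
  have hXX := fun v hv => hX u hu v hv z hXz
  have hJ : ∀ᶠ t in 𝓝[>] (0 : ℝ), t ∈ Set.Ioo 0 ε := Ioo_mem_nhdsGT hε
  refine ⟨fun v i => τ u v z i.castSucc, ⟨⟨ε, hε, fun v hv => ContinuousAt.continuousWithinAt ?_, ?_⟩, ?_, ?_⟩, ?_⟩
  · refine continuousAt_pi.2 fun i => (continuous_apply i.castSucc).continuousAt.comp ?_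
    exact ContinuousAt.comp (g := fun p : ℝ × ℝ × (Fin (n + 1) → ℝ) => τ p.1 p.2.1 p.2.2) (f := fun v => (u, v, z)) (x := v)
      (hτ.cont u hu v hv z) (by fun_prop)
  · refine D.congr (((D.lt (DF.const 0) (DF.proj none)).and (D.lt (DF.proj none) (DF.const ε))).and
      (D.alli fun i : Fin n => D.eq (DF.proj (some i)) (hτ.df (DF.const u) (DF.proj none) (fun j => DF.const (z j)) i.castSucc)))
      fun z => ?_
    show (_ ∧ _) ↔ _
    rw [funext_iff]; rfl
  · refine N_tend fun η hη => ?_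
    filter_upwards [T (η / 2) (half_pos hη), hJ, Ioo_mem_nhdsGT (half_pos hη)] with t ⟨x', a1, a2, a3⟩ h1 h2
    have := (hXX t h1).2.2 x' a1 a3
    linarith [h2.2]
  · filter_upwards [hJ] with t ht using (hXX t ht).2.1
  · filter_upwards [hJ] with t ht using (hXX t ht).1

end


section

theorem ABS {E : Type} [TopologicalSpace E] {M : Set E} {ν μ : E → ℝ} {T : E → ℝ → E} {J : Set ℝ} {u0 s u1 : ℝ}
    (hν : ContinuousOn ν M) (hμ : ContinuousOn μ M) (hJ : J.OrdConnected) (h0 : u0 ∈ J) (h1 : u1 ∈ J) (h0s : u0 < s) (hs1 : s < u1)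
    (tM : ∀ x ∈ M, ν x ∈ J → ∀ v ∈ J, T x v ∈ M) (tν : ∀ x ∈ M, ν x ∈ J → ∀ v ∈ J, ν (T x v) = v)
    (ti : ∀ x ∈ M, ν x ∈ J → T x (ν x) = x)
    (tc : ∀ x ∈ M, ν x ∈ J → ∀ v ∈ J, ∀ v' ∈ J, T (T x v) v' = T x v')
    (tm : ∀ x ∈ M, ν x ∈ J → StrictMonoOn (fun v => μ (T x v)) J)
    (m0 : ∀ x ∈ M, ν x ≤ u0 → μ x < s) (m1 : ∀ x ∈ M, u1 ≤ ν x → s < μ x)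
    (tC : ContinuousOn (fun p : E × ℝ => T p.1 p.2) ({x | x ∈ M ∧ ν x ∈ J} ×ˢ J)) {ψ : E → E}
    (hψ : ψ = fun x => if ν x ≤ u0 then x else T x (u0 + (s - u0) * (μ x - μ (T x u0)) / (s - μ (T x u0)))) :
    ContinuousOn ψ {x | x ∈ M ∧ μ x ≤ s} ∧ Set.InjOn ψ {x | x ∈ M ∧ μ x ≤ s} ∧
      ψ '' {x | x ∈ M ∧ μ x ≤ s} = {x | x ∈ M ∧ ν x ≤ s} := by
  have hsJ : s ∈ J := hJ.out h0 h1 ⟨h0s.le, hs1.le⟩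
  have hin : ∀ x ∈ M, μ x ≤ s → u0 ≤ ν x → ν x ∈ J := fun x hx h2 h3 =>
    hJ.out h0 h1 ⟨h3, le_of_not_ge fun h => absurd (m1 x hx h) (not_lt.2 h2)⟩
  have hb : ∀ x ∈ M, ν x ∈ J → 0 < s - μ (T x u0) := fun x hx hj =>
    sub_pos.2 (m0 _ (tM x hx hj u0 h0) (tν x hx hj u0 h0).le)
  have hlt : ∀ x ∈ M, ν x ∈ J → u0 < ν x → μ (T x u0) < μ x := by
    intro x hx hj hl
    have := tm x hx hj h0 hj hl
    simpa only [ti x hx hj] using this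
  set U : E → ℝ := fun x => u0 + (s - u0) * (μ x - μ (T x u0)) / (s - μ (T x u0)) with hU
  have hUr : ∀ x ∈ M, μ x ≤ s → ν x ∈ J → u0 < ν x → u0 < U x ∧ U x ≤ s := by
    intro x hx h2 hj hl
    have b := hb x hx hj
    constructor
    · have : 0 < (s - u0) * (μ x - μ (T x u0)) / (s - μ (T x u0)) :=
        div_pos (mul_pos (sub_pos.2 h0s) (sub_pos.2 (hlt x hx hj hl))) b
      simp only [hU]; linarith
    · have : (s - u0) * (μ x - μ (T x u0)) / (s - μ (T x u0)) ≤ s - u0 := by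
        rw [div_le_iff₀ b]; exact mul_le_mul_of_nonneg_left (by linarith) (by linarith)
      simp only [hU]; linarith
  have hUJ : ∀ x ∈ M, μ x ≤ s → ν x ∈ J → u0 < ν x → U x ∈ J := fun x hx h2 hj hl =>
    hJ.out h0 hsJ ⟨(hUr x hx h2 hj hl).1.le, (hUr x hx h2 hj hl).2⟩
  have e0 : ∀ x, ν x ≤ u0 → ψ x = x := fun x h => by rw [hψ]; exact if_pos h
  have e1 : ∀ x, u0 < ν x → ψ x = T x (U x) := fun x h => by rw [hψ]; exact if_neg (not_le.2 h)
  have e2 : ∀ x ∈ M, ν x = u0 → U x = u0 := by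
    intro x hx h
    have := ti x hx (h ▸ h0)
    rw [h] at this
    simp [hU, this]
  refine ⟨?_, ?_, ?_⟩
  · have hM1 : {x | x ∈ M ∧ μ x ≤ s} ⊆ M := fun x hx => hx.1
    rw [continuousOn_iff_continuous_domRestrict]
    have : Set.domRestrict {x | x ∈ M ∧ μ x ≤ s} ψ = fun x : {x | x ∈ M ∧ μ x ≤ s} => if ν x ≤ u0 then (x : E) else T x (U x) := by
      ext x; simp only [Set.domRestrict_apply, hψ]; rfl
    rw [this]
    refine continuous_if_le (continuousOn_iff_continuous_domRestrict.1 (hν.mono hM1)) continuous_const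
      continuous_subtype_val.continuousOn ?_ ?_
    · have q : ContinuousOn (fun x => T x u0) {x | (x ∈ M ∧ μ x ≤ s) ∧ u0 ≤ ν x} :=
        tC.comp (f := fun x => (x, u0)) (by fun_prop) fun x hx => ⟨⟨hx.1.1, hin x hx.1.1 hx.1.2 hx.2⟩, h0⟩
      have q' : ContinuousOn (fun x => μ (T x u0)) {x | (x ∈ M ∧ μ x ≤ s) ∧ u0 ≤ ν x} :=
        hμ.comp q fun x hx => tM x hx.1.1 (hin x hx.1.1 hx.1.2 hx.2) u0 h0
      have hμ' : ContinuousOn μ {x | (x ∈ M ∧ μ x ≤ s) ∧ u0 ≤ ν x} := hμ.mono fun x hx => hx.1.1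
      have qU : ContinuousOn U {x | (x ∈ M ∧ μ x ≤ s) ∧ u0 ≤ ν x} :=
        continuousOn_const.add ((continuousOn_const.mul (hμ'.sub q')).div (continuousOn_const.sub q')
          fun x hx => (hb x hx.1.1 (hin x hx.1.1 hx.1.2 hx.2)).ne')
      have qT : ContinuousOn (fun x => T x (U x)) {x | (x ∈ M ∧ μ x ≤ s) ∧ u0 ≤ ν x} := by
        refine tC.comp (f := fun x => (x, U x)) (continuousOn_id.prodMk qU) fun x hx => ?_
        have hj := hin x hx.1.1 hx.1.2 hx.2
        refine ⟨⟨hx.1.1, hj⟩, ?_⟩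
        rcases hx.2.eq_or_lt with h | h
        · show U x ∈ J
          rw [e2 x hx.1.1 h.symm]; exact h0
        · exact hUJ x hx.1.1 hx.1.2 hj h
      exact qT.comp (f := Subtype.val) continuous_subtype_val.continuousOn fun x hx => ⟨x.2, hx⟩
    · intro x h
      rw [e2 x x.2.1 h]
      have := ti x x.2.1 (h ▸ h0)
      rw [h] at this
      exact this.symm
  · have half : ∀ x x', x ∈ M → μ x ≤ s → x' ∈ M → μ x' ≤ s → ν x ≤ u0 → u0 < ν x' → ψ x ≠ ψ x' := by
      intro x x' hx hxs hx' hxs' l l' he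
      have hj := hin x' hx' hxs' l'.le
      rw [e0 x l, e1 x' l'] at he
      rw [he, tν x' hx' hj _ (hUJ x' hx' hxs' hj l')] at l
      exact absurd l (not_le.2 (hUr x' hx' hxs' hj l').1)
    rintro x ⟨hx, hxs⟩ x' ⟨hx', hxs'⟩ he
    rcases le_or_gt (ν x) u0 with l | l <;> rcases le_or_gt (ν x') u0 with l' | l'
    · rwa [e0 x l, e0 x' l'] at he
    · exact absurd he (half x x' hx hxs hx' hxs' l l')
    · exact absurd he.symm (half x' x hx' hxs' hx hxs l' l)
    · have hj := hin x hx hxs l.le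
      have hj' := hin x' hx' hxs' l'.le
      rw [e1 x l, e1 x' l'] at he
      have hUU : U x = U x' := by
        rw [← tν x hx hj _ (hUJ x hx hxs hj l), he, tν x' hx' hj' _ (hUJ x' hx' hxs' hj' l')]
      have hbb : T x u0 = T x' u0 := by
        rw [← tc x hx hj _ (hUJ x hx hxs hj l) u0 h0, he, tc x' hx' hj' _ (hUJ x' hx' hxs' hj' l') u0 h0]
      have b := hb x hx hj
      have hμμ : μ x = μ x' := by
        simp only [hU, ← hbb] at hUU
        have h3 := add_left_cancel hUU
        rw [div_left_inj' b.ne'] at h3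
        linarith [mul_left_cancel₀ (sub_pos.2 h0s).ne' h3]
      have r : T (T x u0) (ν x) = x := by rw [tc x hx hj _ h0 _ hj, ti x hx hj]
      have r' : T (T x u0) (ν x') = x' := by rw [hbb, tc x' hx' hj' _ h0 _ hj', ti x' hx' hj']
      have hνν : ν x = ν x' := (tm (T x u0) (tM x hx hj _ h0) (by rw [tν x hx hj _ h0]; exact h0)).injOn hj hj'
        (by show μ (T (T x u0) (ν x)) = μ (T (T x u0) (ν x')); rw [r, r', hμμ])
      rw [← r, ← r', hνν]
  · ext p
    constructor
    · rintro ⟨x, ⟨hx, hxs⟩, rfl⟩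
      rcases le_or_gt (ν x) u0 with l | l
      · rw [e0 x l]; exact ⟨hx, l.trans h0s.le⟩
      · have hj := hin x hx hxs l.le
        rw [e1 x l]
        refine ⟨tM x hx hj _ (hUJ x hx hxs hj l), ?_⟩
        rw [tν x hx hj _ (hUJ x hx hxs hj l)]; exact (hUr x hx hxs hj l).2
    · rintro ⟨hp, hps⟩
      rcases le_or_gt (ν p) u0 with l | l
      · exact ⟨p, ⟨hp, (m0 p hp l).le⟩, e0 p l⟩
      · have hj : ν p ∈ J := hJ.out h0 hsJ ⟨l.le, hps⟩
        have hbM := tM p hp hj u0 h0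
        have hbν := tν p hp hj u0 h0
        have b := hb p hp hj
        have hbc := tc p hp hj u0 h0
        set b0 := T p u0
        have hbJ : ν b0 ∈ J := by rw [hbν]; exact h0
        have hI : Set.Icc u0 u1 ⊆ J := hJ.out h0 h1
        have hc : ContinuousOn (fun t => μ (T b0 t)) (Set.Icc u0 u1) :=
          hμ.comp (tC.comp (f := fun t => (b0, t)) (by fun_prop) fun t ht => ⟨⟨hbM, hbJ⟩, hI ht⟩)
            fun t ht => tM b0 hbM hbJ t (hI ht)
        set w := μ b0 + (ν p - u0) * (s - μ b0) / (s - u0) with hw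
        have hss : 0 < s - u0 := sub_pos.2 h0s
        have w1 : μ b0 < w := by
          have : 0 < (ν p - u0) * (s - μ b0) / (s - u0) := div_pos (mul_pos (sub_pos.2 l) b) hss
          linarith
        have w2 : w ≤ s := by
          have : (ν p - u0) * (s - μ b0) / (s - u0) ≤ s - μ b0 := by
            rw [div_le_iff₀ hss, mul_comm]; exact mul_le_mul_of_nonneg_left (by linarith) b.le
          linarith
        have f0 : T b0 u0 = b0 := hbc u0 h0
        obtain ⟨t, ht, htw⟩ := intermediate_value_Icc (h0s.trans hs1).le hc (show w ∈ _ from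
          ⟨by simp only [f0]; exact w1.le, w2.trans (m1 _ (tM b0 hbM hbJ u1 h1) (tν b0 hbM hbJ u1 h1).ge).le⟩)
        simp only at htw
        have htJ := hI ht
        have htu : u0 < t := lt_of_le_of_ne ht.1 fun h => by rw [← h, f0] at htw; exact w1.ne htw
        have hxν := tν b0 hbM hbJ t htJ
        refine ⟨T b0 t, ⟨tM b0 hbM hbJ t htJ, htw.trans_le w2⟩, ?_⟩
        rw [e1 _ (by rw [hxν]; exact htu)]
        have hUv : U (T b0 t) = ν p := by
          simp only [hU, tc b0 hbM hbJ t htJ u0 h0, f0, htw]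
          rw [hw, add_sub_cancel_left, mul_div_cancel₀ _ hss.ne', mul_div_assoc, div_self b.ne']
          ring
        rw [hUv, tc b0 hbM hbJ t htJ _ hj, hbc _ hj, ti p hp hj]

theorem homeo_cpt {n : ℕ} {A K : Set (Fin n → ℝ)} (hK : IsCompact K) (dK : D fun x => x ∈ K)
    {Φ : (Fin n → ℝ) → (Fin n → ℝ)} (hc : ContinuousOn Φ K) (hi : Set.InjOn Φ K) (him : Φ '' K = A)
    (hd : ∀ i, DF fun x => Φ x i) : IsSemialgHomeo A K := by
  have hex : ∀ x ∈ A, ∃ y ∈ K, Φ y = x := fun x hx => by rw [← him] at hx; exact hx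
  let ψ : (Fin n → ℝ) → (Fin n → ℝ) := fun x => if hx : x ∈ A then (hex x hx).choose else 0
  have p1 : ∀ x ∈ A, ψ x ∈ K ∧ Φ (ψ x) = x := fun x hx => by
    simp only [ψ, dif_pos hx]; exact (hex x hx).choose_spec
  have hm : Set.MapsTo Φ K A := fun y hy => him ▸ Set.mem_image_of_mem _ hy
  have p2 : ∀ y ∈ K, ψ (Φ y) = y := fun y hy => hi (p1 _ (hm hy)).1 hy (p1 _ (hm hy)).2
  have hg : IsRSA (Fin n ⊕ Fin n) (graphMapOn Φ K) := by
    refine D.congr ((dK.comap Sum.inl).and (D.alli fun i => D.eq (DF.proj (Sum.inr i)) ((hd i).comap Sum.inl))) fun z => ?_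
    show (_ ∧ _) ↔ _
    rw [funext_iff]
  refine ⟨ψ, Φ, fun x hx => (p1 x hx).1, hm, fun x hx => (p1 x hx).2, p2, ?_, hc, ?_, hg⟩
  · have := isCompact_iff_compactSpace.1 hK
    have he := ((continuousOn_iff_continuous_domRestrict.1 hc).isClosedEmbedding (Set.injOn_iff_injective.1 hi)).isEmbedding
    rw [continuousOn_iff_continuous_domRestrict]
    have : Continuous fun x : A => (⟨ψ x, (p1 x x.2).1⟩ : K) := by
      rw [he.continuous_iff]
      convert continuous_subtype_val (p := fun x => x ∈ A) using 1
      ext1 x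
      exact (p1 x x.2).2
    exact continuous_subtype_val.comp this
  · refine D.congr (D.comap (p := fun z : Fin n ⊕ Fin n → ℝ => z ∈ graphMapOn Φ K) hg Sum.swap) fun z => ?_
    show (_ ∧ _) ↔ (_ ∧ _)
    constructor
    · rintro ⟨h1, h2⟩
      refine ⟨?_, ?_⟩
      · show (fun j => z (Sum.inr j)) ∈ K
        rw [h2]; exact (p1 _ h1).1
      · show (fun j => z (Sum.inl j)) = Φ (fun j => z (Sum.inr j))
        rw [h2]; exact (p1 _ h1).2.symm
    · rintro ⟨h1, h2⟩
      change (fun j => z (Sum.inr j)) ∈ K at h1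
      change (fun j => z (Sum.inl j)) = Φ (fun j => z (Sum.inr j)) at h2
      rw [h2]
      exact ⟨hm h1, (p2 _ h1).symm⟩

theorem ext_df {n : ℕ} {U : Set (Fin n → ℝ)} {h : (Fin n → ℝ) → (Fin n → ℝ)} (hU : IsRSA (Fin n) U)
    (hh : IsRSA (Fin n ⊕ Fin n) (graphMapOn h U)) (i : Fin n) : DF fun x => (if x ∈ U then h x else 0) i := by
  refine DF.of_graph (p := fun x t => (x ∉ U ∧ t = 0) ∨ ∃ y, (x ∈ U ∧ y = h x) ∧ t = y i) ?_ fun x t => ?_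
  · refine ((D.comap (D.not hU) some).and (D.eq (DF.proj none) (DF.const 0))).or ?_
    refine D.exs (κ := Fin n) (p := fun (z : Option (Fin n) → ℝ) y => ((fun i => z (some i)) ∈ U ∧ y = h fun i => z (some i)) ∧ z none = y i) ?_
    exact (D.comap hh (Sum.elim (fun i => Sum.inl (some i)) Sum.inr)).and (D.eq (DF.proj _) (DF.proj _))
  · by_cases hx : x ∈ U <;> simp [hx]

end


section

theorem N_ball {n : ℕ} {p : (Fin n → ℝ) → Prop} (h : ∀ᶠ x in 𝓝 0, p x) : ∃ d > 0, ∀ x, N x ≤ d → p x := by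
  have h1 : Tendsto id (comap (N (n := n)) (𝓝 0)) (𝓝 0) := N_tend fun η hη =>
    (tendsto_comap (f := N (n := n)) (x := 𝓝 (0 : ℝ))).eventually_lt_const hη
  obtain ⟨t, ht, h2⟩ := mem_comap.1 (h1.eventually h)
  obtain ⟨ε, hε, h3⟩ := Metric.mem_nhds_iff.1 ht
  refine ⟨ε / 2, by positivity, fun x hx => h2 (h3 ?_)⟩
  rw [Metric.mem_ball, dist_zero_right, Real.norm_of_nonneg (N_nonneg x)]; linarith

theorem N_cpt {n : ℕ} {S : Set (Fin n → ℝ)} (hS : IsClosed S) {d : ℝ} (hd : ∀ x ∈ S, N x ≤ d) : IsCompact S := by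
  refine (isCompact_univ_pi fun _ : Fin n => isCompact_Icc (a := -(|d| + 1)) (b := |d| + 1)).of_isClosed_subset hS
    fun x hx i _ => ?_
  have h1 : x i ^ 2 ≤ N x := Finset.single_le_sum (f := fun i => x i ^ 2) (fun i _ => sq_nonneg _) (Finset.mem_univ i)
  have h2 := hd x hx
  have h3 := le_abs_self d
  have h4 := abs_nonneg d
  exact abs_le.1 (abs_le_of_sq_le_sq (by nlinarith) (by linarith))

theorem partI {n : ℕ} (P Q : MvPolynomial (Fin n) ℝ) (f g : (Fin n → ℝ) → ℝ)
    (hf : f = fun x => MvPolynomial.eval x P) (hg : g = fun x => MvPolynomial.eval x Q)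
    (hf0 : f 0 = 0) (hg0 : g 0 = 0)
    (U V : Set (Fin n → ℝ)) (hU : U ∈ nhds (0 : Fin n → ℝ)) (hV : V ∈ nhds (0 : Fin n → ℝ))
    (hUsa : IsRSA (Fin n) U) (hVsa : IsRSA (Fin n) V)
    (h h' : (Fin n → ℝ) → (Fin n → ℝ))
    (hmaps : Set.MapsTo h U V)
    (hinv : ∀ x ∈ U, h' (h x) = x)
    (hhC : ContinuousOn h U)
    (hhSA : IsRSA (Fin n ⊕ Fin n) (graphMapOn h U))
    (hh'SA : IsRSA (Fin n ⊕ Fin n) (graphMapOn h' V))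
    (h0 : h 0 = 0)
    (harc : (fun γ : ℝ → (Fin n → ℝ) => h ∘ γ) '' ArcFib f = ArcFib g) :
    ∀ᶠ x in 𝓝 0, x ∈ U ∧ ∀ a > 0, f x = a ↔ g (h x) = a := by
  have A : ∀ᶠ x in 𝓝 0, ¬ (x ∈ U ∧ 0 < f x ∧ g (if x ∈ U then h x else 0) ≠ f x) := by
    by_contra hc
    obtain ⟨γ, hγ, hS⟩ := CSL P hf hf0 (S := fun x => x ∈ U ∧ 0 < f x ∧ g (if x ∈ U then h x else 0) ≠ f x)
      (D.and hUsa ((D.lt (DF.const 0) (hf ▸ DF.poly P)).and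
        (D.eq (hg ▸ DF.polyc Q fun i => ext_df hUsa hhSA i) (hf ▸ DF.poly P)).not)) (fun x hx => hx.2.1) hc
    have hγ' : h ∘ γ ∈ ArcFib g := harc ▸ ⟨γ, hγ, rfl⟩
    obtain ⟨t, ⟨a1, a2, a3⟩, b1, b2⟩ := (hS.and (hγ.2.2.and hγ'.2.2)).exists
    rw [if_pos a1, b1] at a3
    exact a3 b2
  have B : ∀ᶠ y in 𝓝 0, ¬ (y ∈ V ∧ 0 < g y ∧ f (if y ∈ V then h' y else 0) ≠ g y) := by
    by_contra hc
    obtain ⟨γ, hγ, hS⟩ := CSL Q hg hg0 (S := fun y => y ∈ V ∧ 0 < g y ∧ f (if y ∈ V then h' y else 0) ≠ g y)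
      (D.and hVsa ((D.lt (DF.const 0) (hg ▸ DF.poly Q)).and
        (D.eq (hf ▸ DF.polyc P fun i => ext_df hVsa hh'SA i) (hg ▸ DF.poly Q)).not)) (fun x hx => hx.2.1) hc
    have hγ' := hγ
    rw [← harc] at hγ'
    obtain ⟨γ', c1, rfl⟩ := hγ'
    obtain ⟨t, ⟨a1, a2, a3⟩, b1, b2, b3⟩ := (hS.and (hγ.2.2.and (c1.2.2.and (c1.2.1.eventually hU)))).exists
    rw [if_pos a1, b1] at a3
    refine a3 ?_
    show f (h' (h (γ' t))) = t
    rw [hinv _ b3, b2]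
  have hc0 : Tendsto h (𝓝 0) (𝓝 0) := by
    have := (hhC.continuousAt hU).tendsto; rwa [h0] at this
  filter_upwards [A, hU, hc0.eventually B] with x a1 hx b1
  rw [if_pos hx] at a1
  rw [if_pos (hmaps hx), hinv x hx] at b1
  refine ⟨hx, fun a ha => ⟨fun e => ?_, fun e => ?_⟩⟩
  · by_contra hne; exact a1 ⟨hx, e ▸ ha, e ▸ hne⟩
  · by_contra hne; exact b1 ⟨hmaps hx, e ▸ ha, e ▸ hne⟩

end


theorem en_le {n : ℕ} {x : Fin n → ℝ} {r : ℝ} (hr : 0 < r) : enorm x ≤ r ↔ N x ≤ r ^ 2 :=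
  Real.sqrt_le_left hr.le

/-- Theorem `main`.(1). Let `f, g` be polynomial functions vanishing
at `0` and `h` a semialgebraic homeomorphism between semialgebraic neighbourhoods `U, V`
of `0` with `h(0) = 0`. If `h̃(𝒻_f) = 𝒻_g`, then `F_f(r,a)` and `F_g(r,a)` are
semialgebraically homeomorphic for `0 < a ≪ r ≪ 1`. -/
theorem statement16 {n : ℕ} (P Q : MvPolynomial (Fin n) ℝ) (f g : (Fin n → ℝ) → ℝ)
    (hf : f = fun x => MvPolynomial.eval x P) (hg : g = fun x => MvPolynomial.eval x Q)
    (hf0 : f 0 = 0) (hg0 : g 0 = 0)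
    (U V : Set (Fin n → ℝ)) (hU : U ∈ nhds (0 : Fin n → ℝ)) (hV : V ∈ nhds (0 : Fin n → ℝ))
    (hUsa : IsRSA (Fin n) U) (hVsa : IsRSA (Fin n) V)
    (h h' : (Fin n → ℝ) → (Fin n → ℝ))
    (hmaps : Set.MapsTo h U V) (hmaps' : Set.MapsTo h' V U)
    (hinv : ∀ x ∈ U, h' (h x) = x) (hinv' : ∀ y ∈ V, h (h' y) = y)
    (hhC : ContinuousOn h U) (hh'C : ContinuousOn h' V)
    (hhSA : IsRSA (Fin n ⊕ Fin n) (graphMapOn h U))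
    (hh'SA : IsRSA (Fin n ⊕ Fin n) (graphMapOn h' V))
    (h0 : h 0 = 0)
    (harc : (fun γ : ℝ → (Fin n → ℝ) => h ∘ γ) '' ArcFib f = ArcFib g) :
    ∃ r₀ > (0 : ℝ), ∀ r ∈ Set.Ioc (0 : ℝ) r₀, ∃ a₀ > (0 : ℝ),
      ∀ a ∈ Set.Ioc (0 : ℝ) a₀, IsSemialgHomeo (Fib f r a) (Fib g r a) := by
  have hfc : Continuous f := by rw [hf]; exact MvPolynomial.continuous_eval P
  have hgc : Continuous g := by rw [hg]; exact MvPolynomial.continuous_eval Q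
  have dfc : ∀ {ι : Type} {F : Fin n → (ι → ℝ) → ℝ}, (∀ i, DF (F i)) → DF fun x => f fun i => F i x := by
    intro ι F h; rw [hf]; exact DF.polyc P h
  have dgc : ∀ {ι : Type} {F : Fin n → (ι → ℝ) → ℝ}, (∀ i, DF (F i)) → DF fun x => g fun i => F i x := by
    intro ι F h; rw [hg]; exact DF.polyc Q h
  obtain ⟨d, hd, hdd⟩ := N_ball (partI P Q f g hf hg hf0 hg0 U V hU hV hUsa hVsa h h' hmaps hinv hhC hhSA hh'SA h0 harc)
  have hh0 : h' 0 = 0 := by have := hinv 0 (mem_of_mem_nhds hU); rwa [h0] at this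
  obtain ⟨H, hH⟩ : ∃ H : (Fin n → ℝ) → (Fin n → ℝ), H = fun x => if x ∈ U then h x else 0 := ⟨_, rfl⟩
  obtain ⟨H', hH'⟩ : ∃ H : (Fin n → ℝ) → (Fin n → ℝ), H = fun x => if x ∈ V then h' x else 0 := ⟨_, rfl⟩
  have eH : ∀ x ∈ U, H x = h x := fun x hx => by rw [hH]; exact if_pos hx
  have eH' : ∀ x ∈ V, H' x = h' x := fun x hx => by rw [hH']; exact if_pos hx
  have dH : ∀ i, DF fun x => H x i := fun i => by rw [hH]; exact ext_df hUsa hhSA i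
  have dH' : ∀ i, DF fun x => H' x i := fun i => by rw [hH']; exact ext_df hVsa hh'SA i
  have cH : ContinuousOn H {x | N x ≤ d} :=
    (hhC.mono fun x hx => (hdd x hx).1).congr fun x hx => eH x (hdd x hx).1
  have cμ : ContinuousOn (fun x => N (H x)) {x | N x ≤ d} := N_cont.comp_continuousOn cH
  have dμ : DF fun x => N (H x) := N_df dH
  let mk : (Fin n → ℝ) → (Fin (n + 1) → ℝ) := fun x => Fin.snoc x (N (H x))
  let pr : (Fin (n + 1) → ℝ) → (Fin n → ℝ) := fun z i => z i.castSucc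
  have pm : ∀ x, pr (mk x) = x := fun x => by ext i; simp [pr, mk]
  have ml : ∀ x, mk x (Fin.last n) = N (H x) := fun x => by simp [mk]
  have mz : ∀ z, z (Fin.last n) = N (H (pr z)) ↔ z = mk (pr z) := by
    intro z
    constructor
    · intro e; ext i
      refine Fin.lastCases ?_ (fun i => ?_) i
      · rw [ml, e]
      · simp [mk, pr]
    · intro e; rw [← ml, ← e]
  have dmk : ∀ i, DF fun x => mk x i := by
    intro i
    refine Fin.lastCases ?_ (fun i => ?_) i
    · simp only [ml]; exact dμ
    · simp only [mk, Fin.snoc_castSucc]; exact DF.proj i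
  have cmk : ContinuousOn mk {x | N x ≤ d} := by
    refine continuousOn_pi.2 fun i => ?_
    refine Fin.lastCases ?_ (fun i => ?_) i
    · simp only [ml]; exact cμ
    · simp only [mk, Fin.snoc_castSucc]; exact (continuous_apply i).continuousOn
  have cpr : Continuous pr := continuous_pi fun i => continuous_apply _
  let X : ℝ → ℝ → (Fin (n + 1) → ℝ) → Prop := fun a u z =>
    N (pr z) ≤ d ∧ f (pr z) = a ∧ N (pr z) = u ∧ z (Fin.last n) = N (H (pr z))
  obtain ⟨σ, hσ, hT⟩ := T1 (X := X) ((D.le (N_df fun i => DF.proj _) (DF.const d)).and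
    ((D.eq (dfc fun i => DF.proj _) (DF.proj _)).and ((D.eq (N_df fun i => DF.proj _) (DF.proj _)).and
      (D.eq (DF.proj _) (dμ.comap fun i => Sum.inr i.castSucc)))))
  obtain ⟨w1, hw1, hnv⟩ := NV2 hσ
  obtain ⟨u1, hu1, u1d, u1w⟩ : ∃ u1 > 0, 2 * u1 ≤ d ∧ 2 * u1 ≤ w1 :=
    ⟨min d w1 / 2, by positivity, by linarith [min_le_left d w1], by linarith [min_le_right d w1]⟩
  obtain ⟨c, hc, hcc⟩ := N_ball (p := fun y => y ∈ V ∧ N (h' y) < u1) (by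
    have : Tendsto h' (𝓝 0) (𝓝 0) := by
      have := (hh'C.continuousAt hV).tendsto; rwa [hh0] at this
    filter_upwards [hV, this.eventually (N_small hu1)] with y h1 h2 using ⟨h1, h2⟩)
  have hmin : 0 < min c (u1 / 2) := by positivity
  refine ⟨√(min c (u1 / 2)), Real.sqrt_pos.2 hmin, fun r hr => ?_⟩
  obtain ⟨s, hs⟩ : ∃ s, s = r ^ 2 := ⟨_, rfl⟩
  have s0 : 0 < s := hs ▸ pow_pos hr.1 2
  have sm : s ≤ min c (u1 / 2) := hs ▸ (Real.le_sqrt' hr.1).1 hr.2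
  have sc : s ≤ c := sm.trans (min_le_left _ _)
  have su : s ≤ u1 / 2 := sm.trans (min_le_right _ _)
  obtain ⟨q0, hq0, hqq⟩ := N_ball (p := fun x => N (h x) < s) (by
    have : Tendsto h (𝓝 0) (𝓝 0) := by
      have := (hhC.continuousAt hU).tendsto; rwa [h0] at this
    exact this.eventually (N_small s0))
  obtain ⟨u0, hu0, u0q, u0s⟩ : ∃ u0 > 0, u0 ≤ q0 ∧ u0 < s :=
    ⟨min q0 (s / 2), by positivity, min_le_left _ _, by linarith [min_le_right q0 (s / 2)]⟩
  obtain ⟨a0, ha0, hna⟩ := hnv (u0 / 2) (by positivity)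
  refine ⟨a0, ha0, fun a ha => ?_⟩
  let J := Set.Ioo (u0 / 2) (2 * u1)
  have hJ : J.OrdConnected := Set.ordConnected_Ioo
  have j0 : u0 ∈ J := ⟨by linarith, by linarith⟩
  have j1 : u1 ∈ J := ⟨by linarith, by linarith⟩
  obtain ⟨τ, ω, hτ, hX, hω, hmono⟩ := hT a J isOpen_Ioo hJ fun u hu => hna a ha u ⟨hu.1.le, hu.2.le.trans u1w⟩
  let M : Set (Fin n → ℝ) := {x | N x ≤ d ∧ f x = a}
  let μ : (Fin n → ℝ) → ℝ := fun x => N (H x)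
  let T : (Fin n → ℝ) → ℝ → (Fin n → ℝ) := fun x v => pr (τ (N x) v (mk x))
  have xX : ∀ x ∈ M, X a (N x) (mk x) := by
    intro x hx
    refine ⟨?_, ?_, ?_, ?_⟩ <;> rw [pm]
    exacts [hx.1, hx.2, ml x]
  have xT : ∀ x ∈ M, N x ∈ J → ∀ v ∈ J, T x v ∈ M ∧ N (T x v) = v ∧ τ (N x) v (mk x) = mk (T x v) := by
    intro x hx hj v hv
    obtain ⟨h1, h2, h3, h4⟩ := hX _ hj v hv _ (xX x hx)
    exact ⟨⟨h1, h2⟩, h3, (mz _).1 h4⟩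
  have xω : ∀ x ∈ M, N x ∈ J → ∀ v ∈ J, μ (T x v) = ω (N x) v (μ x) := by
    intro x hx hj v hv
    have := hω _ hj v hv (mk x)
    rwa [(xT x hx hj v hv).2.2, ml, ml] at this
  have m0 : ∀ x ∈ M, N x ≤ u0 → μ x < s := by
    intro x hx hl
    show N (H x) < s
    rw [eH x (hdd x hx.1).1]; exact hqq x (hl.trans u0q)
  have m1 : ∀ x ∈ M, u1 ≤ N x → s < μ x := by
    intro x hx hl
    by_contra hcon
    have h2 : N (H x) ≤ s := not_lt.1 hcon
    have hxU := (hdd x hx.1).1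
    rw [eH x hxU] at h2
    have := (hcc _ (h2.trans sc)).2
    rw [hinv x hxU] at this
    linarith
  have cM : M ⊆ {x | N x ≤ d} := fun x hx => hx.1
  have clM : IsClosed M := (isClosed_le N_cont continuous_const).inter (isClosed_eq hfc continuous_const)
  obtain ⟨ψ, hψ⟩ : ∃ ψ : (Fin n → ℝ) → (Fin n → ℝ), ψ = fun x => if N x ≤ u0 then x else
      T x (u0 + (s - u0) * (μ x - μ (T x u0)) / (s - μ (T x u0))) := ⟨_, rfl⟩
  obtain ⟨p1, p2, p3⟩ := ABS (M := M) (ν := N) (μ := μ) (T := T) (J := J) (u0 := u0) (s := s) (u1 := u1)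
    N_cont.continuousOn (cμ.mono cM) hJ j0 j1 u0s (by linarith)
    (fun x hx hj v hv => (xT x hx hj v hv).1) (fun x hx hj v hv => (xT x hx hj v hv).2.1)
    (fun x hx hj => by simp only [T]; rw [hτ.id _ hj, pm])
    (fun x hx hj v hv v' hv' => by
      obtain ⟨-, h2, h3⟩ := xT x hx hj v hv
      show pr (τ (N (T x v)) v' (mk (T x v))) = pr (τ (N x) v' (mk x))
      rw [h2, ← h3, hτ.coc _ hj _ hv _ hv'])
    (fun x hx hj => by
      have hcp : IsCompact {w | ∃ z, X a (N x) z ∧ z (Fin.last n) = w} := by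
        have k : IsCompact {y | y ∈ M ∧ N y = N x} :=
          N_cpt (d := d) (clM.inter (isClosed_eq N_cont continuous_const)) fun y hy => hy.1.1
        have := k.image_of_continuousOn (cμ.mono fun y hy => hy.1.1)
        convert this using 1
        ext w
        constructor
        · rintro ⟨z, ⟨h1, h2, h3, h4⟩, rfl⟩
          exact ⟨pr z, ⟨⟨h1, h2⟩, h3⟩, h4.symm⟩
        · rintro ⟨y, ⟨h1, h2⟩, rfl⟩
          exact ⟨mk y, h2 ▸ xX y h1, ml y⟩
      have := hmono _ hj hcp u0 j0 u1 j1 (by linarith) (fun z hz => by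
        obtain ⟨h1, h2, h3, h4⟩ := hz
        have hM : pr z ∈ M := ⟨h1, h2⟩
        rw [← h3] at hj ⊢
        have e0 := xω _ hM hj u0 j0
        have e1 := xω _ hM hj u1 j1
        have t0 := xT _ hM hj u0 j0
        have t1 := xT _ hM hj u1 j1
        rw [h4]
        show ω _ _ (μ (pr z)) < ω _ _ (μ (pr z))
        rw [← e0, ← e1]
        exact (m0 _ t0.1 t0.2.1.le).trans (m1 _ t1.1 t1.2.1.ge)) (mk x) (xX x hx)
      rw [ml] at this
      exact this.congr fun v hv => (xω x hx hj v hv).symm)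
    m0 m1
    (by
      refine cpr.comp_continuousOn fun p hp => ?_
      have c1 := hτ.cont (N p.1) hp.1.2 p.2 hp.2 (mk p.1)
      have c2 : ContinuousWithinAt (fun p : (Fin n → ℝ) × ℝ => (N p.1, p.2, mk p.1)) ({x | x ∈ M ∧ N x ∈ J} ×ˢ J) p := by
        refine (N_cont.comp continuous_fst).continuousWithinAt.prodMk (continuous_snd.continuousWithinAt.prodMk ?_)
        exact ((cmk.mono fun (x : Fin n → ℝ) (hx : x ∈ M ∧ N x ∈ J) => hx.1.1).comp continuous_fst.continuousOn fun q hq => hq.1) p hp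
      exact ContinuousAt.comp_continuousWithinAt (g := fun p : ℝ × ℝ × (Fin (n + 1) → ℝ) => τ p.1 p.2.1 p.2.2)
        (f := fun p : (Fin n → ℝ) × ℝ => (N p.1, p.2, mk p.1)) c1 c2) hψ
  have DN : DF (N : (Fin n → ℝ) → ℝ) := N_df fun i => DF.proj i
  have dT : ∀ {v : (Fin n → ℝ) → ℝ}, DF v → ∀ i, DF fun x => T x (v x) i := fun hv i =>
    hτ.df DN hv dmk i.castSucc
  have dT0 : DF fun x => μ (T x u0) := N_df fun i => DF.comp (dH i) fun j => dT (DF.const u0) j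
  have dψ : ∀ i, DF fun x => ψ x i := by
    intro i
    have := DF.ite (D.le DN (DF.const u0)) (DF.proj i) (dT ((DF.const u0).add
      (((DF.const (s - u0)).mul (dμ.sub dT0)).div ((DF.const s).sub dT0))) i)
    convert this using 2 with x
    rw [hψ]; simp only; split_ifs <;> rfl
  have eF : ∀ (k : (Fin n → ℝ) → ℝ) x, x ∈ Fib k r a ↔ N x ≤ s ∧ k x = a := fun k x => by
    rw [hs, ← en_le hr.1]; rfl
  have sd : s ≤ d := by linarith
  have b1 : ∀ y ∈ Fib g r a, y ∈ V ∧ H' y ∈ {x | x ∈ M ∧ μ x ≤ s} ∧ H (H' y) = y := by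
    intro y hy
    rw [eF] at hy
    obtain ⟨yV, yu⟩ := hcc y (hy.1.trans sc)
    have h1 := hdd (h' y) (by linarith)
    have e := hinv' y yV
    rw [eH' y yV, eH _ h1.1, e]
    refine ⟨yV, ⟨⟨by linarith, (h1.2 a ha.1).2 (by rw [e]; exact hy.2)⟩, ?_⟩, rfl⟩
    show N (H (h' y)) ≤ s
    rw [eH _ h1.1, e]; exact hy.1
  have b2 : ∀ x ∈ {x | x ∈ M ∧ μ x ≤ s}, H x ∈ Fib g r a ∧ H' (H x) = x := by
    intro x hx
    have h1 := hdd x hx.1.1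
    have h2 : N (H x) ≤ s := hx.2
    rw [eF]
    rw [eH x h1.1] at h2 ⊢
    exact ⟨⟨h2, (h1.2 a ha.1).1 hx.1.2⟩, by rw [eH' _ (hmaps h1.1), hinv x h1.1]⟩
  have sK : Fib g r a = {x | N x ≤ s ∧ g x = a} := Set.ext fun x => eF g x
  refine homeo_cpt (Φ := fun y => ψ (H' y)) ?_ ?_ ?_ ?_ ?_ fun i => DF.comp (dψ i) dH'
  · rw [sK]
    exact N_cpt (d := s) ((isClosed_le N_cont continuous_const).inter (isClosed_eq hgc continuous_const)) fun x hx => hx.1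
  · rw [sK]
    exact (D.le DN (DF.const s)).and (D.eq (dgc fun i => DF.proj i) (DF.const a))
  · refine p1.comp (f := H') ?_ fun y hy => (b1 y hy).2.1
    exact (hh'C.mono fun y hy => (b1 y hy).1).congr fun y hy => eH' y (b1 y hy).1
  · intro y hy y' hy' e
    have := p2 (b1 y hy).2.1 (b1 y' hy').2.1 e
    rw [← (b1 y hy).2.2, this, (b1 y' hy').2.2]
  · have e1 : H' '' Fib g r a = {x | x ∈ M ∧ μ x ≤ s} := by
      ext x
      constructor
      · rintro ⟨y, hy, rfl⟩; exact (b1 y hy).2.1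
      · intro hx; exact ⟨_, (b2 x hx).1, (b2 x hx).2⟩
    rw [← Set.image_image ψ H', e1, p3]
    ext x
    rw [eF]
    exact ⟨fun hx => ⟨hx.2, hx.1.2⟩, fun hx => ⟨⟨hx.1.trans sd, hx.2⟩, hx.1⟩⟩

end RealMilnor
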